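/- arXiv:1104.2454 — 2 statements merged into one kernel-verified Lean document; each statement's English description precedes it below -/
import Mathlib

section
/- Let K ∈ {−1,0,1} and let v be a solution of problem (P) satisfying ∫_{ℝ²₊} e^v < ∞. Then the Schwarzian map Q of v, which extends holomorphically to ℂ* = ℂ \ {0} by the reflection Q(z̄) = conj(Q(z)), is of the form Q(z) = c/z² for some constant c ∈ ℝ. -/
open Complex Set Filter MeasureTheory

/-- The Laplacian Δv = v_ss + v_tt of a function v : ℂ → ℝ, identifying ℂ ≅ ℝ². -/
noncomputable def lap (v : ℂ → ℝ) (z : ℂ) : ℝ :=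
  fderiv ℝ (fun w => fderiv ℝ v w 1) z 1 +
  fderiv ℝ (fun w => fderiv ℝ v w Complex.I) z Complex.I

/-- The boundary derivative ∂v/∂t at a real point s, taken within the closed upper
half-plane. -/
noncomputable def dnu (v : ℂ → ℝ) (s : ℝ) : ℝ :=
  fderivWithin ℝ v {w : ℂ | 0 ≤ w.im} (s : ℂ) Complex.I

/-- v_z = (v_s − i v_t)/2, with derivatives taken within the closed upper half-plane. -/
noncomputable def vzc (v : ℂ → ℝ) (z : ℂ) : ℂ :=
  (((fderivWithin ℝ v {w : ℂ | 0 ≤ w.im} z 1 : ℝ) : ℂ)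
    - Complex.I * ((fderivWithin ℝ v {w : ℂ | 0 ≤ w.im} z Complex.I : ℝ) : ℂ)) / 2

/-- The Schwarzian map Q = v_zz − (1/2) v_z² of a solution v of the Liouville equation. -/
noncomputable def schwarzianMap (v : ℂ → ℝ) (z : ℂ) : ℂ :=
  (fderivWithin ℝ (vzc v) {w : ℂ | 0 ≤ w.im} z 1
    - Complex.I * fderivWithin ℝ (vzc v) {w : ℂ | 0 ≤ w.im} z Complex.I) / 2
  - (vzc v z) ^ 2 / 2

/-- Problem (P): v ∈ C²(closure(ℝ²₊) \ {0}) with Δv + 2K e^v = 0 in ℝ²₊,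
∂v/∂t = c₁ e^{v/2} on {s > 0} and ∂v/∂t = c₂ e^{v/2} on {s < 0}. -/
def IsSolutionP (K c₁ c₂ : ℝ) (v : ℂ → ℝ) : Prop :=
  ContDiffOn ℝ 2 v ({z : ℂ | 0 ≤ z.im} \ {0}) ∧
  (∀ z : ℂ, 0 < z.im → lap v z + 2 * K * Real.exp (v z) = 0) ∧
  (∀ s : ℝ, 0 < s → dnu v s = c₁ * Real.exp (v (s : ℂ) / 2)) ∧
  (∀ s : ℝ, s < 0 → dnu v s = c₂ * Real.exp (v (s : ℂ) / 2))

lemma prim_bound {f F : ℂ → ℂ} (hF0 : F 0 = 0) (hF : ∀ x, HasDerivAt F (f x) x)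
    {c R : ℝ} {k : ℕ} (hf : ∀ w : ℂ, ‖w‖ ≤ R → ‖f w‖ ≤ c * (‖w‖ ^ k / k.factorial)) :
    ∀ w : ℂ, ‖w‖ ≤ R → ‖F w‖ ≤ c * (‖w‖ ^ (k+1) / (k+1).factorial) := by
  intro w hw
  have hd : ∀ t : ℝ, HasDerivAt (fun t : ℝ => F (t * w)) (f (t * w) * w) t := by
    intro t
    have h1 : HasDerivAt (fun t : ℝ => (t : ℂ) * w) w t := by
      simpa using (Complex.ofRealCLM.hasDerivAt (x := t)).mul_const w
    exact (hF (t * w)).comp t h1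
  have hB : ∀ t : ℝ, HasDerivAt (fun t : ℝ => c * ((t * ‖w‖) ^ (k+1) / (k+1).factorial))
      (c * ((t * ‖w‖) ^ k / k.factorial) * ‖w‖) t := by
    intro t
    have h1 : HasDerivAt (fun t : ℝ => t * ‖w‖) ‖w‖ t := by
      simpa using (hasDerivAt_id t).mul_const ‖w‖
    have h3 := ((h1.pow (k+1)).div_const ((k+1).factorial : ℝ)).const_mul c
    refine HasDerivAt.congr_deriv h3 ?_
    have : ((k.factorial : ℕ) : ℝ) ≠ 0 := by positivity
    rw [Nat.factorial_succ]
    push_cast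
    field_simp
  have key := image_norm_le_of_norm_deriv_right_le_deriv_boundary (a := 0) (b := 1)
    (f := fun t : ℝ => F (t * w)) (f' := fun t => f (t * w) * w)
    (B := fun t : ℝ => c * ((t * ‖w‖) ^ (k+1) / (k+1).factorial))
    (B' := fun t => c * ((t * ‖w‖) ^ k / k.factorial) * ‖w‖)
    (fun t _ => (hd t).continuousAt.continuousWithinAt)
    (fun t _ => (hd t).hasDerivWithinAt) (by simp [hF0]) hB
    (by
      intro t ht
      rw [norm_mul]
      gcongr
      have h2 : ‖(t : ℂ) * w‖ = t * ‖w‖ := by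
        rw [norm_mul, Complex.norm_of_nonneg ht.1]
      rw [← h2]
      apply hf
      rw [h2]
      nlinarith [ht.1, ht.2, norm_nonneg w])
  simpa using key (x := 1) (by simp)

theorem exists_entire_sol (p : ℂ → ℂ) (hp : Differentiable ℂ p) (a b : ℂ) :
    ∃ y y' : ℂ → ℂ, (∀ w, HasDerivAt y (y' w) w) ∧ (∀ w, HasDerivAt y' (p w * y w) w) ∧
      y 0 = a ∧ y' 0 = b := by
  have hJ : ∀ f : {f : ℂ → ℂ // Differentiable ℂ f}, ∃ F : {f : ℂ → ℂ // Differentiable ℂ f},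
      F.1 0 = 0 ∧ ∀ x, HasDerivAt F.1 (f.1 x) x := by
    intro f
    obtain ⟨g, h0, hg⟩ := f.2.isExactOn_univ.with_val_at 0 0
    exact ⟨⟨g, fun x => (hg x trivial).differentiableAt⟩, h0, fun x => hg x trivial⟩
  choose J hJ0 hJ' using hJ
  let f : ℕ → {f : ℂ → ℂ // Differentiable ℂ f} := fun n => Nat.rec
    ⟨fun w => a + b * w, by fun_prop⟩
    (fun _ g => J (J ⟨fun w => p w * g.1 w, hp.mul g.2⟩)) n
  let G : ℕ → {f : ℂ → ℂ // Differentiable ℂ f} := fun n =>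
    J ⟨fun w => p w * (f n).1 w, hp.mul (f n).2⟩
  have f0 : (f 0).1 = fun w => a + b * w := rfl
  have fs : ∀ n, f (n+1) = J (G n) := fun n => rfl
  let d : ℕ → ℂ → ℂ := fun n => Nat.casesOn n (fun _ => b) (fun n => (G n).1)
  let e : ℕ → ℂ → ℂ := fun n => Nat.casesOn n (fun _ => 0) (fun n w => p w * (f n).1 w)
  have hfd : ∀ n w, HasDerivAt (f n).1 (d n w) w := by
    intro n w
    cases n with
    | zero =>
      rw [f0]
      have := ((hasDerivAt_id w).const_mul b).const_add a
      simpa [d] using this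
    | succ n => rw [fs]; exact hJ' (G n) w
  have hde : ∀ n w, HasDerivAt (d n) (e n w) w := by
    intro n w
    cases n with
    | zero => exact hasDerivAt_const w b
    | succ n => exact hJ' ⟨fun w => p w * (f n).1 w, hp.mul (f n).2⟩ w
  -- bounds
  have bounds : ∀ R : ℝ, 0 < R → ∃ C M : ℝ, 1 ≤ M ∧ 0 ≤ C ∧ (∀ w, ‖w‖ ≤ R → ‖p w‖ ≤ M) ∧
      (∀ n w, ‖w‖ ≤ R → ‖(f n).1 w‖ ≤ C * M ^ n * (‖w‖ ^ (2*n) / (2*n).factorial)) ∧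
      (∀ n w, ‖w‖ ≤ R → ‖(G n).1 w‖ ≤ C * M ^ (n+1) * (‖w‖ ^ (2*n+1) / (2*n+1).factorial)) := by
    intro R hR
    obtain ⟨M0, hM0⟩ := (isCompact_closedBall (0:ℂ) R).exists_bound_of_continuousOn
      hp.continuous.continuousOn
    set M := max M0 1
    have hM : ∀ w, ‖w‖ ≤ R → ‖p w‖ ≤ M := fun w hw =>
      (hM0 w (by simpa using hw)).trans (le_max_left _ _)
    set C := ‖a‖ + ‖b‖ * R
    have hM1 : 1 ≤ M := le_max_right _ _
    have hC : 0 ≤ C := by positivity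
    have hG : ∀ n, (∀ w, ‖w‖ ≤ R → ‖(f n).1 w‖ ≤ C * M ^ n * (‖w‖ ^ (2*n) / (2*n).factorial)) →
        (∀ w, ‖w‖ ≤ R → ‖(G n).1 w‖ ≤ C * M ^ (n+1) * (‖w‖ ^ (2*n+1) / (2*n+1).factorial)) := by
      intro n hn
      apply prim_bound (hJ0 _) (hJ' _)
      intro w hw
      simp only [norm_mul]
      calc ‖p w‖ * ‖(f n).1 w‖ ≤ M * (C * M ^ n * (‖w‖ ^ (2*n) / (2*n).factorial)) := by
            gcongr
            · exact hM w hw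
            · exact hn w hw
        _ = _ := by ring
    have hf : ∀ n, (∀ w, ‖w‖ ≤ R → ‖(f n).1 w‖ ≤ C * M ^ n * (‖w‖ ^ (2*n) / (2*n).factorial)) := by
      intro n
      induction n with
      | zero =>
        intro w hw
        rw [f0]
        simp
        calc ‖a + b * w‖ ≤ ‖a‖ + ‖b‖ * ‖w‖ := by
              refine (norm_add_le _ _).trans ?_; rw [norm_mul]
          _ ≤ ‖a‖ + ‖b‖ * R := by gcongr
      | succ n ih =>
        rw [fs]
        exact prim_bound (hJ0 _) (hJ' _) (hG n ih)
    exact ⟨C, M, hM1, hC, hM, hf, fun n => hG n (hf n)⟩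
  -- summable bounds
  have sums : ∀ R : ℝ, 0 < R → ∃ U : ℕ → ℝ, Summable U ∧ (∀ n w, ‖w‖ ≤ R → ‖(f n).1 w‖ ≤ U n) ∧
      (∀ n w, ‖w‖ ≤ R → ‖d n w‖ ≤ U n) ∧ (∀ n w, ‖w‖ ≤ R → ‖e n w‖ ≤ U n) := by
    intro R hR
    obtain ⟨C, M, hM, hC, hpM, h1, h2⟩ := bounds R hR
    have s1 : Summable (fun n : ℕ => C * ((M * R) ^ (2*n) / (2*n).factorial)) :=
      ((Real.summable_pow_div_factorial (M*R)).comp_injective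
        (i := fun n : ℕ => 2 * n) (fun a b h => by simpa using h)).mul_left C
    have s2 : Summable (fun n : ℕ => C * M * ((M * R) ^ (2*n+1) / (2*n+1).factorial)) :=
      ((Real.summable_pow_div_factorial (M*R)).comp_injective
        (i := fun n : ℕ => 2 * n + 1) (fun a b h => by simpa using h)).mul_left (C * M)
    have b1 : ∀ n w, ‖w‖ ≤ R → ‖(f n).1 w‖ ≤ C * ((M * R) ^ (2*n) / (2*n).factorial) := by
      intro n w hw
      refine (h1 n w hw).trans ?_
      rw [mul_assoc]
      gcongr
      rw [mul_pow, mul_div_assoc]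
      gcongr
      omega
    have b2 : ∀ n w, ‖w‖ ≤ R → ‖(G n).1 w‖ ≤ C * M * ((M * R) ^ (2*n+1) / (2*n+1).factorial) := by
      intro n w hw
      refine (h2 n w hw).trans ?_
      have : M ^ (n+1) * (‖w‖ ^ (2*n+1) / (2*n+1).factorial) ≤
          M * ((M * R) ^ (2*n+1) / (2*n+1).factorial) := by
        rw [mul_pow, mul_div_assoc, pow_succ', mul_assoc]
        gcongr
        omega
      calc _ = C * (M ^ (n+1) * (‖w‖ ^ (2*n+1) / (2*n+1).factorial)) := by ring
        _ ≤ C * (M * ((M * R) ^ (2*n+1) / (2*n+1).factorial)) := by gcongr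
        _ = _ := by ring
    let A : ℕ → ℝ := fun n => C * ((M * R) ^ (2*n) / (2*n).factorial)
    let D : ℕ → ℝ := fun n => Nat.casesOn n ‖b‖ (fun n => C * M * ((M * R) ^ (2*n+1) / (2*n+1).factorial))
    let E : ℕ → ℝ := fun n => Nat.casesOn n 0 (fun n => M * (C * ((M * R) ^ (2*n) / (2*n).factorial)))
    have sD : Summable D := (summable_nat_add_iff 1).1 s2
    have sE : Summable E := (summable_nat_add_iff 1).1 (s1.mul_left M)
    have A0 : ∀ n, 0 ≤ A n := fun n => by positivity
    have D0 : ∀ n, 0 ≤ D n := fun n => by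
      cases n with
      | zero => exact norm_nonneg b
      | succ n => exact mul_nonneg (by positivity) (by positivity)
    have E0 : ∀ n, 0 ≤ E n := fun n => by
      cases n with
      | zero => exact le_rfl
      | succ n => exact mul_nonneg (by positivity) (by positivity)
    refine ⟨fun n => A n + D n + E n, (s1.add sD).add sE, ?_, ?_, ?_⟩
    · intro n w hw
      have := b1 n w hw
      have h : ‖(f n).1 w‖ ≤ A n := this
      linarith [D0 n, E0 n]
    · intro n w hw
      have h : ‖d n w‖ ≤ D n := by
        cases n with
        | zero => exact le_rfl
        | succ n => exact b2 n w hw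
      linarith [A0 n, E0 n]
    · intro n w hw
      have h : ‖e n w‖ ≤ E n := by
        cases n with
        | zero => simp [e, E]
        | succ n =>
          simp only [e, E, norm_mul]
          gcongr
          · exact hpM w hw
          · exact b1 n w hw
      linarith [A0 n, D0 n]
  have summf : ∀ w, Summable (fun n => (f n).1 w) := by
    intro w
    obtain ⟨U, hU, h1, _⟩ := sums (‖w‖ + 1) (by positivity)
    exact Summable.of_norm_bounded hU (fun n => h1 n w (by linarith))
  have summd : ∀ w, Summable (fun n => d n w) := by
    intro w
    obtain ⟨U, hU, _, h1, _⟩ := sums (‖w‖ + 1) (by positivity)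
    exact Summable.of_norm_bounded hU (fun n => h1 n w (by linarith))
  refine ⟨fun w => ∑' n, (f n).1 w, fun w => ∑' n, d n w, ?_, ?_, ?_, ?_⟩
  · intro w
    obtain ⟨U, hU, _, h1, _⟩ := sums (‖w‖ + 1) (by positivity)
    exact hasDerivAt_tsum_of_isPreconnected hU (Metric.isOpen_ball (x := 0) (ε := ‖w‖ + 1))
      (convex_ball _ _).isPreconnected (fun n y _ => hfd n y)
      (fun n y hy => h1 n y (le_of_lt (by simpa using hy))) (y₀ := w) (by simp) (summf w) (by simp)
  · intro w
    obtain ⟨U, hU, _, _, h1⟩ := sums (‖w‖ + 1) (by positivity)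
    have := hasDerivAt_tsum_of_isPreconnected hU (Metric.isOpen_ball (x := 0) (ε := ‖w‖ + 1))
      (convex_ball _ _).isPreconnected (fun n y _ => hde n y)
      (fun n y hy => h1 n y (le_of_lt (by simpa using hy))) (y₀ := w) (by simp) (summd w) (y := w) (by simp)
    have he : ∑' n, e n w = p w * ∑' n, (f n).1 w := by
      have hs : Summable (fun n => e n w) :=
        Summable.of_norm_bounded hU (fun n => h1 n w (by linarith))
      rw [hs.tsum_eq_zero_add, ← tsum_mul_left]
      simp [e]
    rwa [he] at this
  · show ∑' n, (f n).1 0 = a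
    rw [(summf 0).tsum_eq_zero_add, f0]
    have : ∀ n, (f (n+1)).1 0 = 0 := fun n => hJ0 (G n)
    simp [this]
  · show ∑' n, d n 0 = b
    rw [(summd 0).tsum_eq_zero_add]
    have : ∀ n, d (n+1) 0 = 0 := fun n => hJ0 _
    simp [this, d]

theorem bc_est {h h' h'' : ℂ → ℂ} (hd : ∀ w, HasDerivAt h (h' w) w)
    (hd' : ∀ w, HasDerivAt h' (h'' w) w) {w0 : ℂ} {R l : ℝ} (hR : 0 < R) (hl : 0 < l)
    (h1 : ∀ w ∈ Metric.ball w0 R, 1 ≤ ‖h w‖) (h0 : ‖h w0‖ ≤ Real.exp l) :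
    (∀ w ∈ Metric.closedBall w0 (R/2), ‖h w‖ ≤ Real.exp (3 * l)) ∧
    ‖h' w0‖ ≤ 4 * l / R * ‖h w0‖ ∧ ‖h'' w0‖ ≤ (16 * l / R^2 + 16 * l^2 / R^2) * ‖h w0‖ := by
  have hball : ∀ ζ ∈ Metric.ball (0:ℂ) R, w0 + ζ ∈ Metric.ball w0 R := by
    intro ζ hζ; simpa using hζ
  have hne : ∀ ζ ∈ Metric.ball (0:ℂ) R, h (w0 + ζ) ≠ 0 := by
    intro ζ hζ hz
    have := h1 _ (hball ζ hζ)
    rw [hz] at this; norm_num at this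
  have hsh : ∀ ζ, HasDerivAt (fun ζ => h (w0 + ζ)) (h' (w0 + ζ)) ζ := fun ζ =>
    (hd (w0 + ζ)).comp_const_add w0 ζ
  have hsh' : ∀ ζ, HasDerivAt (fun ζ => h' (w0 + ζ)) (h'' (w0 + ζ)) ζ := fun ζ =>
    (hd' (w0 + ζ)).comp_const_add w0 ζ
  set L : ℂ → ℂ := fun ζ => h' (w0 + ζ) / h (w0 + ζ) with hL
  have hLd : ∀ ζ ∈ Metric.ball (0:ℂ) R, HasDerivAt L
      ((h'' (w0+ζ) * h (w0 + ζ) - h' (w0 + ζ) * h' (w0+ζ)) / (h (w0 + ζ))^2) ζ := by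
    intro ζ hζ
    exact (hsh' ζ).div (hsh ζ) (hne ζ hζ)
  have hex : IsExactOn L (Metric.ball 0 R) :=
    DifferentiableOn.isExactOn_ball (fun ζ hζ => (hLd ζ hζ).differentiableAt.differentiableWithinAt)
  obtain ⟨H, H0, hH⟩ := hex.with_val_at 0 0
  have h00 : (0:ℂ) ∈ Metric.ball (0:ℂ) R := by simpa using hR
  have hconst : ∀ ζ ∈ Metric.ball (0:ℂ) R, h (w0 + ζ) * exp (-H ζ) = h w0 := by
    intro ζ hζ
    have hdd : ∀ ζ ∈ Metric.ball (0:ℂ) R, HasDerivAt (fun ζ => h (w0 + ζ) * exp (-H ζ)) 0 ζ := by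
      intro ζ hζ
      have := (hsh ζ).mul ((hH ζ hζ).neg.cexp)
      refine this.congr_deriv ?_
      have := hne ζ hζ
      simp only [hL]
      field_simp
      ring
    have := (convex_ball (0:ℂ) R).is_const_of_fderivWithin_eq_zero (𝕜 := ℂ)
      (f := fun ζ => h (w0 + ζ) * exp (-H ζ))
      (fun ζ hζ => (hdd ζ hζ).differentiableAt.differentiableWithinAt)
      (fun ζ hζ => by
        rw [fderivWithin_of_isOpen Metric.isOpen_ball hζ]
        have := (hdd ζ hζ).hasFDerivAt.fderiv
        rw [this]; ext; simp) hζ h00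
    simpa [H0] using this
  have hw0 : 1 ≤ ‖h w0‖ := h1 w0 (by simpa using hR)
  have hnorm : ∀ ζ ∈ Metric.ball (0:ℂ) R, ‖h (w0 + ζ)‖ = ‖h w0‖ * Real.exp ((H ζ).re) := by
    intro ζ hζ
    rw [← hconst ζ hζ, norm_mul, Complex.norm_exp, mul_assoc, ← Real.exp_add]
    simp
  have hre : ∀ ζ ∈ Metric.ball (0:ℂ) R, -l ≤ (H ζ).re := by
    intro ζ hζ
    have e1 := h1 _ (hball ζ hζ)
    rw [hnorm ζ hζ] at e1
    have e2 : Real.exp 0 ≤ Real.exp (l + (H ζ).re) := by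
      rw [Real.exp_add, Real.exp_zero]
      refine e1.trans ?_
      gcongr
    have := Real.exp_le_exp.1 e2
    linarith
  have hHd : DifferentiableOn ℂ H (Metric.ball 0 R) := fun ζ hζ =>
    (hH ζ hζ).differentiableAt.differentiableWithinAt
  have hbc : ∀ ζ ∈ Metric.closedBall (0:ℂ) (R/2), ‖H ζ‖ ≤ 2 * l := by
    intro ζ hζ
    have hζ2 : ‖ζ‖ ≤ R / 2 := by simpa using hζ
    have hζ' : ζ ∈ Metric.ball (0:ℂ) R := by
      simp; linarith
    have := Complex.borelCaratheodory_zero (f := fun ζ => - H ζ) hl hHd.neg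
      (fun z hz => by have := hre z hz; simp; linarith) hR hζ' (by simp [H0])
    rw [norm_neg] at this
    refine this.trans ?_
    rw [div_le_iff₀ (by linarith)]
    nlinarith
  have hdc : DiffContOnCl ℂ H (Metric.ball 0 (R/2)) := by
    apply DifferentiableOn.diffContOnCl
    rw [closure_ball _ (by positivity)]
    exact hHd.mono (Metric.closedBall_subset_ball (by linarith))
  have hsp : ∀ ζ ∈ Metric.sphere (0:ℂ) (R/2), ‖H ζ‖ ≤ 2 * l := fun ζ hζ =>
    hbc ζ (Metric.sphere_subset_closedBall hζ)
  have c1 := Complex.norm_iteratedDeriv_le_of_forall_mem_sphere_norm_le 1 (by positivity) hdc hsp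
  have c2 := Complex.norm_iteratedDeriv_le_of_forall_mem_sphere_norm_le 2 (by positivity) hdc hsp
  have d1 : deriv H 0 = L 0 := (hH 0 h00).deriv
  have hev : deriv H =ᶠ[nhds 0] L := by
    filter_upwards [Metric.isOpen_ball.mem_nhds h00] with ζ hζ
    exact (hH ζ hζ).deriv
  have d2 : iteratedDeriv 2 H 0 =
      ((h'' (w0+0) * h (w0 + 0) - h' (w0 + 0) * h' (w0+0)) / (h (w0 + 0))^2) := by
    rw [iteratedDeriv_succ, iteratedDeriv_one, hev.deriv_eq]
    exact (hLd 0 h00).deriv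
  rw [iteratedDeriv_one, d1] at c1
  rw [d2] at c2
  simp only [hL, add_zero, norm_div] at c1 c2
  have hw0p : 0 < ‖h w0‖ := by linarith
  have hw0n : h w0 ≠ 0 := norm_pos_iff.1 hw0p
  have r1 : ‖h' w0‖ ≤ 4 * l / R * ‖h w0‖ := by
    rw [div_le_iff₀ hw0p] at c1
    refine c1.trans (le_of_eq ?_)
    simp; field_simp; norm_num
  refine ⟨?_, r1, ?_⟩
  · intro w hw
    have hw2 : w - w0 ∈ Metric.closedBall (0:ℂ) (R/2) := by
      simpa [dist_eq_norm] using hw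
    have e := hnorm (w - w0) (Metric.closedBall_subset_ball (by linarith) hw2)
    rw [add_sub_cancel] at e
    rw [e]
    have := (re_le_norm _).trans (hbc _ hw2)
    calc _ ≤ Real.exp l * Real.exp (2 * l) := by gcongr
      _ = _ := by rw [← Real.exp_add]; ring_nf
  · have e1 : h'' w0 = ((h'' w0 * h w0 - h' w0 * h' w0) / (h w0)^2) * h w0 +
        (h' w0 / h w0) * (h' w0 / h w0) * h w0 := by
      field_simp; ring
    have c2' : ‖(h'' w0 * h w0 - h' w0 * h' w0) / (h w0)^2‖ ≤ 16 * l / R^2 := by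
      rw [norm_div]
      refine c2.trans (le_of_eq ?_)
      simp [Nat.factorial]; field_simp; norm_num
    have c1' : ‖h' w0 / h w0‖ ≤ 4 * l / R := by
      rw [norm_div, div_le_iff₀ hw0p]; exact r1
    rw [e1]
    refine (norm_add_le _ _).trans ?_
    rw [norm_mul _ (h w0), norm_mul _ (h w0), ← add_mul, norm_mul]
    gcongr
    calc _ ≤ (4 * l / R) * (4 * l / R) := by gcongr
      _ = _ := by ring

section C2

structure SolPair (p y1 z1 y2 z2 : ℂ → ℂ) : Prop where
  d1 : ∀ w, HasDerivAt y1 (z1 w) w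
  d1' : ∀ w, HasDerivAt z1 (p w * y1 w) w
  d2 : ∀ w, HasDerivAt y2 (z2 w) w
  d2' : ∀ w, HasDerivAt z2 (p w * y2 w) w
  wr : ∀ w, y1 w * z2 w - z1 w * y2 w = 1

noncomputable def uu (y1 y2 : ℂ → ℂ) (w : ℂ) : ℝ := normSq (y1 w) + normSq (y2 w)

variable {p y1 z1 y2 z2 : ℂ → ℂ}

lemma SolPair.upos (s : SolPair p y1 z1 y2 z2) (w : ℂ) : 0 < uu y1 y2 w := by
  have h := s.wr w
  by_contra hn
  have h1 := normSq_nonneg (y1 w)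
  have h2 := normSq_nonneg (y2 w)
  simp only [uu, not_lt] at hn
  have e1 : y1 w = 0 := normSq_eq_zero.1 (by linarith)
  have e2 : y2 w = 0 := normSq_eq_zero.1 (by linarith)
  simp [e1, e2] at h

lemma SolPair.ucont (s : SolPair p y1 z1 y2 z2) : Continuous (uu y1 y2) := by
  have h1 : Continuous y1 := continuous_iff_continuousAt.2 fun w => (s.d1 w).continuousAt
  have h2 : Continuous y2 := continuous_iff_continuousAt.2 fun w => (s.d2 w).continuousAt
  exact (continuous_normSq.comp h1).add (continuous_normSq.comp h2)

lemma SolPair.rotate (s : SolPair p y1 z1 y2 z2) (w1 : ℂ) :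
    ∃ h1 k1 h2 k2 : ℂ → ℂ, SolPair p h1 k1 h2 k2 ∧ (∀ w, uu h1 h2 w = uu y1 y2 w) ∧ h2 w1 = 0 := by
  set a := uu y1 y2 w1 with ha
  have hapos : 0 < a := s.upos w1
  set r : ℝ := Real.sqrt a
  have hr : 0 < r := Real.sqrt_pos.2 hapos
  have hr2 : r * r = a := Real.mul_self_sqrt hapos.le
  set α : ℂ := starRingEnd ℂ (y1 w1) / r with hα
  set β : ℂ := starRingEnd ℂ (y2 w1) / r with hβ
  have hrc : (r : ℂ) ≠ 0 := by exact_mod_cast hr.ne'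
  have hn : normSq α + normSq β = 1 := by
    rw [hα, hβ]
    simp only [map_div₀, normSq_conj, normSq_ofReal, ← add_div, hr2]
    exact div_self hapos.ne'
  have hn' : α * starRingEnd ℂ α + β * starRingEnd ℂ β = 1 := by
    rw [mul_conj, mul_conj]; exact_mod_cast hn
  refine ⟨fun w => α * y1 w + β * y2 w, fun w => α * z1 w + β * z2 w,
    fun w => - starRingEnd ℂ β * y1 w + starRingEnd ℂ α * y2 w,
    fun w => - starRingEnd ℂ β * z1 w + starRingEnd ℂ α * z2 w, ⟨?_, ?_, ?_, ?_, ?_⟩, ?_, ?_⟩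
  · exact fun w => ((s.d1 w).const_mul α).add ((s.d2 w).const_mul β)
  · exact fun w => (((s.d1' w).const_mul α).add ((s.d2' w).const_mul β)).congr_deriv (by ring)
  · exact fun w => ((s.d1 w).const_mul _).add ((s.d2 w).const_mul _)
  · exact fun w => (((s.d1' w).const_mul _).add ((s.d2' w).const_mul _)).congr_deriv (by ring)
  · intro w
    have := s.wr w
    linear_combination (α * starRingEnd ℂ α + β * starRingEnd ℂ β) * this + hn'
  · intro w
    have e : ∀ A B : ℂ, normSq (α * A + β * B) + normSq (-starRingEnd ℂ β * A + starRingEnd ℂ α * B)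
        = (normSq α + normSq β) * (normSq A + normSq B) := by
      intro A B
      simp [normSq_apply]
      ring
    simp only [uu, e, hn, one_mul]
  · simp only [hα, hβ, map_div₀, conj_conj, conj_ofReal]
    field_simp
    ring

lemma pathDeriv {h h' : ℂ → ℂ} (hd : ∀ w, HasDerivAt h (h' w) w) (w0 d : ℂ) (t : ℝ) :
    HasDerivAt (fun t : ℝ => h (w0 + t * d)) (h' (w0 + t * d) * d) t := by
  have h1 : HasDerivAt (fun t : ℝ => w0 + (t : ℂ) * d) d t := by
    simpa using ((Complex.ofRealCLM.hasDerivAt (x := t)).mul_const d).const_add w0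
  exact (hd _).comp t h1

lemma normSqDeriv {k : ℝ → ℂ} {k' : ℂ} {t : ℝ} (hk : HasDerivAt k k' t) :
    HasDerivAt (fun t => normSq (k t)) (2 * ((k t).re * k'.re + (k t).im * k'.im)) t := by
  have hr : HasDerivAt (fun t => (k t).re) k'.re t :=
    (Complex.reCLM.hasFDerivAt (x := k t)).comp_hasDerivAt t hk
  have hi : HasDerivAt (fun t => (k t).im) k'.im t :=
    (Complex.imCLM.hasFDerivAt (x := k t)).comp_hasDerivAt t hk
  have := (hr.mul hr).add (hi.mul hi)
  refine (this.congr_deriv (by ring))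

lemma SolPair.half (s : SolPair p y1 z1 y2 z2) {w1 : ℂ} (h0 : y2 w1 = 0) {m ρ : ℝ}
    (hm : 0 < m) (hρ : ρ ≤ m / 2) (hu : ∀ w ∈ Metric.ball w1 ρ, m ≤ uu y1 y2 w) :
    ∀ w ∈ Metric.ball w1 ρ, uu y1 y2 w / 2 ≤ normSq (y1 w) := by
  intro w hw
  set d := w - w1 with hd
  have hdn : ‖d‖ < ρ := by simpa [dist_eq_norm] using hw
  have hmem : ∀ t ∈ Icc (0:ℝ) 1, w1 + t * d ∈ Metric.ball w1 ρ := by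
    intro t ht
    have : ‖(t:ℂ) * d‖ < ρ := by
      rw [norm_mul, Complex.norm_of_nonneg ht.1]
      nlinarith [norm_nonneg d, ht.2]
    simpa [dist_eq_norm] using this
  set f : ℝ → ℝ := fun t => normSq (y1 (w1 + t * d)) / uu y1 y2 (w1 + t * d) with hf
  have hder : ∀ t : ℝ, HasDerivAt f
      (-2 * (starRingEnd ℂ (y1 (w1 + t * d)) * starRingEnd ℂ (y2 (w1 + t * d)) * d).re
        / (uu y1 y2 (w1 + t * d))^2) t := by
    intro t
    have e1 := normSqDeriv (pathDeriv s.d1 w1 d t)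
    have e2 := normSqDeriv (pathDeriv s.d2 w1 d t)
    have := e1.div (e1.add e2) (s.upos (w1 + t * d)).ne'
    refine this.congr_deriv ?_
    show _ / (uu y1 y2 (w1 + t * d))^2 = _
    congr 1
    simp only [Pi.add_apply]
    have hw := s.wr (w1 + t * d)
    generalize w1 + t * d = x at *
    have hre : (y1 x * z2 x - z1 x * y2 x).re = 1 := by rw [hw]; rfl
    have him : (y1 x * z2 x - z1 x * y2 x).im = 0 := by rw [hw]; rfl
    simp only [sub_re, sub_im, mul_re, mul_im] at hre him
    simp only [Pi.add_apply, normSq_apply, mul_re, mul_im, conj_re, conj_im]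
    generalize (y1 x).re = a at *
    generalize (y1 x).im = b at *
    generalize (y2 x).re = a2 at *
    generalize (y2 x).im = b2 at *
    linear_combination (-2 * ((a*a2 - b * b2) * d.re + (a * b2 + b * a2) * d.im)) * hre
      + (-2 * ((a*b2+b*a2) * d.re - (a * a2 - b * b2) * d.im)) * him
  have hbd : ∀ t ∈ Icc (0:ℝ) 1, ‖-2 * (starRingEnd ℂ (y1 (w1 + t * d)) *
      starRingEnd ℂ (y2 (w1 + t * d)) * d).re / (uu y1 y2 (w1 + t * d))^2‖ ≤ ‖d‖ / m := by
    intro t ht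
    have hux := hu _ (hmem t ht)
    generalize w1 + t * d = x at *
    have hup := s.upos x
    have h2 : 2 * (‖y1 x‖ * ‖y2 x‖) ≤ uu y1 y2 x := by
      simp only [uu, normSq_eq_norm_sq]
      nlinarith [sq_nonneg (‖y1 x‖ - ‖y2 x‖)]
    have h3 : |(starRingEnd ℂ (y1 x) * starRingEnd ℂ (y2 x) * d).re| ≤ ‖y1 x‖ * ‖y2 x‖ * ‖d‖ := by
      refine (abs_re_le_norm _).trans ?_
      simp
    rw [Real.norm_eq_abs, abs_div, abs_mul, abs_of_pos (pow_pos hup 2)]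
    rw [div_le_div_iff₀ (by positivity) hm]
    rw [show |(-2:ℝ)| = 2 by norm_num]
    calc 2 * |(starRingEnd ℂ (y1 x) * starRingEnd ℂ (y2 x) * d).re| * m
        ≤ 2 * (‖y1 x‖ * ‖y2 x‖ * ‖d‖) * uu y1 y2 x := by gcongr
      _ = 2 * (‖y1 x‖ * ‖y2 x‖) * (‖d‖ * uu y1 y2 x) := by ring
      _ ≤ uu y1 y2 x * (‖d‖ * uu y1 y2 x) := by gcongr
      _ = ‖d‖ * uu y1 y2 x ^ 2 := by ring
  have key := (convex_Icc (0:ℝ) 1).norm_image_sub_le_of_norm_hasDerivWithin_le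
    (fun t _ => (hder t).hasDerivWithinAt) hbd (by simp : (0:ℝ) ∈ Icc (0:ℝ) 1)
    (by simp : (1:ℝ) ∈ Icc (0:ℝ) 1)
  have hf0 : f 0 = 1 := by
    have := s.upos w1
    simp only [uu, h0, map_zero, add_zero] at this
    simp [hf, uu, h0, this.ne']
  have hf1 : f 1 = normSq (y1 w) / uu y1 y2 w := by simp [hf, hd]
  rw [hf0, hf1] at key
  simp only [sub_zero, norm_one, mul_one, Real.norm_eq_abs] at key
  have h4 : ‖d‖ / m ≤ 1/2 := by
    rw [div_le_iff₀ hm]; linarith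
  have h5 := (abs_le.1 (key.trans h4)).1
  have h6 : 1/2 ≤ normSq (y1 w) / uu y1 y2 w := by linarith
  rw [le_div_iff₀ (s.upos w)] at h6
  linarith

end C2

section C3
variable {p y1 z1 y2 z2 : ℂ → ℂ}

lemma heinz_lower (s : SolPair p y1 z1 y2 z2) {w1 : ℂ} {a : ℝ} (ha : uu y1 y2 w1 = a)
    (hu : ∀ w ∈ Metric.ball w1 (a/4), a/2 ≤ uu y1 y2 w) :
    ∀ w ∈ Metric.ball w1 (a/8), uu y1 y2 w ≤ 32 * a := by
  have hapos : 0 < a := ha ▸ s.upos w1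
  obtain ⟨h1, k1, h2, k2, S, hS, h20⟩ := s.rotate w1
  have hu' : ∀ w ∈ Metric.ball w1 (a/4), a/2 ≤ uu h1 h2 w := fun w hw => by rw [hS]; exact hu w hw
  have hh := S.half h20 (m := a/2) (ρ := a/4) (by linarith) (by linarith) hu'
  set r : ℝ := Real.sqrt a / 2 with hr
  have hrpos : 0 < r := by have := Real.sqrt_pos.2 hapos; positivity
  have hr2 : r ^ 2 = a / 4 := by rw [hr, div_pow, Real.sq_sqrt hapos.le]; norm_num
  have hn : ∀ w, ‖h1 w / r‖ ^ 2 = normSq (h1 w) / (a/4) := by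
    intro w
    rw [norm_div, div_pow, Complex.norm_of_nonneg hrpos.le, hr2, normSq_eq_norm_sq]
  have hb := bc_est (h := fun w => h1 w / r) (h' := fun w => k1 w / r) (h'' := fun w => p w * h1 w / r)
    (fun w => (S.d1 w).div_const _) (fun w => (S.d1' w).div_const _) (w0 := w1) (R := a/4)
    (l := Real.log 2) (by linarith) (Real.log_pos (by norm_num)) ?_ ?_
  · intro w hw
    have e := hb.1 w (by
      refine Metric.ball_subset_closedBall ?_
      convert hw using 1; ring_nf)
    have e8 : Real.exp (3 * Real.log 2) = 8 := by
      rw [mul_comm, Real.exp_mul, Real.exp_log (by norm_num)]; norm_num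
    rw [e8] at e
    have e2 : ‖h1 w / r‖ ^ 2 ≤ 8 ^ 2 := by gcongr
    rw [hn, div_le_iff₀ (by linarith)] at e2
    have := hh w (Metric.ball_subset_ball (by linarith) hw)
    rw [hS] at this
    linarith
  · intro w hw
    have := hh w hw
    have h2 := hu' w hw
    have : 1 ≤ ‖h1 w / r‖ ^ 2 := by
      rw [hn, le_div_iff₀ (by linarith)]; linarith
    by_contra hlt
    push Not at hlt
    have := norm_nonneg (h1 w / r)
    nlinarith
  · rw [Real.exp_log (by norm_num)]
    have e : normSq (h1 w1) = a := by
      have := hS w1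
      rw [ha] at this
      simpa [uu, h20] using this
    have : ‖h1 w1 / r‖ ^ 2 = 2 ^ 2 := by
      rw [hn, e]; field_simp; norm_num
    have h0 := norm_nonneg (h1 w1 / r)
    show ‖h1 w1 / r‖ ≤ 2
    nlinarith

lemma SolPair.invint (s : SolPair p y1 z1 y2 z2) (w0 : ℂ) (r : ℝ) :
    IntegrableOn (fun w => (uu y1 y2 w ^ 2)⁻¹) (Metric.ball w0 r) := by
  have hc : Continuous (fun w => (uu y1 y2 w ^ 2)⁻¹) :=
    (s.ucont.pow 2).inv₀ fun w => (pow_pos (s.upos w) 2).ne'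
  exact (hc.continuousOn.integrableOn_compact (isCompact_closedBall w0 r)).mono_set
    Metric.ball_subset_closedBall

lemma heinz (s : SolPair p y1 z1 y2 z2) {w0 : ℂ} {r : ℝ} (hr : 0 < r)
    (hi : ∫ w in Metric.ball w0 r, (uu y1 y2 w ^ 2)⁻¹ < Real.pi / 65536) :
    2 * r ≤ uu y1 y2 w0 := by
  by_contra hlt
  push Not at hlt
  have hFc : Continuous (fun w => (r - ‖w - w0‖) / uu y1 y2 w) := by
    refine Continuous.div₀ (by fun_prop) s.ucont (fun w => (s.upos w).ne')
  obtain ⟨w1, hw1, hmax⟩ := (isCompact_closedBall w0 r).exists_isMaxOn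
    ⟨w0, Metric.mem_closedBall_self hr.le⟩ hFc.continuousOn
  set a := uu y1 y2 w1 with ha
  have hapos : 0 < a := s.upos w1
  obtain ⟨d, hd⟩ : ∃ d, r - ‖w1 - w0‖ = 2 * d := ⟨_, (mul_div_cancel₀ _ two_ne_zero).symm⟩
  have h0 := hmax (Metric.mem_closedBall_self hr.le)
  simp only [mem_setOf_eq, sub_self, norm_zero, sub_zero, hd, ← ha] at h0
  have h1 : 1/2 < r / uu y1 y2 w0 := by
    rw [lt_div_iff₀ (s.upos w0)]; linarith
  have h2 : a / 4 < d := by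
    have := h1.trans_le h0
    rw [lt_div_iff₀ hapos] at this
    linarith
  have hdpos : 0 < d := by linarith
  have hsub : Metric.ball w1 d ⊆ Metric.ball w0 r := by
    refine Metric.ball_subset_ball' ?_
    rw [dist_eq_norm]; linarith
  have hu : ∀ w ∈ Metric.ball w1 (a/4), a/2 ≤ uu y1 y2 w := by
    intro w hw
    have hw' : w ∈ Metric.ball w1 d := Metric.ball_subset_ball h2.le hw
    have e := hmax (Metric.ball_subset_closedBall (hsub hw'))
    simp only [mem_setOf_eq, hd, ← ha] at e
    have hn : d ≤ r - ‖w - w0‖ := by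
      have e1 : ‖w - w1‖ < d := by simpa [dist_eq_norm] using hw'
      have : ‖w - w0‖ ≤ ‖w - w1‖ + ‖w1 - w0‖ := by
        simpa using norm_add_le (w - w1) (w1 - w0)
      linarith
    have e2 : d / uu y1 y2 w ≤ 2 * d / a := (by
      have := s.upos w
      gcongr : d / uu y1 y2 w ≤ (r - ‖w - w0‖) / uu y1 y2 w).trans e
    rw [div_le_div_iff₀ (s.upos w) hapos] at e2
    have : d * a ≤ d * (2 * uu y1 y2 w) := by linarith
    linarith [le_of_mul_le_mul_left this hdpos]
  have hlow := heinz_lower s ha.symm hu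
  have e1 : ∫ w in Metric.ball w1 (a/8), (uu y1 y2 w ^ 2)⁻¹ ≤
      ∫ w in Metric.ball w0 r, (uu y1 y2 w ^ 2)⁻¹ := by
    refine setIntegral_mono_set (s.invint w0 r) ?_ ?_
    · exact Eventually.of_forall fun w => by have := s.upos w; positivity
    · exact ((Metric.ball_subset_ball (by linarith)).trans hsub).eventuallyLE
  have e2 : ((32 * a)^2)⁻¹ * (volume (Metric.ball w1 (a/8))).toReal ≤
      ∫ w in Metric.ball w1 (a/8), (uu y1 y2 w ^ 2)⁻¹ := by
    refine setIntegral_ge_of_const_le_real measurableSet_ball ?_ ?_ (s.invint _ _)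
    · exact measure_ball_lt_top.ne
    · intro w hw
      have := s.upos w
      have := hlow w hw
      gcongr
  rw [Complex.volume_ball] at e2
  simp only [ENNReal.toReal_mul, ENNReal.toReal_pow, ENNReal.toReal_ofReal (by linarith : 0 ≤ a/8),
    ENNReal.coe_toReal, NNReal.coe_real_pi] at e2
  have e3 : ((32 * a)^2)⁻¹ * ((a/8)^2 * Real.pi) = Real.pi / 65536 := by
    field_simp; norm_num
  linarith
end C3

section C4
variable {p y1 z1 y2 z2 : ℂ → ℂ}

lemma pointEst (s : SolPair p y1 z1 y2 z2) {w0 : ℂ}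
    (hu : ∀ w ∈ Metric.ball w0 16, 32 ≤ uu y1 y2 w) :
    ‖p w0‖ ≤ (Real.log (uu y1 y2 w0) + Real.log (uu y1 y2 w0) ^ 2) / 16 ∧
    ∃ D, HasDerivAt (fun t : ℝ => uu y1 y2 (w0 + t * 1)) D 0 ∧
      D ≤ uu y1 y2 w0 * Real.log (uu y1 y2 w0) / 4 := by
  obtain ⟨h1, k1, h2, k2, S, hS, h20⟩ := s.rotate w0
  have hu' : ∀ w ∈ Metric.ball w0 16, 32 ≤ uu h1 h2 w := fun w hw => by rw [hS]; exact hu w hw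
  have hh := S.half h20 (m := 32) (ρ := 16) (by norm_num) (by norm_num) hu'
  set U := uu y1 y2 w0 with hU
  have hU32 : 32 ≤ U := hu w0 (Metric.mem_ball_self (by norm_num))
  have hUpos : 0 < U := by linarith
  set l := Real.log U / 2 with hl
  have hlpos : 0 < l := by
    have : 0 < Real.log U := Real.log_pos (by linarith)
    positivity
  have e : normSq (h1 w0) = U := by
    have := hS w0
    rw [← hU] at this
    simpa [uu, h20] using this
  have en : ‖h1 w0‖ ^ 2 = U := by rw [← normSq_eq_norm_sq, e]
  have hexp : ‖h1 w0‖ = Real.exp l := by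
    have : Real.exp l ^ 2 = U := by
      rw [← Real.exp_nat_mul, hl]
      push_cast
      rw [mul_div_cancel₀ _ (two_ne_zero), Real.exp_log hUpos]
    have h3 := Real.exp_pos l
    have h4 := norm_nonneg (h1 w0)
    nlinarith
  have hb := bc_est S.d1 S.d1' (w0 := w0) (R := 16) (l := l) (by norm_num) hlpos ?_ hexp.le
  · obtain ⟨_, hb1, hb2⟩ := hb
    have hnp : 0 < ‖h1 w0‖ := by rw [hexp]; exact Real.exp_pos l
    constructor
    · rw [norm_mul] at hb2
      have := le_of_mul_le_mul_right hb2 hnp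
      have hl2 : Real.log U = 2 * l := by rw [hl]; ring
      rw [hl2]
      nlinarith
    · have e1 := normSqDeriv (pathDeriv S.d1 w0 1 0)
      have e2 := normSqDeriv (pathDeriv S.d2 w0 1 0)
      have e3 := e1.add e2
      refine ⟨_, e3.congr_of_eventuallyEq (f₁ := fun t : ℝ => uu y1 y2 (w0 + t * 1)) ?_, ?_⟩
      · refine Eventually.of_forall fun t => ?_
        exact (hS (w0 + t * 1)).symm
      · simp only [ofReal_zero, zero_mul, add_zero, mul_one, h20, zero_re, zero_im]
        have h5 : (h1 w0).re * (k1 w0).re + (h1 w0).im * (k1 w0).im ≤ ‖h1 w0‖ * ‖k1 w0‖ := by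
          have : (h1 w0).re * (k1 w0).re + (h1 w0).im * (k1 w0).im
            = (starRingEnd ℂ (h1 w0) * k1 w0).re := by simp
          rw [this]
          refine (Complex.re_le_norm _).trans ?_
          simp
        have h6 : ‖h1 w0‖ * ‖k1 w0‖ ≤ ‖h1 w0‖ * (4 * l / 16 * ‖h1 w0‖) := by gcongr
        have h7 : ‖h1 w0‖ * (4 * l / 16 * ‖h1 w0‖) = U * (l / 4) := by rw [← en]; ring
        have hl2 : Real.log U = 2 * l := by rw [hl]; ring
        rw [hl2]
        linarith
  · intro w hw
    have h3 := hh w hw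
    have h2 := hu' w hw
    rw [normSq_eq_norm_sq] at h3
    by_contra hlt
    push Not at hlt
    have := norm_nonneg (h1 w)
    nlinarith

lemma log_growth (s : SolPair p y1 z1 y2 z2) {X : ℝ}
    (hX : ∀ w : ℂ, X ≤ w.re → |w.im| ≤ Real.pi → ∀ w' ∈ Metric.ball w 16, 32 ≤ uu y1 y2 w') :
    ∃ C, 0 ≤ C ∧ ∀ w : ℂ, X ≤ w.re → |w.im| ≤ Real.pi →
      Real.log (uu y1 y2 w) ≤ C * Real.exp (w.re / 4) := by
  have hlc : Continuous (fun w => Real.log (uu y1 y2 w)) :=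
    s.ucont.log fun w => (s.upos w).ne'
  have hcc : Continuous (fun y : ℝ => Real.log (uu y1 y2 (X + y * I))) :=
    hlc.comp (by fun_prop)
  obtain ⟨M, hM⟩ := (isCompact_Icc (a := -Real.pi) (b := Real.pi)).bddAbove_image hcc.continuousOn
  refine ⟨max M 0 * Real.exp (-(X/4)), by positivity, ?_⟩
  intro w hw hw2
  set y := w.im
  set g : ℝ → ℝ := fun t => Real.log (uu y1 y2 (t + y * I)) * Real.exp (-(t/4)) with hg
  have hgc : Continuous g := (hlc.comp (by fun_prop)).mul (by fun_prop)
  have hanti : AntitoneOn g (Ici X) := by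
    have key : ∀ t ∈ Ici X, ∃ D, HasDerivAt g D t ∧ D ≤ 0 := by
      intro t ht
      obtain ⟨_, D, hD, hD2⟩ := pointEst s (w0 := t + y * I)
        (hX _ (by simpa using ht) (by simpa using hw2))
      have h1 : HasDerivAt (fun τ : ℝ => uu y1 y2 (τ + y * I)) D t := by
        have h0 : HasDerivAt (fun τ : ℝ => τ - t) 1 t := (hasDerivAt_id t).sub_const t
        have hD' : HasDerivAt (fun t_1 : ℝ => uu y1 y2 ((t:ℂ) + y * I + t_1 * 1)) D (t - t) := by
          rw [sub_self]; exact hD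
        have := HasDerivAt.comp (h := fun τ : ℝ => τ - t) t hD' h0
        rw [mul_one] at this
        refine this.congr_of_eventuallyEq (Eventually.of_forall fun τ => ?_)
        simp only [Function.comp]
        congr 1
        push_cast; ring
      have h2 := (h1.log (s.upos _).ne').mul
        (((hasDerivAt_id t).div_const 4).neg.exp)
      refine ⟨_, h2, ?_⟩
      simp only [id]
      have hE := Real.exp_pos (-(t/4))
      have hp := s.upos (t + y * I)
      have : D / uu y1 y2 (t + y * I) ≤ Real.log (uu y1 y2 (t + y * I)) / 4 := by
        rw [div_le_iff₀ hp]; linarith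
      show _ * Real.exp (-(t/4)) + _ * (Real.exp (-(t/4)) * _) ≤ 0
      nlinarith
    refine antitoneOn_of_deriv_nonpos (convex_Ici X) hgc.continuousOn ?_ ?_
    · intro t ht
      rw [interior_Ici] at ht
      obtain ⟨D, hD, _⟩ := key t (mem_Ici.2 (le_of_lt ht))
      exact hD.differentiableAt.differentiableWithinAt
    · intro t ht
      rw [interior_Ici] at ht
      obtain ⟨D, hD, h0⟩ := key t (mem_Ici.2 (le_of_lt ht))
      rw [hD.deriv]; exact h0
  have h3 := hanti (mem_Ici.2 le_rfl) (mem_Ici.2 hw) hw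
  have hwe : (w.re : ℂ) + y * I = w := Complex.re_add_im w
  simp only [hg, hwe] at h3
  have h4 : Real.log (uu y1 y2 (X + y * I)) ≤ max M 0 :=
    (hM ⟨y, abs_le.1 hw2, rfl⟩).trans (le_max_left _ _)
  have h5 : Real.log (uu y1 y2 w) = Real.log (uu y1 y2 w) * Real.exp (-(w.re/4)) * Real.exp (w.re/4) := by
    rw [mul_assoc, ← Real.exp_add]; simp
  rw [h5]
  refine mul_le_mul_of_nonneg_right (h3.trans ?_) (Real.exp_pos _).le
  gcongr

lemma tail_small (s : SolPair p y1 z1 y2 z2)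
    (hi : IntegrableOn (fun w => (uu y1 y2 w ^ 2)⁻¹) {w : ℂ | |w.im| < Real.pi + 32}) :
    ∃ X : ℝ, ∀ w : ℂ, X ≤ w.re → |w.im| ≤ Real.pi →
      ∀ w' ∈ Metric.ball w 16, 32 ≤ uu y1 y2 w' := by
  set A : ℕ → Set ℂ := fun n => {w : ℂ | (n:ℝ) ≤ w.re ∧ |w.im| < Real.pi + 32} with hA
  have hAm : ∀ n, MeasurableSet (A n) := fun n =>
    (measurableSet_le measurable_const Complex.measurable_re).inter
      (measurableSet_lt (Complex.measurable_im.abs) measurable_const)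
  have hanti : Antitone A := by
    intro m n hmn w hw
    exact ⟨le_trans (by exact_mod_cast hmn) hw.1, hw.2⟩
  have ht := tendsto_setIntegral_of_antitone (μ := volume) hAm hanti
    ⟨0, hi.mono_set (fun w hw => hw.2)⟩
  have hempty : ⋂ n, A n = ∅ := by
    ext w
    simp only [mem_iInter, mem_empty_iff_false, iff_false, not_forall]
    obtain ⟨n, hn⟩ := exists_nat_gt w.re
    exact ⟨n, fun h => absurd h.1 (not_le.2 hn)⟩
  rw [hempty, setIntegral_empty] at ht
  obtain ⟨n, hn⟩ := (ht.eventually (gt_mem_nhds (by positivity : (0:ℝ) < Real.pi / 65536))).exists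
  refine ⟨n + 32, ?_⟩
  intro w hw hw2 w' hw'
  have := heinz s (w0 := w') (r := 16) (by norm_num) (lt_of_le_of_lt ?_ hn)
  · linarith
  · refine setIntegral_mono_set (hi.mono_set fun w hw => hw.2) ?_ ?_
    · exact Eventually.of_forall fun w => by have := s.upos w; positivity
    · refine LE.le.eventuallyLE ?_
      intro x hx
      have h1 : ‖x - w‖ < 32 := by
        have a1 : ‖x - w'‖ < 16 := by simpa [dist_eq_norm] using hx
        have a2 : ‖w' - w‖ < 16 := by simpa [dist_eq_norm] using hw'
        have := norm_add_le (x - w') (w' - w)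
        simp only [sub_add_sub_cancel] at this
        linarith
      have h2 := (abs_le.1 ((abs_re_le_norm (x - w)))).1
      have h3 := abs_im_le_norm (x - w)
      have h4 := abs_add_le (x - w).im w.im
      simp only [sub_re, sub_im, sub_add_cancel] at *
      exact ⟨by linarith, by linarith⟩

lemma p_growth (s : SolPair p y1 z1 y2 z2) (hp : Continuous p)
    (hi : IntegrableOn (fun w => (uu y1 y2 w ^ 2)⁻¹) {w : ℂ | |w.im| < Real.pi + 32}) :
    ∃ C, ∀ w : ℂ, 0 ≤ w.re → |w.im| ≤ Real.pi → ‖p w‖ ≤ C * Real.exp (w.re / 2) := by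
  obtain ⟨X, hX⟩ := tail_small s hi
  obtain ⟨C, hC, hl⟩ := log_growth s hX
  have hcomp : IsCompact (Icc 0 X ×ℂ Icc (-Real.pi) Real.pi) :=
    isCompact_Icc.reProdIm isCompact_Icc
  obtain ⟨M, hM⟩ := hcomp.bddAbove_image hp.norm.continuousOn
  refine ⟨max M ((C + C^2)/16), ?_⟩
  intro w hw hw2
  by_cases h : w.re ≤ X
  · have h1 : ‖p w‖ ≤ M := hM ⟨w, by
      rw [mem_reProdIm]; exact ⟨⟨hw, h⟩, abs_le.1 hw2⟩, rfl⟩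
    have h2 : 1 ≤ Real.exp (w.re/2) := Real.one_le_exp (by linarith)
    have h3 : 0 ≤ max M ((C + C^2)/16) := le_trans (by positivity) (le_max_right _ _)
    nlinarith [le_max_left M ((C + C^2)/16)]
  · push Not at h
    have h1 := (pointEst s (hX w h.le hw2)).1
    have h2 := hl w h.le hw2
    have h0 : 0 ≤ Real.log (uu y1 y2 w) := Real.log_nonneg (by
      have := hX w h.le hw2 w (Metric.mem_ball_self (by norm_num)); linarith)
    have e1 : Real.exp (w.re/4) ^ 2 = Real.exp (w.re/2) := by
      rw [← Real.exp_nat_mul]; congr 1; push_cast; ring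
    have e2 : 1 ≤ Real.exp (w.re/4) := Real.one_le_exp (by linarith)
    have h3 : Real.log (uu y1 y2 w) ^ 2 ≤ (C * Real.exp (w.re/4)) ^ 2 := by gcongr
    rw [mul_pow, e1] at h3
    have h4 : Real.exp (w.re/4) ≤ Real.exp (w.re/2) := Real.exp_le_exp.2 (by linarith)
    have h5 : C * Real.exp (w.re/4) ≤ C * Real.exp (w.re/2) := by gcongr
    have h6 : ‖p w‖ ≤ (C + C^2)/16 * Real.exp (w.re/2) := by linarith
    refine h6.trans ?_
    gcongr
    exact le_max_right _ _
end C4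

section C5
variable {p y1 z1 y2 z2 : ℂ → ℂ}

lemma SolPair.comp1 (s : SolPair p y1 z1 y2 z2) {f g : ℂ → ℂ} (hf : ∀ w, HasDerivAt f (g w) w)
    (hg : ∀ w, HasDerivAt g (p w * f w) w) :
    ∃ C, 0 ≤ C ∧ ∀ w, normSq (f w) ≤ C * uu y1 y2 w := by
  have h1 : ∀ w, HasDerivAt (fun w => f w * z2 w - g w * y2 w) 0 w := fun w =>
    (((hf w).mul (s.d2' w)).sub ((hg w).mul (s.d2 w))).congr_deriv (by ring)
  have h2 : ∀ w, HasDerivAt (fun w => y1 w * g w - z1 w * f w) 0 w := fun w =>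
    (((s.d1 w).mul (hg w)).sub ((s.d1' w).mul (hf w))).congr_deriv (by ring)
  have c1 := is_const_of_deriv_eq_zero (fun w => (h1 w).differentiableAt) (fun w => (h1 w).deriv)
  have c2 := is_const_of_deriv_eq_zero (fun w => (h2 w).differentiableAt) (fun w => (h2 w).deriv)
  set α := f 0 * z2 0 - g 0 * y2 0
  set β := y1 0 * g 0 - z1 0 * f 0
  refine ⟨normSq α + normSq β, add_nonneg (normSq_nonneg _) (normSq_nonneg _), fun w => ?_⟩
  have a1 : f w * z2 w - g w * y2 w = α := c1 w 0
  have a2 : y1 w * g w - z1 w * f w = β := c2 w 0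
  have e : f w = α * y1 w + β * y2 w := by
    rw [← a1, ← a2]; linear_combination (- f w) * s.wr w
  rw [e, uu]
  have : normSq (α * y1 w + β * y2 w) + normSq (α * starRingEnd ℂ (y2 w) - β * starRingEnd ℂ (y1 w))
    = (normSq α + normSq β) * (normSq (y1 w) + normSq (y2 w)) := by
    simp [normSq_apply]; ring
  rw [← this]
  linarith [normSq_nonneg (α * starRingEnd ℂ (y2 w) - β * starRingEnd ℂ (y1 w))]

lemma SolPair.comp2 (s : SolPair p y1 z1 y2 z2) {f1 g1 f2 g2 : ℂ → ℂ}
    (s' : SolPair p f1 g1 f2 g2) :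
    ∃ C, 0 ≤ C ∧ ∀ w, uu f1 f2 w ≤ C * uu y1 y2 w := by
  obtain ⟨C, hC, h⟩ := s.comp1 s'.d1 s'.d1'
  obtain ⟨C', hC', h'⟩ := s.comp1 s'.d2 s'.d2'
  exact ⟨C + C', by positivity, fun w => by
    have := h w; have := h' w; rw [uu]; linarith⟩

lemma conjDeriv {f : ℂ → ℂ} {f' w : ℂ} (h : HasDerivAt f f' (starRingEnd ℂ w)) :
    HasDerivAt (fun w => starRingEnd ℂ (f (starRingEnd ℂ w))) (starRingEnd ℂ f') w := by
  have := h.conj_conj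
  simpa [Function.comp_def] using this

lemma SolPair.conjPair (s : SolPair p y1 z1 y2 z2)
    (hp : ∀ w, p (starRingEnd ℂ w) = starRingEnd ℂ (p w)) :
    SolPair p (fun w => starRingEnd ℂ (y1 (starRingEnd ℂ w)))
      (fun w => starRingEnd ℂ (z1 (starRingEnd ℂ w)))
      (fun w => starRingEnd ℂ (y2 (starRingEnd ℂ w)))
      (fun w => starRingEnd ℂ (z2 (starRingEnd ℂ w))) where
  d1 w := conjDeriv (s.d1 _)
  d1' w := (conjDeriv (s.d1' _)).congr_deriv (by rw [map_mul, hp, conj_conj])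
  d2 w := conjDeriv (s.d2 _)
  d2' w := (conjDeriv (s.d2' _)).congr_deriv (by rw [map_mul, hp, conj_conj])
  wr w := by simp only [← map_mul, ← map_sub, s.wr, map_one]

lemma SolPair.shift (s : SolPair p y1 z1 y2 z2) (a : ℂ) (hp : ∀ w, p (w + a) = p w) :
    SolPair p (fun w => y1 (w + a)) (fun w => z1 (w + a)) (fun w => y2 (w + a))
      (fun w => z2 (w + a)) where
  d1 w := (s.d1 _).comp_add_const w a
  d1' w := ((s.d1' _).comp_add_const w a).congr_deriv (by rw [hp])
  d2 w := (s.d2 _).comp_add_const w a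
  d2' w := ((s.d2' _).comp_add_const w a).congr_deriv (by rw [hp])
  wr w := s.wr _

lemma SolPair.neg (s : SolPair p y1 z1 y2 z2) :
    SolPair (fun w => p (-w)) (fun w => y1 (-w)) (fun w => - z1 (-w)) (fun w => - y2 (-w))
      (fun w => z2 (-w)) where
  d1 w := (HasDerivAt.comp w (h := fun w => -w) (s.d1 (-w)) (hasDerivAt_neg w)).congr_deriv (by ring)
  d1' w := ((HasDerivAt.comp w (h := fun w => -w) (s.d1' (-w)) (hasDerivAt_neg w)).neg).congr_deriv
    (by ring)
  d2 w := ((HasDerivAt.comp w (h := fun w => -w) (s.d2 (-w)) (hasDerivAt_neg w)).neg).congr_deriv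
    (by ring)
  d2' w := ((HasDerivAt.comp w (h := fun w => -w) (s.d2' (-w)) (hasDerivAt_neg w))).congr_deriv
    (by ring)
  wr w := by linear_combination s.wr (-w)

lemma SolPair.transport (s : SolPair p y1 z1 y2 z2) {φ : ℂ → ℂ} (hφ : MeasurePreserving φ)
    (hme : MeasurableEmbedding φ) {C : ℝ} (hC : 0 ≤ C)
    (hle : ∀ w, uu y1 y2 (φ w) ≤ C * uu y1 y2 w)
    {A : Set ℂ} (hi : IntegrableOn (fun w => (uu y1 y2 w ^ 2)⁻¹) A) :
    IntegrableOn (fun w => (uu y1 y2 w ^ 2)⁻¹) (φ ⁻¹' A) := by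
  have h1 := (hφ.integrableOn_comp_preimage hme).2 hi
  have hc : Continuous (fun w => (uu y1 y2 w ^ 2)⁻¹) :=
    (s.ucont.pow 2).inv₀ fun w => (pow_pos (s.upos w) 2).ne'
  refine Integrable.mono' (h1.const_mul (C^2)) hc.aestronglyMeasurable ?_
  refine Eventually.of_forall fun w => ?_
  have hw := s.upos w
  have hw2 := s.upos (φ w)
  have h2 := hle w
  rw [Real.norm_of_nonneg (by positivity)]
  simp only [Function.comp]
  have h3 : uu y1 y2 (φ w) ^ 2 ≤ C^2 * uu y1 y2 w ^ 2 := by rw [← mul_pow]; gcongr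
  rw [← div_eq_mul_inv, le_div_iff₀ (by positivity), inv_mul_le_iff₀ (by positivity)]
  linarith

lemma vol_line (c : ℝ) : volume {w : ℂ | w.im = c} = 0 := by
  have : {w : ℂ | w.im = c} = measurableEquivRealProd ⁻¹' ((univ : Set ℝ) ×ˢ {c}) := by
    ext w; simp [measurableEquivRealProd]
  rw [this, volume_preserving_equiv_real_prod.measure_preimage
    (MeasurableSet.univ.prod (measurableSet_singleton c)).nullMeasurableSet,
    Measure.volume_eq_prod, Measure.prod_prod]
  simp

lemma SolPair.strip (s : SolPair p y1 z1 y2 z2)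
    (hp : ∀ w, p (starRingEnd ℂ w) = starRingEnd ℂ (p w))
    (hper : ∀ w, p (w + 2 * Real.pi * I) = p w)
    (hi : IntegrableOn (fun w => (uu y1 y2 w ^ 2)⁻¹) {w : ℂ | 0 < w.im ∧ w.im < Real.pi}) :
    IntegrableOn (fun w => (uu y1 y2 w ^ 2)⁻¹) {w : ℂ | |w.im| < Real.pi + 32} := by
  have hconj : IntegrableOn (fun w => (uu y1 y2 w ^ 2)⁻¹)
      ((starRingEnd ℂ) ⁻¹' {w : ℂ | 0 < w.im ∧ w.im < Real.pi}) := by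
    obtain ⟨C, hC, h⟩ := s.comp2 (s.conjPair hp)
    refine s.transport (φ := starRingEnd ℂ) ?_ ?_ hC ?_ hi
    · exact conjLIE.measurePreserving
    · exact conjLIE.toHomeomorph.measurableEmbedding
    · intro w
      have := h w
      simpa [uu, normSq_conj] using this
  have hnull : ∀ c, IntegrableOn (fun w => (uu y1 y2 w ^ 2)⁻¹) {w : ℂ | w.im = c} := by
    intro c
    rw [IntegrableOn, Measure.restrict_eq_zero.2 (vol_line c)]
    exact integrable_zero_measure
  have hmain : IntegrableOn (fun w => (uu y1 y2 w ^ 2)⁻¹) {w : ℂ | |w.im| ≤ Real.pi} := by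
    refine (((hi.union hconj).union (hnull 0)).union ((hnull Real.pi).union (hnull (-Real.pi)))).mono_set ?_
    intro w hw
    have := abs_le.1 (show |w.im| ≤ Real.pi from hw)
    simp only [mem_union, mem_preimage, conj_im]
    show (((0 < w.im ∧ w.im < Real.pi) ∨ (0 < -w.im ∧ -w.im < Real.pi)) ∨ w.im = 0) ∨
      (w.im = Real.pi ∨ w.im = - Real.pi)
    grind
  have hsh : ∀ k : ℤ, IntegrableOn (fun w => (uu y1 y2 w ^ 2)⁻¹)
      ((fun w : ℂ => w + k * (2 * Real.pi * I)) ⁻¹' {w : ℂ | |w.im| ≤ Real.pi}) := by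
    intro k
    have hk : ∀ w, p (w + k * (2 * Real.pi * I)) = p w :=
      Function.Periodic.int_mul (f := p) hper k
    obtain ⟨C, hC, h⟩ := s.comp2 (s.shift _ hk)
    refine s.transport (measurePreserving_add_right volume _) ?_ hC h hmain
    exact (Homeomorph.addRight _).measurableEmbedding
  have hfin := (integrableOn_finset_iUnion (s := Finset.Icc (-6:ℤ) 6)
    (t := fun k => (fun w : ℂ => w + k * (2 * Real.pi * I)) ⁻¹' {w : ℂ | |w.im| ≤ Real.pi})
    (f := fun w => (uu y1 y2 w ^ 2)⁻¹) (μ := volume)).2 (fun k _ => hsh k)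
  refine hfin.mono_set ?_
  intro w hw
  have hw' : |w.im| < Real.pi + 32 := hw
  have hpi3 := Real.pi_gt_three
  have hpi4 := Real.pi_lt_four
  set x := w.im / (2 * Real.pi) with hx
  have hxe : w.im = x * (2 * Real.pi) := by rw [hx]; field_simp
  have hr := abs_le.1 (abs_sub_round x)
  have hxx : -6.4 < x ∧ x < 6.4 := by
    have := abs_lt.1 hw'
    rw [hxe] at this
    constructor <;> nlinarith
  have hk1 : (-7:ℝ) < round x := by linarith
  have hk2 : (round x : ℝ) < 7 := by linarith
  have hk1' : (-7:ℤ) < round x := by exact_mod_cast hk1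
  have hk2' : round x < (7:ℤ) := by exact_mod_cast hk2
  simp only [mem_iUnion]
  refine ⟨-round x, Finset.mem_Icc.2 ⟨by omega, by omega⟩, ?_⟩
  show |(w + ((-round x : ℤ):ℂ) * (2 * Real.pi * I)).im| ≤ Real.pi
  have : (w + ((-round x : ℤ):ℂ) * (2 * Real.pi * I)).im = (x - round x) * (2 * Real.pi) := by
    simp [hxe]; ring
  rw [this, abs_le]
  constructor <;> nlinarith

/-- Two-sided growth bound for the potential. -/
lemma p_growth_two (s : SolPair p y1 z1 y2 z2) (hp : Continuous p)
    (hpc : ∀ w, p (starRingEnd ℂ w) = starRingEnd ℂ (p w))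
    (hper : ∀ w, p (w + 2 * Real.pi * I) = p w)
    (hi : IntegrableOn (fun w => (uu y1 y2 w ^ 2)⁻¹) {w : ℂ | 0 < w.im ∧ w.im < Real.pi}) :
    ∃ C, ∀ w : ℂ, |w.im| ≤ Real.pi → ‖p w‖ ≤ C * Real.exp (|w.re| / 2) := by
  have hst := s.strip hpc hper hi
  obtain ⟨C, hC⟩ := p_growth s hp hst
  have hst' : IntegrableOn (fun w => (uu (fun w => y1 (-w)) (fun w => -y2 (-w)) w ^ 2)⁻¹)
      {w : ℂ | |w.im| < Real.pi + 32} := by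
    have h1 := ((Measure.measurePreserving_neg (volume : Measure ℂ)).integrableOn_comp_preimage
      (Homeomorph.neg ℂ).measurableEmbedding).2 hst
    have e : (Neg.neg ⁻¹' {w : ℂ | |w.im| < Real.pi + 32}) = {w : ℂ | |w.im| < Real.pi + 32} := by
      ext w; simp
    rw [e] at h1
    simpa [uu, Function.comp_def] using h1
  obtain ⟨C', hC'⟩ := p_growth s.neg (hp.comp continuous_neg) hst'
  refine ⟨max C C', fun w hw => ?_⟩
  rcases le_total 0 w.re with h | h
  · rw [abs_of_nonneg h]
    refine (hC w h hw).trans ?_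
    gcongr
    exact le_max_left _ _
  · rw [abs_of_nonpos h]
    have := hC' (-w) (by simpa using h) (by simpa using hw)
    simp only [neg_neg, neg_re] at this
    refine this.trans ?_
    gcongr
    exact le_max_right _ _
end C5

lemma segInt {U : Set ℂ} {f G : ℂ → ℂ} {L : ℂ → ℂ →L[ℝ] ℂ} (hf : ∀ z ∈ U, HasFDerivAt f (L z) z)
    {γ : ℝ → ℂ} {e : ℂ} (hγ : ∀ x, HasDerivAt γ e x) {a b : ℝ} (hm : ∀ x ∈ uIcc a b, γ x ∈ U)
    (hG : ContinuousOn G U) (hGL : ∀ z ∈ U, G z = L z e) :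
    ∫ x in a..b, G (γ x) = f (γ b) - f (γ a) := by
  have hγc : Continuous γ := continuous_iff_continuousAt.2 fun x => (hγ x).continuousAt
  refine intervalIntegral.integral_eq_sub_of_hasDerivAt (f := fun x => f (γ x)) ?_ ?_
  · intro x hx
    rw [hGL _ (hm x hx)]
    exact (hf _ (hm x hx)).comp_hasDerivAt x (hγ x)
  · exact (hG.comp hγc.continuousOn hm).intervalIntegrable

lemma horDeriv (c : ℂ) (x : ℝ) : HasDerivAt (fun x : ℝ => (x : ℂ) + c) 1 x := by
  simpa using (Complex.ofRealCLM.hasDerivAt (x := x)).add_const c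

lemma verDeriv (c : ℂ) (x : ℝ) : HasDerivAt (fun x : ℝ => c + (x : ℂ) * I) I x := by
  simpa using ((Complex.ofRealCLM.hasDerivAt (x := x)).mul_const I).const_add c

lemma morera_aux {U : Set ℂ} (hU : IsOpen U) {Q f P R : ℂ → ℂ} {L LP LR : ℂ → ℂ →L[ℝ] ℂ}
    (hf : ∀ z ∈ U, HasFDerivAt f (L z) z) (hP : ∀ z ∈ U, HasFDerivAt P (LP z) z)
    (hR : ∀ z ∈ U, HasFDerivAt R (LR z) z) (hQ : ContinuousOn Q U)
    (h1 : ∀ z ∈ U, Q z = L z 1 + P z) (h2 : ∀ z ∈ U, I * Q z = L z I + I * R z)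
    (h3 : ∀ z ∈ U, - LP z I + I * LR z 1 = 0) : DifferentiableOn ℂ Q U := by
  rw [← isConservativeOn_and_continuousOn_iff_isDifferentiableOn hU]
  refine ⟨?_, hQ⟩
  have hPc : ContinuousOn P U := fun z hz => (hP z hz).continuousAt.continuousWithinAt
  have hRc : ContinuousOn R U := fun z hz => (hR z hz).continuousAt.continuousWithinAt
  intro z w hzw
  rw [← add_eq_zero_iff_eq_neg, wedgeIntegral_add_wedgeIntegral_eq]
  have hmem : ∀ x ∈ uIcc z.re w.re, ∀ y ∈ uIcc z.im w.im, (x : ℂ) + y * I ∈ U := by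
    intro x hx y hy
    apply hzw
    simp [Rectangle, mem_reProdIm, hx, hy]
  have hor : ∀ y ∈ uIcc z.im w.im, ∫ x in z.re..w.re, Q (x + y * I) =
      f (w.re + y * I) - f (z.re + y * I) + ∫ x in z.re..w.re, P (x + y * I) := by
    intro y hy
    have hcont : Continuous (fun x : ℝ => (x : ℂ) + y * I) := by fun_prop
    have hm : ∀ x ∈ uIcc z.re w.re, (x : ℂ) + y * I ∈ U := fun x hx => hmem x hx y hy
    have := segInt (G := fun z => Q z - P z) hf (horDeriv (y * I)) hm (hQ.sub hPc)
      (fun z hz => by rw [h1 z hz]; ring)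
    rw [intervalIntegral.integral_sub (f := fun x : ℝ => Q (x + y * I))
      (g := fun x : ℝ => P (x + y * I)) (hQ.comp hcont.continuousOn hm).intervalIntegrable
      (hPc.comp hcont.continuousOn hm).intervalIntegrable] at this
    rw [← this]; ring
  have ver : ∀ x ∈ uIcc z.re w.re, I * ∫ y in z.im..w.im, Q (x + y * I) =
      f (x + w.im * I) - f (x + z.im * I) + I * ∫ y in z.im..w.im, R (x + y * I) := by
    intro x hx
    have hcont : Continuous (fun y : ℝ => (x : ℂ) + y * I) := by fun_prop
    have hm : ∀ y ∈ uIcc z.im w.im, (x : ℂ) + y * I ∈ U := fun y hy => hmem x hx y hy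
    have := segInt (G := fun z => I * (Q z - R z)) hf (verDeriv x) hm
      (continuousOn_const.mul (hQ.sub hRc)) (fun z hz => by rw [mul_sub, h2 z hz]; ring)
    rw [intervalIntegral.integral_const_mul,
      intervalIntegral.integral_sub (f := fun y : ℝ => Q (x + y * I))
      (g := fun y : ℝ => R (x + y * I)) (hQ.comp hcont.continuousOn hm).intervalIntegrable
      (hRc.comp hcont.continuousOn hm).intervalIntegrable] at this
    rw [← this]; ring
  set e : ℝ × ℝ →L[ℝ] ℂ := (equivRealProdCLM.symm : (ℝ × ℝ) ≃L[ℝ] ℂ).toContinuousLinearMap with he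
  have hee : ∀ q : ℝ × ℝ, e q = q.1 + q.2 * I := fun q => equivRealProd_symm_apply q
  have hme : ∀ q ∈ uIcc z.re w.re ×ˢ uIcc z.im w.im, e q ∈ U := by
    intro q hq; rw [hee]; exact hmem _ hq.1 _ hq.2
  have hme' : ∀ q ∈ Ioo (min z.re w.re) (max z.re w.re) ×ˢ Ioo (min z.im w.im) (max z.im w.im),
      e q ∈ U := fun q hq => hme q ⟨Ioo_subset_Icc_self hq.1, Ioo_subset_Icc_self hq.2⟩
  have hzero : ∀ q ∈ uIcc z.re w.re ×ˢ uIcc z.im w.im,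
      (I • (LR (e q)).comp e) (1, 0) + (-(LP (e q)).comp e) (0, 1) = 0 := by
    intro q hq
    have e1 : e (1, 0) = 1 := by simp [hee]
    have e2 : e (0, 1) = I := by simp [hee]
    have := h3 _ (hme q hq)
    simp only [ContinuousLinearMap.smul_apply, ContinuousLinearMap.neg_apply,
      ContinuousLinearMap.comp_apply, e1, e2, smul_eq_mul]
    rw [add_comm]; exact this
  have key := integral2_divergence_prod_of_hasFDerivAt (fun q => I • R (e q)) (fun q => - P (e q))
    (fun q => I • (LR (e q)).comp e) (fun q => - (LP (e q)).comp e) z.re z.im w.re w.im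
    ((hRc.comp e.continuous.continuousOn hme).const_smul I)
    ((hPc.comp e.continuous.continuousOn hme).neg)
    (fun q hq => ((hR _ (hme' q hq)).comp q e.hasFDerivAt).const_smul I)
    (fun q hq => ((hP _ (hme' q hq)).comp q e.hasFDerivAt).neg)
    ((integrableOn_zero (μ := volume)).congr_fun (fun q hq => (hzero q hq).symm)
      (measurableSet_uIcc.prod measurableSet_uIcc))
  have hL : (∫ x in z.re..w.re, ∫ y in z.im..w.im, (I • (LR (e (x,y))).comp e) (1, 0) +
      (-(LP (e (x,y))).comp e) (0, 1)) = 0 := by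
    rw [intervalIntegral.integral_congr (g := fun _ => (0:ℂ)), intervalIntegral.integral_zero]
    intro x hx
    show (∫ y in z.im..w.im, _) = 0
    rw [intervalIntegral.integral_congr (g := fun _ => (0:ℂ)), intervalIntegral.integral_zero]
    intro y hy
    exact hzero (x, y) ⟨hx, hy⟩
  rw [hL] at key
  simp only [hee, intervalIntegral.integral_neg, smul_eq_mul, intervalIntegral.integral_const_mul] at key
  rw [hor _ left_mem_uIcc, hor _ right_mem_uIcc, smul_eq_mul, smul_eq_mul,
    ver _ left_mem_uIcc, ver _ right_mem_uIcc]
  linear_combination -key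

lemma morera_line {G : ℂ → ℂ} (hc : ContinuousOn G {0}ᶜ)
    (hd : DifferentiableOn ℂ G {z | z.im ≠ 0}) : DifferentiableOn ℂ G {0}ᶜ := by
  rw [← isConservativeOn_and_continuousOn_iff_isDifferentiableOn isOpen_compl_singleton]
  refine ⟨?_, hc⟩
  intro z w hzw
  rw [← add_eq_zero_iff_eq_neg, wedgeIntegral_add_wedgeIntegral_eq]
  have hmem : ∀ x ∈ uIcc z.re w.re, ∀ y ∈ uIcc z.im w.im, (x : ℂ) + y * I ∈ ({0}ᶜ : Set ℂ) := by
    intro x hx y hy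
    apply hzw
    simp [Rectangle, mem_reProdIm, hx, hy]
  have key : ∀ c d : ℝ, uIcc c d ⊆ uIcc z.im w.im → (∀ y ∈ Ioo (min c d) (max c d), y ≠ 0) →
      (∫ x : ℝ in z.re..w.re, G (x + c * I)) - (∫ x : ℝ in z.re..w.re, G (x + d * I)) +
      I • (∫ y : ℝ in c..d, G (w.re + y * I)) -
      I • (∫ y : ℝ in c..d, G (z.re + y * I)) = 0 := by
    intro c d hsub hne
    have := integral_boundary_rect_eq_zero_of_continuousOn_of_differentiableOn G
      (z.re + c * I) (w.re + d * I) ?_ ?_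
    · simpa using this
    · refine hc.mono ?_
      intro q hq
      simp only [mem_reProdIm, add_re, add_im, ofReal_re, ofReal_im, mul_re, mul_im, I_re, I_im,
        mul_zero, mul_one, sub_self, add_zero, zero_add] at hq
      have := hmem _ hq.1 _ (hsub hq.2)
      rwa [re_add_im] at this
    · refine hd.mono ?_
      intro q hq
      simp only [mem_reProdIm, add_re, add_im, ofReal_re, ofReal_im, mul_re, mul_im, I_re, I_im,
        mul_zero, mul_one, sub_self, add_zero, zero_add] at hq
      exact hne _ hq.2
  by_cases h0 : (0:ℝ) ∈ uIcc z.im w.im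
  · have h1 := key z.im 0 (uIcc_subset_uIcc left_mem_uIcc h0) (by
      intro y hy h; subst h
      rcases le_total z.im 0 with h | h
      · simp [h] at hy
      · simp [h] at hy)
    have h2 := key 0 w.im (uIcc_subset_uIcc h0 right_mem_uIcc) (by
      intro y hy h; subst h
      rcases le_total w.im 0 with h | h
      · simp [h] at hy
      · simp [h] at hy)
    have hintg : ∀ x ∈ uIcc z.re w.re, ∀ c ∈ uIcc z.im w.im, ∀ d ∈ uIcc z.im w.im,
        IntervalIntegrable (fun y : ℝ => G (x + y * I)) volume c d := by
      intro x hx c hc1 d hd1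
      refine ContinuousOn.intervalIntegrable ?_
      have hcont : Continuous (fun y : ℝ => (x : ℂ) + y * I) := by fun_prop
      exact hc.comp hcont.continuousOn (fun y hy => hmem x hx y (uIcc_subset_uIcc hc1 hd1 hy))
    have h3 := intervalIntegral.integral_add_adjacent_intervals
      (hintg _ left_mem_uIcc _ left_mem_uIcc _ h0) (hintg _ left_mem_uIcc _ h0 _ right_mem_uIcc)
    have h4 := intervalIntegral.integral_add_adjacent_intervals
      (hintg _ right_mem_uIcc _ left_mem_uIcc _ h0) (hintg _ right_mem_uIcc _ h0 _ right_mem_uIcc)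
    rw [← h3, ← h4]
    simp only [smul_eq_mul] at *
    linear_combination h1 + h2
  · exact key _ _ le_rfl (fun y hy h => h0 (h ▸ Ioo_subset_Icc_self hy))

lemma reflectQ {Q : ℂ → ℂ} (hQc : ContinuousOn Q ({z : ℂ | 0 ≤ z.im} \ {0}))
    (hQd : DifferentiableOn ℂ Q {z : ℂ | 0 < z.im}) (hre : ∀ s : ℝ, s ≠ 0 → (Q s).im = 0) :
    ∃ G : ℂ → ℂ, DifferentiableOn ℂ G {0}ᶜ ∧ (∀ z : ℂ, 0 ≤ z.im → z ≠ 0 → G z = Q z) ∧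
      ∀ z, G (starRingEnd ℂ z) = starRingEnd ℂ (G z) := by
  classical
  set G0 : ℂ → ℂ := fun z => if 0 ≤ z.im then Q z else starRingEnd ℂ (Q (starRingEnd ℂ z)) with hG0
  have hreal : ∀ z : ℂ, z ≠ 0 → z.im = 0 → starRingEnd ℂ (Q z) = Q z ∧ starRingEnd ℂ z = z := by
    intro z hz him
    have hz' : z = (z.re : ℂ) := by apply Complex.ext <;> simp [him]
    have hz2 : z.re ≠ 0 := fun h => hz (by rw [hz', h]; simp)
    constructor
    · rw [conj_eq_iff_im, hz']; exact hre _ hz2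
    · rw [conj_eq_iff_im]; exact him
  have hconjc : ContinuousOn (fun z => starRingEnd ℂ (Q (starRingEnd ℂ z))) ({z : ℂ | z.im ≤ 0} \ {0}) := by
    refine continuous_conj.comp_continuousOn (hQc.comp continuous_conj.continuousOn ?_)
    intro z hz
    refine ⟨?_, ?_⟩
    · have : z.im ≤ 0 := hz.1
      show 0 ≤ (starRingEnd ℂ z).im
      simpa using this
    · simpa using hz.2
  have hG0c : ContinuousOn G0 {0}ᶜ := by
    refine ContinuousOn.if ?_ ?_ ?_
    · rintro z ⟨hz, hf⟩
      rw [frontier_setOfPred_le_im] at hf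
      have hf' : z.im = 0 := hf
      obtain ⟨h1, h2⟩ := hreal z hz hf'
      rw [h2, h1]
    · refine hQc.mono ?_
      rintro z ⟨hz, hf⟩
      rw [(isClosed_le continuous_const continuous_im).closure_eq] at hf
      exact ⟨hf, hz⟩
    · refine hconjc.mono ?_
      rintro z ⟨hz, hf⟩
      simp only [not_le] at hf
      rw [closure_setOfPred_im_lt] at hf
      exact ⟨hf, hz⟩
  have hG0d : DifferentiableOn ℂ G0 {z | z.im ≠ 0} := by
    intro z hz
    refine DifferentiableAt.differentiableWithinAt ?_
    rcases lt_or_gt_of_ne (show z.im ≠ 0 from hz) with h | h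
    · have hop : IsOpen {z : ℂ | z.im < 0} := isOpen_lt continuous_im continuous_const
      have h1 : DifferentiableAt ℂ Q (starRingEnd ℂ z) :=
        hQd.differentiableAt ((isOpen_lt continuous_const continuous_im).mem_nhds
          (show 0 < (starRingEnd ℂ z).im by simpa using h))
      have h2 : DifferentiableAt ℂ (fun z => starRingEnd ℂ (Q (starRingEnd ℂ z))) z := by
        have := h1.hasDerivAt.conj_conj
        rw [conj_conj] at this
        exact this.differentiableAt
      refine h2.congr_of_eventuallyEq ?_
      filter_upwards [hop.mem_nhds h] with u hu
      simp only [hG0]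
      rw [if_neg (not_le.2 hu)]
    · have hop : IsOpen {z : ℂ | 0 < z.im} := isOpen_lt continuous_const continuous_im
      refine (hQd.differentiableAt (hop.mem_nhds h)).congr_of_eventuallyEq ?_
      filter_upwards [hop.mem_nhds h] with u hu
      simp only [hG0]
      rw [if_pos (le_of_lt hu)]
  have hG0' := morera_line hG0c hG0d
  refine ⟨fun z => if z = 0 then 0 else G0 z, ?_, ?_, ?_⟩
  · refine hG0'.congr ?_
    intro z hz
    exact if_neg hz
  · intro z hz h0
    simp [h0, hG0, hz]
  · intro z
    by_cases h0 : z = 0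
    · simp [h0]
    · simp only [h0, map_eq_zero, if_false, hG0, conj_im]
      rcases lt_trichotomy z.im 0 with h | h | h
      · rw [if_pos (by linarith), if_neg (by linarith), conj_conj]
      · obtain ⟨h1, h2⟩ := hreal z h0 h
        rw [if_pos (by linarith), if_pos (by linarith), h2, h1]
      · rw [if_neg (by linarith), if_pos (by linarith), conj_conj]

section M3

/-- closed upper half plane -/
abbrev SS : Set ℂ := {w : ℂ | 0 ≤ w.im}
abbrev UH : Set ℂ := {w : ℂ | 0 < w.im}

lemma SS_uniq : UniqueDiffOn ℝ SS := by
  refine uniqueDiffOn_convex (convex_halfSpace_im_ge 0) ?_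
  refine ⟨I, ?_⟩
  rw [interior_setOfPred_le_im]
  show (0:ℝ) < I.im
  simp

lemma UH_open : IsOpen UH := isOpen_lt continuous_const continuous_im

lemma SD_uniq : UniqueDiffOn ℝ (SS \ {0}) := by
  rw [sdiff_eq]
  exact SS_uniq.inter isOpen_compl_singleton

lemma fdw_eq {E : Type*} [NormedAddCommGroup E] [NormedSpace ℝ E] (f : ℂ → E) {z : ℂ} (hz : z ≠ 0) :
    fderivWithin ℝ f (SS \ {0}) z = fderivWithin ℝ f SS z := by
  rw [sdiff_eq]
  exact fderivWithin_inter (isOpen_compl_singleton.mem_nhds hz)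

lemma SS_nhds {z : ℂ} (hz : z ∈ UH) : SS ∈ nhds z :=
  mem_of_superset (UH_open.mem_nhds hz) fun w hw => le_of_lt (show 0 < w.im from hw)

lemma UH_sub : UH ⊆ SS \ {0} := fun w hw => ⟨le_of_lt (show 0 < w.im from hw), fun h => by
  have hw' : 0 < w.im := hw
  rw [h] at hw'; simp at hw'⟩

lemma SD_closure : SS \ {0} ⊆ closure UH := by
  intro w hw
  rw [closure_setOfPred_lt_im]
  exact hw.1

variable {K c₁ c₂ : ℝ} {v : ℂ → ℝ}

lemma v_fd_c1 (hv : IsSolutionP K c₁ c₂ v) : ContDiffOn ℝ 1 (fderivWithin ℝ v SS) (SS \ {0}) := by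
  have := hv.1.fderivWithin SD_uniq (m := 1) (by norm_num)
  exact this.congr fun z hz => (fdw_eq v hz.2).symm

lemma v_dir_c1 (hv : IsSolutionP K c₁ c₂ v) (h : ℂ) :
    ContDiffOn ℝ 1 (fun z => fderivWithin ℝ v SS z h) (SS \ {0}) :=
  (v_fd_c1 hv).clm_apply contDiffOn_const

lemma vzc_c1 (hv : IsSolutionP K c₁ c₂ v) : ContDiffOn ℝ 1 (vzc v) (SS \ {0}) := by
  have h1 := Complex.ofRealCLM.contDiff.comp_contDiffOn (v_dir_c1 hv 1)
  have h2 := Complex.ofRealCLM.contDiff.comp_contDiffOn (v_dir_c1 hv I)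
  exact (h1.sub (contDiffOn_const.mul h2)).div_const 2

lemma vzc_fd_cont (hv : IsSolutionP K c₁ c₂ v) :
    ContinuousOn (fderivWithin ℝ (vzc v) SS) (SS \ {0}) := by
  have := (vzc_c1 hv).continuousOn_fderivWithin SD_uniq (by norm_num)
  exact this.congr fun z hz => (fdw_eq _ hz.2).symm

lemma fd_of_c1 {E : Type*} [NormedAddCommGroup E] [NormedSpace ℝ E] {f : ℂ → E} {n : WithTop ℕ∞}
    (hn : n ≠ 0) (hf : ContDiffOn ℝ n f (SS \ {0})) {z : ℂ} (hz : z ∈ SS \ {0}) :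
    HasFDerivWithinAt f (fderivWithin ℝ f SS z) SS z := by
  have h := (hf z hz).differentiableWithinAt hn
  rw [sdiff_eq] at h
  have := (differentiableWithinAt_inter (isOpen_compl_singleton.mem_nhds hz.2)).1 h
  exact this.hasFDerivWithinAt

lemma vzc_re (z : ℂ) : (vzc v z).re = fderivWithin ℝ v SS z 1 / 2 := by
  simp [vzc]

lemma vzc_im (z : ℂ) : (vzc v z).im = - fderivWithin ℝ v SS z I / 2 := by
  simp [vzc]

lemma v_hfd (hv : IsSolutionP K c₁ c₂ v) {z : ℂ} (hz : z ∈ UH) :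
    HasFDerivAt v (fderivWithin ℝ v SS z) z :=
  (fd_of_c1 (by norm_num) hv.1 (UH_sub hz)).hasFDerivAt (SS_nhds hz)

lemma vzc_hfd (hv : IsSolutionP K c₁ c₂ v) {z : ℂ} (hz : z ∈ UH) :
    HasFDerivAt (vzc v) (fderivWithin ℝ (vzc v) SS z) z :=
  (fd_of_c1 (by norm_num) (vzc_c1 hv) (UH_sub hz)).hasFDerivAt (SS_nhds hz)

lemma dbar_int (hv : IsSolutionP K c₁ c₂ v) {z : ℂ} (hz : z ∈ UH) :
    fderivWithin ℝ (vzc v) SS z 1 + I * fderivWithin ℝ (vzc v) SS z I =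
      ((- K * Real.exp (v z) : ℝ) : ℂ) := by
  have hcd : ContDiffAt ℝ 2 v z := (hv.1 z (UH_sub hz)).contDiffAt
    (mem_of_superset (UH_open.mem_nhds hz) UH_sub)
  have hd2 : DifferentiableAt ℝ (fderiv ℝ v) z :=
    (hcd.fderiv_right (m := 1) (by norm_num)).differentiableAt (by norm_num)
  have hsymm : fderiv ℝ (fderiv ℝ v) z 1 I = fderiv ℝ (fderiv ℝ v) z I 1 :=
    (hcd.isSymmSndFDerivAt (by simp)) 1 I
  have hdir : ∀ h : ℂ, HasFDerivAt (fun w => fderiv ℝ v w h)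
      ((ContinuousLinearMap.apply ℝ ℝ h).comp (fderiv ℝ (fderiv ℝ v) z)) z := fun h =>
    (ContinuousLinearMap.apply ℝ ℝ h).hasFDerivAt.comp z hd2.hasFDerivAt
  have hlap := hv.2.1 z hz
  rw [lap, (hdir 1).fderiv, (hdir I).fderiv] at hlap
  simp only [ContinuousLinearMap.comp_apply, ContinuousLinearMap.apply_apply] at hlap
  have hev : vzc v =ᶠ[nhds z] fun w => ((fderiv ℝ v w 1 : ℝ) - I * (fderiv ℝ v w I : ℝ)) / 2 := by
    filter_upwards [UH_open.mem_nhds hz] with w hw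
    simp only [vzc]
    rw [show {w : ℂ | 0 ≤ w.im} = SS from rfl, fderivWithin_of_mem_nhds (SS_nhds hw)]
  have hL : HasFDerivAt (vzc v) ((2:ℂ)⁻¹ • (ofRealCLM.comp
      ((ContinuousLinearMap.apply ℝ ℝ 1).comp (fderiv ℝ (fderiv ℝ v) z))
      - I • ofRealCLM.comp ((ContinuousLinearMap.apply ℝ ℝ I).comp (fderiv ℝ (fderiv ℝ v) z)))) z := by
    have h1 := (ofRealCLM.hasFDerivAt.comp z (hdir 1)).sub
      ((ofRealCLM.hasFDerivAt.comp z (hdir I)).const_smul I)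
    refine (h1.const_smul (2:ℂ)⁻¹).congr_of_eventuallyEq (hev.trans ?_)
    refine Eventually.of_forall fun w => ?_
    simp [div_eq_inv_mul]
  have hu := (vzc_hfd hv hz).unique hL
  rw [hu]
  simp only [smul_apply, sub_apply, ContinuousLinearMap.comp_apply,
    ContinuousLinearMap.apply_apply, ofRealCLM_apply, smul_eq_mul]
  rw [hsymm]
  have h2 : (fderiv ℝ (fderiv ℝ v) z 1 1 : ℂ) + (fderiv ℝ (fderiv ℝ v) z I I : ℂ) +
      2 * K * Real.exp (v z) = 0 := by exact_mod_cast hlap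
  push_cast at *
  linear_combination (1/2 : ℂ) * h2 - (1/2:ℂ) * (fderiv ℝ (fderiv ℝ v) z I I : ℂ) * I_sq

lemma v_cont (hv : IsSolutionP K c₁ c₂ v) : ContinuousOn v (SS \ {0}) := hv.1.continuousOn

lemma dbar_bd (hv : IsSolutionP K c₁ c₂ v) :
    EqOn (fun z => fderivWithin ℝ (vzc v) SS z 1 + I * fderivWithin ℝ (vzc v) SS z I)
      (fun z => ((- K * Real.exp (v z) : ℝ) : ℂ)) (SS \ {0}) := by
  refine EqOn.of_subset_closure (s := UH) (fun z hz => dbar_int hv hz) ?_ ?_ UH_sub SD_closure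
  · have h1 := (vzc_fd_cont hv).clm_apply (continuousOn_const (c := (1:ℂ)))
    have h2 := (vzc_fd_cont hv).clm_apply (continuousOn_const (c := I))
    exact h1.add (continuousOn_const.mul h2)
  · exact continuous_ofReal.comp_continuousOn (continuousOn_const.mul (v_cont hv).rexp)

lemma Q_cont (hv : IsSolutionP K c₁ c₂ v) : ContinuousOn (schwarzianMap v) (SS \ {0}) := by
  have h1 := (vzc_fd_cont hv).clm_apply (continuousOn_const (c := (1:ℂ)))
  have h2 := (vzc_fd_cont hv).clm_apply (continuousOn_const (c := I))
  exact ((h1.sub (continuousOn_const.mul h2)).div_const 2).sub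
    (((vzc_c1 hv).continuousOn.pow 2).div_const 2)

lemma Q_eq (hv : IsSolutionP K c₁ c₂ v) {z : ℂ} (hz : z ∈ SS \ {0}) :
    schwarzianMap v z = fderivWithin ℝ (vzc v) SS z 1 +
      (((K/2) * Real.exp (v z) : ℝ) : ℂ) - (vzc v z)^2 / 2 := by
  have := dbar_bd hv hz
  simp only at this
  simp only [schwarzianMap]
  push_cast at *
  linear_combination (-1/2 : ℂ) * this

lemma Q_diff (hv : IsSolutionP K c₁ c₂ v) : DifferentiableOn ℂ (schwarzianMap v) UH := by
  set f := vzc v with hf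
  set L := fderivWithin ℝ (vzc v) SS with hL
  have hE : ∀ z ∈ UH, HasFDerivAt (fun z => (((K/2) * Real.exp (v z) : ℝ) : ℂ))
      (ofRealCLM.comp ((K/2) • (Real.exp (v z) • fderivWithin ℝ v SS z))) z := fun z hz =>
    ofRealCLM.hasFDerivAt.comp z ((v_hfd hv hz).exp.const_mul (K/2))
  have hsq : ∀ z ∈ UH, HasFDerivAt (fun z => f z ^ 2 / 2) (f z • L z) z := by
    intro z hz
    have h1 := ((vzc_hfd hv hz).mul (vzc_hfd hv hz)).const_mul (1/2 : ℂ)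
    refine (h1.congr_fderiv ?_).congr_of_eventuallyEq (Eventually.of_forall fun w => ?_)
    · ext h
      simp [hf, hL]
      ring
    · simp [hf]; ring
  refine morera_aux (f := f) (L := L)
    (P := fun z => (((K/2) * Real.exp (v z) : ℝ) : ℂ) - f z ^ 2 / 2)
    (R := fun z => -(((K/2) * Real.exp (v z) : ℝ) : ℂ) - f z ^ 2 / 2)
    UH_open (fun z hz => vzc_hfd hv hz)
    (fun z hz => (hE z hz).sub (hsq z hz)) (fun z hz => (hE z hz).neg.sub (hsq z hz))
    ((Q_cont hv).mono UH_sub) ?_ ?_ ?_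
  · intro z hz
    rw [Q_eq hv (UH_sub hz)]; ring
  · intro z hz
    rw [Q_eq hv (UH_sub hz)]
    have := dbar_int hv hz
    push_cast at *
    linear_combination I * this - L z I * I_sq
  · intro z hz
    have h1 := dbar_int hv hz
    have h2 : ((fderivWithin ℝ v SS z 1 : ℝ) : ℂ) - I * (fderivWithin ℝ v SS z I : ℝ) = 2 * f z := by
      simp only [hf, vzc]; ring
    simp only [smul_apply, sub_apply, neg_apply, ContinuousLinearMap.comp_apply,
      ofRealCLM_apply, smul_eq_mul]
    push_cast at *
    set a := ((fderivWithin ℝ v SS z 1 : ℝ) : ℂ)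
    set b := ((fderivWithin ℝ v SS z I : ℝ) : ℂ)
    linear_combination (-I * f z) * h1 + (f z * L z I - (K/2) * cexp (v z) * b) * I_sq
      - (I * (K/2) * cexp (v z)) * h2

lemma imDeriv {k : ℝ → ℂ} {k' : ℂ} {t : ℝ} (hk : HasDerivAt k k' t) :
    HasDerivAt (fun t => (k t).im) k'.im t :=
  (Complex.imCLM.hasFDerivAt (x := k t)).comp_hasDerivAt t hk

lemma Q_real (hv : IsSolutionP K c₁ c₂ v) {s : ℝ} (hs : s ≠ 0) : (schwarzianMap v s).im = 0 := by
  have hmem : ∀ t : ℝ, t ≠ 0 → (t : ℂ) ∈ SS \ {0} := fun t ht =>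
    ⟨by show 0 ≤ (t:ℂ).im; simp, by simpa using ht⟩
  have hγ : HasDerivAt (fun t : ℝ => (t : ℂ)) 1 s := by
    simpa using HasDerivAt.ofReal_comp (hasDerivAt_id s)
  have hvd : HasDerivAt (fun t : ℝ => v t) (fderivWithin ℝ v SS s 1) s := by
    have := (fd_of_c1 (by norm_num) hv.1 (hmem s hs)).comp_hasDerivAt s hγ
      (Eventually.of_forall fun t => by show 0 ≤ (t:ℂ).im; simp)
    exact this
  have hfd : HasDerivAt (fun t : ℝ => vzc v t) (fderivWithin ℝ (vzc v) SS s 1) s := by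
    have := (fd_of_c1 (by norm_num) (vzc_c1 hv) (hmem s hs)).comp_hasDerivAt s hγ
      (Eventually.of_forall fun t => by show 0 ≤ (t:ℂ).im; simp)
    exact this
  have him : HasDerivAt (fun t : ℝ => (vzc v t).im) (fderivWithin ℝ (vzc v) SS s 1).im s :=
    imDeriv hfd
  obtain ⟨c, hc⟩ : ∃ c : ℝ, ∀ᶠ t : ℝ in nhds s,
      fderivWithin ℝ v SS (t:ℂ) I = c * Real.exp (v t / 2) := by
    rcases lt_or_gt_of_ne hs with h | h
    · exact ⟨c₂, by filter_upwards [gt_mem_nhds h] with t ht using hv.2.2.2 t ht⟩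
    · exact ⟨c₁, by filter_upwards [lt_mem_nhds h] with t ht using hv.2.2.1 t ht⟩
  have him2 : HasDerivAt (fun t : ℝ => (vzc v t).im)
      (-(c * (Real.exp (v s / 2) * (fderivWithin ℝ v SS s 1 / 2))) / 2) s := by
    have h1 := (((hvd.div_const 2).exp.const_mul c).neg).div_const 2
    refine h1.congr_of_eventuallyEq ?_
    filter_upwards [hc] with t ht
    rw [vzc_im, ht]
    rfl
  have e := him.unique him2
  have hcs := hc.self_of_nhds
  rw [Q_eq hv (hmem s hs)]
  have e3 : ((vzc v s)^2 / 2).im = (vzc v s).re * (vzc v s).im := by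
    rw [show (vzc v s)^2 / 2 = (vzc v s)^2 * ((1/2 : ℝ) : ℂ) by push_cast; ring, Complex.im_mul_ofReal]
    rw [pow_two, mul_im]; ring
  rw [sub_im, add_im, e, ofReal_im, e3, vzc_re, vzc_im, hcs]
  ring

end M3

lemma conjPathDeriv {k : ℝ → ℂ} {k' : ℂ} {t : ℝ} (hk : HasDerivAt k k' t) :
    HasDerivAt (fun t => starRingEnd ℂ (k t)) (starRingEnd ℂ k') t :=
  (Complex.conjCLE.toContinuousLinearMap.hasFDerivAt (x := k t)).comp_hasDerivAt t hk

lemma m_deriv {K : ℝ} {V : ℝ → ℝ} {F y1 z1 y2 z2 : ℝ → ℂ} {q d : ℂ} {t : ℝ}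
    (hV : HasDerivAt V (2 * (F t * d).re) t)
    (hF : HasDerivAt F ((q + F t ^ 2 / 2) * d
      - (K / 2 : ℝ) * (Real.exp (V t) : ℝ) * starRingEnd ℂ d) t)
    (hy1 : HasDerivAt y1 (z1 t * d) t) (hz1 : HasDerivAt z1 (-(q/2) * y1 t * d) t)
    (hy2 : HasDerivAt y2 (z2 t * d) t) (hz2 : HasDerivAt z2 (-(q/2) * y2 t * d) t) :
    HasDerivAt (fun t => ((Real.exp (-(V t / 2)) : ℝ) : ℂ) *
        (starRingEnd ℂ (z1 t + F t / 2 * y1 t) * (z2 t + F t / 2 * y2 t)) +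
      (K/4 : ℝ) * (((Real.exp (V t / 2) : ℝ) : ℂ) * (starRingEnd ℂ (y1 t) * y2 t))) 0 t := by
  have ha1 := hz1.add ((hF.div_const 2).mul hy1)
  have ha2 := hz2.add ((hF.div_const 2).mul hy2)
  have hX := ((hV.div_const 2).exp).ofReal_comp
  have hY := ((hV.div_const 2).neg.exp).ofReal_comp
  have h := (hY.mul ((conjPathDeriv ha1).mul ha2)).add
    ((hX.mul ((conjPathDeriv hy1).mul hy2)).const_mul ((K/4 : ℝ) : ℂ))
  refine h.congr_deriv ?_
  have hre : ((F t * d).re : ℂ) = (F t * d + starRingEnd ℂ (F t) * starRingEnd ℂ d) / 2 := by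
    rw [← map_mul, Complex.re_eq_add_conj]
  have hYX : ((Real.exp (-(V t / 2)) : ℝ) : ℂ) * ((Real.exp (V t / 2) : ℝ) : ℂ) = 1 := by
    rw [← ofReal_mul, ← Real.exp_add]; simp
  have hXX : ((Real.exp (V t) : ℝ) : ℂ) = ((Real.exp (V t / 2) : ℝ) : ℂ) ^ 2 := by
    rw [← ofReal_pow, ← Real.exp_nat_mul]; congr 2; push_cast; ring
  simp only [Pi.add_apply, Pi.mul_apply, Pi.neg_apply, map_add, map_sub, map_mul, map_div₀, map_neg, map_pow,
    conj_conj, conj_ofReal, map_ofNat, ofReal_mul, ofReal_neg, ofReal_div, ofReal_ofNat, hre, hXX] at *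
  generalize ((Real.exp (-(V t / 2)) : ℝ) : ℂ) = Y at *
  generalize ((Real.exp (V t / 2) : ℝ) : ℂ) = X at *
  generalize F t = F0 at *
  generalize starRingEnd ℂ F0 = F1 at *
  linear_combination (-(K/4) * X * (starRingEnd ℂ (y1 t) * (z2 t + F0 / 2 * y2 t) * d +
    (starRingEnd ℂ (z1 t) + F1 / 2 * starRingEnd ℂ (y1 t)) * y2 t * starRingEnd ℂ d)) * hYX

abbrev strip : Set ℂ := {w : ℂ | 0 < w.im ∧ w.im < Real.pi}

noncomputable def VV (v : ℂ → ℝ) (w : ℂ) : ℝ := v (cexp w) + 2 * w.re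
noncomputable def FF (v : ℂ → ℝ) (w : ℂ) : ℂ := cexp w * vzc v (cexp w) + 1
noncomputable def mm (K : ℝ) (v : ℂ → ℝ) (y1 z1 y2 z2 : ℂ → ℂ) (w : ℂ) : ℂ :=
  ((Real.exp (-(VV v w / 2)) : ℝ) : ℂ) *
        (starRingEnd ℂ (z1 w + FF v w / 2 * y1 w) * (z2 w + FF v w / 2 * y2 w)) +
      (K/4 : ℝ) * (((Real.exp (VV v w / 2) : ℝ) : ℂ) * (starRingEnd ℂ (y1 w) * y2 w))

lemma exp_strip {w : ℂ} (hw : w ∈ strip) : cexp w ∈ UH := by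
  show 0 < (cexp w).im
  rw [exp_im]
  exact mul_pos (Real.exp_pos _) (Real.sin_pos_of_pos_of_lt_pi hw.1 hw.2)

lemma strip_convex : Convex ℝ strip :=
  (convex_halfSpace_im_gt 0).inter (convex_halfSpace_im_lt Real.pi)

lemma clm_decomp (L : ℂ →L[ℝ] ℂ) (h : ℂ) :
    L h = (L 1 - I * L I) / 2 * h + (L 1 + I * L I) / 2 * starRingEnd ℂ h := by
  have e : h = h.re • (1:ℂ) + h.im • I := by
    simp [Complex.re_add_im]
  have e1 : L h = h.re * L 1 + h.im * L I := by
    conv_lhs => rw [e, map_add, map_smul, map_smul]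
    simp
  rw [e1]
  have e3 : starRingEnd ℂ h = h.re - h.im * I := by
    apply Complex.ext <;> simp
  have e4 : (L 1 - I * L I) / 2 * h = (L 1 - I * L I) / 2 * (h.re + h.im * I) := by
    rw [Complex.re_add_im]
  rw [e3, e4]
  linear_combination (h.im * L I) * I_sq

lemma reDeriv {k : ℝ → ℂ} {k' : ℂ} {t : ℝ} (hk : HasDerivAt k k' t) :
    HasDerivAt (fun t => (k t).re) k'.re t :=
  (Complex.reCLM.hasFDerivAt (x := k t)).comp_hasDerivAt t hk

section U2
variable {K c₁ c₂ : ℝ} {v : ℂ → ℝ} {p : ℂ → ℂ}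

lemma mm_const (hv : IsSolutionP K c₁ c₂ v)
    (hp : ∀ w ∈ strip, p w = -((cexp (2 * w) * schwarzianMap v (cexp w) - 1/2) / 2))
    {y1 z1 y2 z2 : ℂ → ℂ} (hy1 : ∀ w, HasDerivAt y1 (z1 w) w)
    (hz1 : ∀ w, HasDerivAt z1 (p w * y1 w) w)
    (hy2 : ∀ w, HasDerivAt y2 (z2 w) w) (hz2 : ∀ w, HasDerivAt z2 (p w * y2 w) w)
    {w0 w : ℂ} (hw0 : w0 ∈ strip) (hw : w ∈ strip) :
    mm K v y1 z1 y2 z2 w = mm K v y1 z1 y2 z2 w0 := by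
  set d := w - w0 with hd
  have hmem : ∀ t ∈ Icc (0:ℝ) 1, w0 + t * d ∈ strip := by
    intro t ht
    have := strip_convex.add_smul_sub_mem hw0 hw ht
    rw [real_smul] at this
    exact this
  have key : ∀ t ∈ Icc (0:ℝ) 1, HasDerivAt (fun t : ℝ => mm K v y1 z1 y2 z2 (w0 + t * d)) 0 t := by
    intro t ht
    have hm := hmem t ht
    have hU := exp_strip hm
    have hexp := pathDeriv (fun w => Complex.hasDerivAt_exp w) w0 d t
    have hγ : HasDerivAt (fun t : ℝ => w0 + (t : ℂ) * d) d t := by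
      simpa using ((Complex.ofRealCLM.hasDerivAt (x := t)).mul_const d).const_add w0
    have hV0 := (v_hfd hv hU).comp_hasDerivAt t hexp
    have hre : HasDerivAt (fun t : ℝ => (w0 + (t : ℂ) * d).re) d.re t :=
      reDeriv hγ
    have hV : HasDerivAt (fun t : ℝ => VV v (w0 + t * d)) (2 * (FF v (w0 + t * d) * d).re) t := by
      refine (hV0.add (hre.const_mul 2)).congr_deriv ?_
      have e : ∀ h : ℂ, fderivWithin ℝ v SS (cexp (w0 + t * d)) h =
          2 * (vzc v (cexp (w0 + t * d)) * h).re := by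
        intro h
        have e : h = h.re • (1:ℂ) + h.im • I := by simp [Complex.re_add_im]
        conv_lhs => rw [e, map_add, map_smul, map_smul]
        rw [mul_re, vzc_re, vzc_im]
        simp only [smul_eq_mul]
        ring
      rw [e, FF, add_mul, add_re, one_mul]
      rw [show vzc v (cexp (w0 + t * d)) * (cexp (w0 + t * d) * d) =
        cexp (w0 + t * d) * vzc v (cexp (w0 + t * d)) * d by ring]
      ring
    have hF0 := (vzc_hfd hv hU).comp_hasDerivAt t hexp
    have hF : HasDerivAt (fun t : ℝ => FF v (w0 + t * d))
        (((cexp (2 * (w0 + t * d)) * schwarzianMap v (cexp (w0 + t * d)) - 1/2)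
          + FF v (w0 + t * d) ^ 2 / 2) * d
      - (K / 2 : ℝ) * (Real.exp (VV v (w0 + t * d)) : ℝ) * starRingEnd ℂ d) t := by
      refine ((hexp.mul hF0).add_const 1).congr_deriv ?_
      have hdb := dbar_int hv hU
      have hQ := Q_eq hv (UH_sub hU)
      rw [clm_decomp, hdb, FF, VV]
      have hA : (fderivWithin ℝ (vzc v) SS (cexp (w0 + t * d)) 1
        - I * fderivWithin ℝ (vzc v) SS (cexp (w0 + t * d)) I) / 2
        = schwarzianMap v (cexp (w0 + t * d)) + vzc v (cexp (w0 + t * d)) ^ 2 / 2 := by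
        simp only [schwarzianMap]; ring
      rw [hA]
      have he2 : cexp (2 * (w0 + t * d)) = cexp (w0 + t * d) ^ 2 := by
        rw [← Complex.exp_nat_mul]; norm_num
      have hen : ((Real.exp (v (cexp (w0 + t * d)) + 2 * (w0 + t * d).re) : ℝ) : ℂ) =
          (Real.exp (v (cexp (w0 + t * d))) : ℝ) *
            (cexp (w0 + t * d) * starRingEnd ℂ (cexp (w0 + t * d))) := by
        rw [mul_conj, ← ofReal_mul, Real.exp_add, normSq_eq_norm_sq, norm_exp, ← Real.exp_nat_mul]
        norm_num
      rw [he2, hen, map_mul]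
      simp only [Function.comp]
      generalize starRingEnd ℂ (cexp (w0 + t * d)) = Zc
      push_cast
      ring
    have h1 := pathDeriv hy1 w0 d t
    have h2 := pathDeriv hz1 w0 d t
    have h3 := pathDeriv hy2 w0 d t
    have h4 := pathDeriv hz2 w0 d t
    rw [hp _ hm] at h2 h4
    exact m_deriv (K := K) (V := fun t : ℝ => VV v (w0 + t * d))
      (F := fun t : ℝ => FF v (w0 + t * d)) (y1 := fun t : ℝ => y1 (w0 + t * d))
      (z1 := fun t : ℝ => z1 (w0 + t * d)) (y2 := fun t : ℝ => y2 (w0 + t * d))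
      (z2 := fun t : ℝ => z2 (w0 + t * d))
      (q := cexp (2 * (w0 + t * d)) * schwarzianMap v (cexp (w0 + t * d)) - 1/2)
      (d := d) hV hF h1 h2 h3 h4
  have := (convex_Icc (0:ℝ) 1).norm_image_sub_le_of_norm_hasDerivWithin_le (C := 0)
    (fun t ht => (key t ht).hasDerivWithinAt) (by simp) (by simp : (0:ℝ) ∈ Icc (0:ℝ) 1)
    (by simp : (1:ℝ) ∈ Icc (0:ℝ) 1)
  simp only [zero_mul, norm_le_zero_iff, sub_eq_zero, ofReal_one, ofReal_zero, one_mul, add_zero] at this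
  rw [← this, hd]; congr 1; ring

lemma exp_le_u (hv : IsSolutionP K c₁ c₂ v)
    (hp : ∀ w ∈ strip, p w = -((cexp (2 * w) * schwarzianMap v (cexp w) - 1/2) / 2))
    {y1 z1 y2 z2 : ℂ → ℂ} (s : SolPair p y1 z1 y2 z2) :
    ∃ C, 0 ≤ C ∧ ∀ w ∈ strip, Real.exp (-(VV v w / 2)) ≤ C * uu y1 y2 w := by
  have hI : I * (Real.pi / 2 : ℝ) ∈ strip := by
    constructor
    · simp; positivity
    · simp; linarith [Real.pi_pos]
  set w0 := I * (Real.pi / 2 : ℝ)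
  set m11 := mm K v y1 z1 y1 z1 w0
  set m12 := mm K v y1 z1 y2 z2 w0
  set m21 := mm K v y2 z2 y1 z1 w0
  set m22 := mm K v y2 z2 y2 z2 w0
  refine ⟨‖m11‖ + ‖m12‖ + ‖m21‖ + ‖m22‖, by positivity, fun w hw => ?_⟩
  have e11 : mm K v y1 z1 y1 z1 w = m11 := mm_const hv hp s.d1 s.d1' s.d1 s.d1' hI hw
  have e12 : mm K v y1 z1 y2 z2 w = m12 := mm_const hv hp s.d1 s.d1' s.d2 s.d2' hI hw
  have e21 : mm K v y2 z2 y1 z1 w = m21 := mm_const hv hp s.d2 s.d2' s.d1 s.d1' hI hw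
  have e22 : mm K v y2 z2 y2 z2 w = m22 := mm_const hv hp s.d2 s.d2' s.d2 s.d2' hI hw
  have hwr := s.wr w
  have hwrc := congrArg (starRingEnd ℂ) hwr
  simp only [map_sub, map_mul, map_one] at hwrc
  have key : ((Real.exp (-(VV v w / 2)) : ℝ) : ℂ) =
      m11 * (starRingEnd ℂ (y2 w) * y2 w) - m12 * (starRingEnd ℂ (y2 w) * y1 w)
      - m21 * (starRingEnd ℂ (y1 w) * y2 w) + m22 * (starRingEnd ℂ (y1 w) * y1 w) := by
    rw [← e11, ← e12, ← e21, ← e22]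
    simp only [mm, map_add, map_mul, map_div₀, map_ofNat]
    generalize ((Real.exp (-(VV v w / 2)) : ℝ) : ℂ) = Y
    linear_combination (-Y * (y1 w * z2 w - z1 w * y2 w)) * hwrc - Y * hwr
  have hn : Real.exp (-(VV v w / 2)) = ‖((Real.exp (-(VV v w / 2)) : ℝ) : ℂ)‖ := by
    rw [Complex.norm_of_nonneg (Real.exp_pos _).le]
  rw [hn, key]
  have hn1 : ‖y1 w‖ * ‖y1 w‖ ≤ uu y1 y2 w := by
    rw [uu, normSq_eq_norm_sq, normSq_eq_norm_sq]; nlinarith [sq_nonneg ‖y2 w‖]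
  have hn2 : ‖y2 w‖ * ‖y2 w‖ ≤ uu y1 y2 w := by
    rw [uu, normSq_eq_norm_sq, normSq_eq_norm_sq]; nlinarith [sq_nonneg ‖y1 w‖]
  have hn12 : ‖y1 w‖ * ‖y2 w‖ ≤ uu y1 y2 w := by
    rw [uu, normSq_eq_norm_sq, normSq_eq_norm_sq]
    nlinarith [sq_nonneg (‖y1 w‖ - ‖y2 w‖), sq_nonneg (‖y1 w‖), sq_nonneg ‖y2 w‖]
  refine (norm_add_le _ _).trans ?_
  have t1 := norm_sub_le (m11 * (starRingEnd ℂ (y2 w) * y2 w) - m12 * (starRingEnd ℂ (y2 w) * y1 w))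
    (m21 * (starRingEnd ℂ (y1 w) * y2 w))
  have t2 := norm_sub_le (m11 * (starRingEnd ℂ (y2 w) * y2 w)) (m12 * (starRingEnd ℂ (y2 w) * y1 w))
  have s1 : ‖m11 * (starRingEnd ℂ (y2 w) * y2 w)‖ ≤ ‖m11‖ * uu y1 y2 w := by
    rw [norm_mul, norm_mul, RCLike.norm_conj]; gcongr
  have s2 : ‖m12 * (starRingEnd ℂ (y2 w) * y1 w)‖ ≤ ‖m12‖ * uu y1 y2 w := by
    rw [norm_mul, norm_mul, RCLike.norm_conj, mul_comm ‖y2 w‖]; gcongr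
  have s3 : ‖m21 * (starRingEnd ℂ (y1 w) * y2 w)‖ ≤ ‖m21‖ * uu y1 y2 w := by
    rw [norm_mul, norm_mul, RCLike.norm_conj]; gcongr
  have s4 : ‖m22 * (starRingEnd ℂ (y1 w) * y1 w)‖ ≤ ‖m22‖ * uu y1 y2 w := by
    rw [norm_mul, norm_mul, RCLike.norm_conj]; gcongr
  linarith
end U2

lemma det_smulRight_exp (a : ℂ) :
    (((ContinuousLinearMap.toSpanSingleton ℂ a).restrictScalars ℝ) : ℂ →L[ℝ] ℂ).det = normSq a := by
  rw [← Algebra.norm_complex_apply, Algebra.norm_apply, ContinuousLinearMap.det]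
  congr 1
  ext
  all_goals simp [mul_comm]

lemma int_strip {v : ℂ → ℝ}
    (hfin : IntegrableOn (fun z => Real.exp (v z)) {z : ℂ | 0 < z.im}) :
    IntegrableOn (fun w => Real.exp (VV v w)) strip := by
  have hms : MeasurableSet strip :=
    ((isOpen_lt continuous_const continuous_im).inter
      (isOpen_lt continuous_im continuous_const)).measurableSet
  have hinj : InjOn cexp strip := by
    intro x hx y hy h
    have := Real.pi_pos
    exact Complex.exp_inj_of_neg_pi_lt_of_le_pi (by linarith [hx.1]) hx.2.le
      (by linarith [hy.1]) hy.2.le h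
  have hsub : cexp '' strip ⊆ {z : ℂ | 0 < z.im} := by
    rintro _ ⟨w, hw, rfl⟩
    exact exp_strip hw
  have h := (integrableOn_image_iff_integrableOn_abs_det_fderiv_smul (μ := volume) hms
    (fun w hw => ((Complex.hasDerivAt_exp w).hasFDerivAt.restrictScalars ℝ).hasFDerivWithinAt)
    hinj (fun z => Real.exp (v z))).1 (hfin.mono_set hsub)
  refine h.congr_fun (fun w hw => ?_) hms
  simp only [VV]
  rw [det_smulRight_exp, abs_of_nonneg (normSq_nonneg _), Real.exp_add, normSq_eq_norm_sq,
    norm_exp, ← Real.exp_nat_mul, smul_eq_mul, mul_comm]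
  norm_num

lemma int_u {K c₁ c₂ : ℝ} {v : ℂ → ℝ} {p : ℂ → ℂ} (hv : IsSolutionP K c₁ c₂ v)
    (hfin : IntegrableOn (fun z => Real.exp (v z)) {z : ℂ | 0 < z.im})
    (hp : ∀ w ∈ strip, p w = -((cexp (2 * w) * schwarzianMap v (cexp w) - 1/2) / 2))
    {y1 z1 y2 z2 : ℂ → ℂ} (s : SolPair p y1 z1 y2 z2) :
    IntegrableOn (fun w => (uu y1 y2 w ^ 2)⁻¹) strip := by
  obtain ⟨C, hC, h⟩ := exp_le_u hv hp s
  have hms : MeasurableSet strip :=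
    ((isOpen_lt continuous_const continuous_im).inter
      (isOpen_lt continuous_im continuous_const)).measurableSet
  refine Integrable.mono' ((int_strip hfin).const_mul (C ^ 2)) ?_ ?_
  · exact ((s.ucont.pow 2).inv₀ fun w => (pow_pos (s.upos w) 2).ne').aestronglyMeasurable
  · refine (ae_restrict_iff' hms).2 (Eventually.of_forall fun w hw => ?_)
    have hu := s.upos w
    have h1 := h w hw
    rw [Real.norm_of_nonneg (by positivity), inv_le_iff_one_le_mul₀ (by positivity)]
    have e : Real.exp (VV v w) * (Real.exp (-(VV v w / 2)) * Real.exp (-(VV v w / 2))) = 1 := by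
      rw [← Real.exp_add, ← Real.exp_add, ← Real.exp_zero]; congr 1; ring
    have e2 : Real.exp (-(VV v w / 2)) * Real.exp (-(VV v w / 2)) ≤
      (C * uu y1 y2 w) * (C * uu y1 y2 w) := by gcongr
    calc (1:ℝ) = _ := e.symm
      _ ≤ Real.exp (VV v w) * ((C * uu y1 y2 w) * (C * uu y1 y2 w)) := by gcongr
      _ = _ := by ring

lemma const_of_growth {Φ : ℂ → ℂ} {C : ℝ} (hd : DifferentiableOn ℂ Φ {0}ᶜ)
    (hC : ∀ z : ℂ, z ≠ 0 → ‖Φ z‖ ≤ C * Real.exp (|Real.log ‖z‖| / 2)) {z : ℂ} (hz : z ≠ 0) :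
    Φ z = Φ 1 := by
  have hC0 : 0 ≤ C := by
    have := (norm_nonneg _).trans (hC 1 one_ne_zero)
    simpa using this
  have hsq : ∀ r : ℝ, 0 < r → Real.exp (Real.log r / 2) = √r := fun r hr => by
    rw [Real.exp_half, Real.exp_log hr]
  have hlo : (fun z => Φ z - Φ 0) =o[nhdsWithin (0:ℂ) {0}ᶜ] fun z => (z - 0)⁻¹ := by
    rw [Asymptotics.isLittleO_iff_tendsto']
    swap
    · filter_upwards [self_mem_nhdsWithin] with w hw h0
      simp only [sub_zero, inv_eq_zero] at h0
      exact absurd h0 hw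
    · have hb : Tendsto (fun w : ℂ => C * √‖w‖ + ‖Φ 0‖ * ‖w‖) (nhdsWithin (0:ℂ) {0}ᶜ) (nhds 0) := by
        have : ContinuousAt (fun w : ℂ => C * √‖w‖ + ‖Φ 0‖ * ‖w‖) 0 := by fun_prop
        have h2 := this.tendsto
        simp only [norm_zero, Real.sqrt_zero, mul_zero, add_zero] at h2
        exact h2.mono_left nhdsWithin_le_nhds
      refine squeeze_zero_norm' ?_ hb
      have hb1 : Metric.ball (0:ℂ) 1 ∈ nhdsWithin (0:ℂ) {0}ᶜ :=
        mem_nhdsWithin_of_mem_nhds (Metric.ball_mem_nhds _ one_pos)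
      filter_upwards [self_mem_nhdsWithin, hb1] with w hw hw1
      have hw0 : w ≠ 0 := hw
      have hn : 0 < ‖w‖ := norm_pos_iff.2 hw0
      have hn1 : ‖w‖ < 1 := by simpa using hw1
      rw [sub_zero, div_inv_eq_mul, norm_mul]
      have h1 := hC w hw0
      rw [abs_of_nonpos (Real.log_nonpos hn.le hn1.le), neg_div, Real.exp_neg, hsq _ hn] at h1
      have h3 : (√‖w‖)⁻¹ * ‖w‖ = √‖w‖ := by
        have := Real.mul_self_sqrt hn.le
        have hs : 0 < √‖w‖ := Real.sqrt_pos.2 hn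
        nth_rewrite 2 [← this]
        field_simp
      calc ‖Φ w - Φ 0‖ * ‖w‖ ≤ (C * (√‖w‖)⁻¹ + ‖Φ 0‖) * ‖w‖ := by
            gcongr
            exact (norm_sub_le _ _).trans (by linarith)
        _ = C * ((√‖w‖)⁻¹ * ‖w‖) + ‖Φ 0‖ * ‖w‖ := by ring
        _ = _ := by rw [h3]
  have hG := differentiableOn_update_limUnder_of_isLittleO (f := Φ) (s := univ) (c := 0) univ_mem
    (by rwa [← compl_eq_univ_sdiff]) hlo
  rw [differentiableOn_univ] at hG
  set G := Function.update Φ 0 ((nhdsWithin (0:ℂ) {0}ᶜ).limUnder Φ) with hGd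
  have hGe : ∀ w, w ≠ 0 → G w = Φ w := fun w hw => by simp [hGd, hw]
  have hder : ∀ c, deriv G c = 0 := by
    intro c
    by_contra hne
    have hδ : 0 < ‖deriv G c‖ := norm_pos_iff.2 hne
    set δ := ‖deriv G c‖ with hδd
    set R := ‖c‖ + 1 + 2 * C ^ 2 / δ ^ 2 with hR
    have hx : 0 ≤ 2 * C ^ 2 / δ ^ 2 := by positivity
    have hcn := norm_nonneg c
    have hRp : 0 < R := by linarith
    have := norm_deriv_le_of_forall_mem_sphere_norm_le (c := c) (C := C * √(2 * R)) (f := G) hRp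
      hG.diffContOnCl (fun w hw => by
        have hwc : ‖w - c‖ = R := by simpa [dist_eq_norm] using hw
        have hw1 : 1 ≤ ‖w‖ := by
          have := norm_sub_le w c
          linarith
        have hw2 : ‖w‖ ≤ 2 * R := by
          have := norm_le_norm_add_norm_sub' w c
          linarith
        have hw0 : w ≠ 0 := by
          intro h; rw [h] at hw1; norm_num at hw1
        rw [hGe w hw0]
        have h1 := hC w hw0
        rw [abs_of_nonneg (Real.log_nonneg hw1), hsq _ (by linarith)] at h1
        exact h1.trans (by gcongr))
    rw [← hδd, le_div_iff₀ hRp] at this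
    have h2 : (δ * R) ^ 2 ≤ (C * √(2 * R)) ^ 2 := by gcongr
    rw [mul_pow, mul_pow, Real.sq_sqrt (by positivity)] at h2
    have h3 : δ ^ 2 * R ≤ 2 * C ^ 2 := by
      have : (δ ^ 2 * R) * R ≤ (2 * C ^ 2) * R := by linarith
      exact le_of_mul_le_mul_right this hRp
    have h4 : δ ^ 2 * R = δ ^ 2 * (‖c‖ + 1) + 2 * C ^ 2 := by
      rw [hR]; field_simp
    have : 0 < δ ^ 2 * (‖c‖ + 1) := by positivity
    linarith
  have := is_const_of_deriv_eq_zero hG hder z 1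
  rwa [hGe z hz, hGe 1 one_ne_zero] at this

/-- the Schwarzian map of any finite-area solution of problem (P) is
Q(z) = c/z² for some real constant c (on the closed upper half-plane minus the origin,
and hence on its reflected holomorphic extension to ℂ*). -/
theorem schwarzian_of_global_solution
    (K c₁ c₂ : ℝ) (hK : K = -1 ∨ K = 0 ∨ K = 1)
    (v : ℂ → ℝ) (hv : IsSolutionP K c₁ c₂ v)
    (hfin : IntegrableOn (fun z => Real.exp (v z)) {z : ℂ | 0 < z.im}) :
    ∃ c : ℝ, ∀ z : ℂ, z ≠ 0 → 0 ≤ z.im →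
      schwarzianMap v z = (c : ℂ) / z ^ 2 := by

  obtain ⟨G, hGd, hGQ, hGc⟩ := reflectQ (Q_cont hv) (Q_diff hv) (fun s hs => Q_real hv hs)
  set p : ℂ → ℂ := fun w => -((cexp (2 * w) * G (cexp w) - 1/2) / 2) with hpd
  have hpdiff : Differentiable ℂ p := by
    have h1 : Differentiable ℂ (fun w => G (cexp w)) := fun w =>
      ((hGd.differentiableAt (isOpen_compl_singleton.mem_nhds (exp_ne_zero w))).comp w
        Complex.differentiable_exp.differentiableAt)
    have h2 : Differentiable ℂ (fun w : ℂ => cexp (2 * w)) := by fun_prop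
    exact (((h2.mul h1).sub_const _).div_const _).neg
  have hpc : ∀ w, p (starRingEnd ℂ w) = starRingEnd ℂ (p w) := by
    intro w
    simp only [hpd, map_neg, map_div₀, map_sub, map_mul, map_one, map_ofNat,
      ← exp_conj]
    rw [exp_conj, hGc]
  have hper : ∀ w, p (w + 2 * Real.pi * I) = p w := by
    intro w
    have h1 : cexp (w + 2 * Real.pi * I) = cexp w := exp_periodic w
    have h2 : cexp (2 * (w + 2 * Real.pi * I)) = cexp (2 * w) := by
      rw [two_mul, exp_add, h1, two_mul, exp_add]
    simp only [hpd, h1, h2]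
  obtain ⟨y1, z1, d1, d1', i1, j1⟩ := exists_entire_sol p hpdiff 1 0
  obtain ⟨y2, z2, d2, d2', i2, j2⟩ := exists_entire_sol p hpdiff 0 1
  have hW : ∀ w, HasDerivAt (fun w => y1 w * z2 w - z1 w * y2 w) 0 w := by
    intro w
    refine (((d1 w).mul (d2' w)).sub ((d1' w).mul (d2 w))).congr_deriv ?_
    ring
  have hwr : ∀ w, y1 w * z2 w - z1 w * y2 w = 1 := by
    intro w
    have := is_const_of_deriv_eq_zero (fun w => (hW w).differentiableAt) (fun w => (hW w).deriv) w 0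
    simpa [i1, j1, i2, j2] using this
  have s : SolPair p y1 z1 y2 z2 := ⟨d1, d1', d2, d2', hwr⟩
  have hp : ∀ w ∈ strip, p w = -((cexp (2 * w) * schwarzianMap v (cexp w) - 1/2) / 2) := by
    intro w hw
    simp only [hpd]
    rw [hGQ _ (le_of_lt (exp_strip hw)) (exp_ne_zero w)]
  obtain ⟨C, hC⟩ := p_growth_two s hpdiff.continuous hpc hper (int_u hv hfin hp s)
  have hΦ : ∀ z : ℂ, z ≠ 0 → ‖z ^ 2 * G z‖ ≤ (1/2 + 2 * C) * Real.exp (|Real.log ‖z‖| / 2) := by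
    intro z hz
    have h1 := hC (log z) (by rw [log_im]; exact abs_arg_le_pi z)
    have h2 : z ^ 2 * G z = 1/2 - 2 * p (log z) := by
      simp only [hpd]
      rw [two_mul (log z), exp_add, exp_log hz]; ring
    rw [log_re] at h1
    have h3 : 1 ≤ Real.exp (|Real.log ‖z‖| / 2) := Real.one_le_exp (by positivity)
    rw [h2]
    refine (norm_sub_le _ _).trans ?_
    rw [norm_mul]
    norm_num
    linarith
  have hΦd : DifferentiableOn ℂ (fun z => z ^ 2 * G z) {0}ᶜ := by
    exact DifferentiableOn.mul (by fun_prop) hGd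
  refine ⟨(G 1).re, fun z hz hzi => ?_⟩
  have hcon := const_of_growth hΦd hΦ hz
  have h1 : ((G 1).re : ℂ) = G 1 := by
    have : (G 1).im = 0 := by
      rw [hGQ 1 (by simp) one_ne_zero]
      simpa using Q_real hv (one_ne_zero (α := ℝ))
    apply Complex.ext <;> simp [this]
  rw [← hGQ z hzi hz, h1, eq_div_iff (pow_ne_zero 2 hz)]
  simp only [one_pow, one_mul] at hcon
  rw [← hcon, mul_comm]
end

section
/- Given K ∈ {−1,0,1} and c₁, c₂ ∈ ℝ, there exists a solution v of problem (P) with ∫_{ℝ²₊} e^v < ∞ if and only if one of the following holds: K = 1; or K = 0 and c_i < 0 for some i ∈ {1,2}; or K = −1 and at least one of the conditions c₁ < −2, c₂ < −2, c₁ + c₂ < 0 is satisfied. -/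
open Complex Set Filter MeasureTheory

/-! ### Conformal invariance of the Laplacian -/

lemma lap_eq_snd {v : ℂ → ℝ} {z : ℂ} (hv : ContDiffAt ℝ 2 v z) :
    lap v z = fderiv ℝ (fderiv ℝ v) z 1 1 + fderiv ℝ (fderiv ℝ v) z I I := by
  have hD : DifferentiableAt ℝ (fderiv ℝ v) z :=
    (hv.fderiv_right (m := 1) (by norm_num)).differentiableAt (by norm_num)
  have h : ∀ e : ℂ, fderiv ℝ (fun w => fderiv ℝ v w e) z e = fderiv ℝ (fderiv ℝ v) z e e := by
    intro e
    have := (hD.hasFDerivAt.clm_apply (hasFDerivAt_const e z)).fderiv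
    rw [this]; simp
  unfold lap
  rw [h, h]

lemma hasFDerivAt_comp_hol {v : ℂ → ℝ} {h : ℂ → ℂ} {a w : ℂ}
    (hv : DifferentiableAt ℝ v (h w)) (hh : HasDerivAt h a w) (e : ℂ) :
    fderiv ℝ (fun x => v (h x)) w e = fderiv ℝ v (h w) (a * e) := by
  have := (hv.hasFDerivAt.comp w (hh.hasFDerivAt.restrictScalars ℝ)).fderiv
  rw [show (fun x => v (h x)) = v ∘ h from rfl, this]
  simp [mul_comm]

lemma lap_comp {v : ℂ → ℝ} {h h' : ℂ → ℂ} {h'' ζ : ℂ}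
    (hh : ∀ᶠ w in nhds ζ, HasDerivAt h (h' w) w) (hh' : HasDerivAt h' h'' ζ)
    (hv : ContDiffAt ℝ 2 v (h ζ)) :
    lap (fun w => v (h w)) ζ = normSq (h' ζ) * lap v (h ζ) := by
  have hD : DifferentiableAt ℝ (fderiv ℝ v) (h ζ) :=
    (hv.fderiv_right (m := 1) (by norm_num)).differentiableAt (by norm_num)
  have hζ := hh.self_of_nhds
  have hev : ∀ᶠ y in nhds (h ζ), DifferentiableAt ℝ v y := by
    filter_upwards [hv.eventually (by simp)] with y hy
    exact hy.differentiableAt (by norm_num)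
  have hev2 : ∀ᶠ w in nhds ζ, DifferentiableAt ℝ v (h w) := hζ.continuousAt.eventually hev
  have key : ∀ e : ℂ, fderiv ℝ (fun w => fderiv ℝ (fun x => v (h x)) w e) ζ e =
      fderiv ℝ (fderiv ℝ v) (h ζ) (h' ζ * e) (h' ζ * e) + fderiv ℝ v (h ζ) (h'' * e * e) := by
    intro e
    have e1 : (fun w => fderiv ℝ (fun x => v (h x)) w e) =ᶠ[nhds ζ]
        fun w => fderiv ℝ v (h w) (h' w * e) := by
      filter_upwards [hh, hev2] with w h1 h2
      exact hasFDerivAt_comp_hol h2 h1 e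
    rw [e1.fderiv_eq]
    have a1 := hD.hasFDerivAt.comp ζ (hζ.hasFDerivAt.restrictScalars ℝ)
    have a2 := (hh'.mul_const e).hasFDerivAt.restrictScalars ℝ
    have := (a1.clm_apply a2).fderiv
    simp only [Function.comp_def] at this
    rw [this]
    simp [mul_comm, add_comm]
  have hs : IsSymmSndFDerivAt ℝ v (h ζ) := hv.isSymmSndFDerivAt (by simp)
  rw [lap_eq_snd hv]
  unfold lap
  rw [key, key]
  set B := fderiv ℝ (fderiv ℝ v) (h ζ) with hB
  have hsym : B 1 I = B I 1 := hs 1 I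
  have hlin : ∀ z u : ℂ, B z u = z.re * u.re * B 1 1 + z.re * u.im * B 1 I
      + z.im * u.re * B I 1 + z.im * u.im * B I I := by
    intro z u
    have hz : z = z.re • (1 : ℂ) + z.im • I := by
      simp [Complex.re_add_im]
    have hu : u = u.re • (1 : ℂ) + u.im • I := by
      simp [Complex.re_add_im]
    conv_lhs => rw [hz, hu]
    simp only [map_add, map_smul, add_apply, smul_apply,
      smul_eq_mul]
    ring
  have hneg : fderiv ℝ v (h ζ) (h'' * I * I) = - fderiv ℝ v (h ζ) (h'' * 1 * 1) := by
    rw [← map_neg]; congr 1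
    rw [mul_assoc, I_mul_I]; ring
  rw [hneg, hlin (h' ζ * 1), hlin (h' ζ * I), hsym, normSq_apply]
  simp
  ring

/-! ### Existence -/

/-- The strip profile `w`. -/
noncomputable def wf (α β γ δ : ℝ) (ζ : ℂ) : ℝ :=
  (α * Real.cosh (γ * ζ.re) + β * Real.cos (γ * ζ.im + δ)) / γ

noncomputable def Uf (α β γ δ : ℝ) (ζ : ℂ) : ℝ :=
  -2 * Real.log (wf α β γ δ ζ) - 2 * ζ.re

noncomputable def Lf (z : ℂ) : ℂ := Complex.log (-I * z) + I * (Real.pi / 2)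

lemma hasFDerivAt_re (ζ : ℂ) : HasFDerivAt (fun z : ℂ => z.re) reCLM ζ := reCLM.hasFDerivAt
lemma hasFDerivAt_im (ζ : ℂ) : HasFDerivAt (fun z : ℂ => z.im) imCLM ζ := imCLM.hasFDerivAt

lemma wf_hasFDerivAt (α β γ δ : ℝ) (hγ : γ ≠ 0) (ζ : ℂ) :
    HasFDerivAt (wf α β γ δ) ((α * Real.sinh (γ * ζ.re)) • reCLM +
      (-β * Real.sin (γ * ζ.im + δ)) • imCLM) ζ := by
  have h1 := ((((hasFDerivAt_re ζ).const_mul γ).cosh).const_mul α)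
  have h2 := (((((hasFDerivAt_im ζ).const_mul γ).add_const δ).cos).const_mul β)
  have h3 := (h1.add h2).mul_const (γ⁻¹)
  have h4 : wf α β γ δ = fun y => ((fun y : ℂ => α * Real.cosh (γ * y.re)) +
      fun y : ℂ => β * Real.cos (γ * y.im + δ)) y * γ⁻¹ := by
    funext y; simp [wf, div_eq_mul_inv]
  rw [h4]
  refine h3.congr_fderiv ?_
  ext; all_goals (simp; field_simp)

lemma wf_contDiff (α β γ δ : ℝ) : ContDiff ℝ 2 (wf α β γ δ) := by
  unfold wf
  have h1 : ContDiff ℝ 2 (fun z : ℂ => z.re) := reCLM.contDiff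
  have h2 : ContDiff ℝ 2 (fun z : ℂ => z.im) := imCLM.contDiff
  exact ((contDiff_const.mul (contDiff_const.mul h1).cosh).add
    (contDiff_const.mul ((contDiff_const.mul h2).add contDiff_const).cos)).div_const _

lemma Uf_contDiffAt (α β γ δ : ℝ) {ζ : ℂ} (h : 0 < wf α β γ δ ζ) :
    ContDiffAt ℝ 2 (Uf α β γ δ) ζ := by
  unfold Uf
  have h1 : ContDiff ℝ 2 (fun z : ℂ => z.re) := reCLM.contDiff
  exact (contDiffAt_const.mul ((wf_contDiff α β γ δ).contDiffAt.log h.ne')).sub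
    (contDiffAt_const.mul h1.contDiffAt)

lemma Uf_fderiv (α β γ δ : ℝ) (hγ : γ ≠ 0) {ζ : ℂ} (h : 0 < wf α β γ δ ζ) (e : ℂ) :
    fderiv ℝ (Uf α β γ δ) ζ e = -2 * (α * Real.sinh (γ * ζ.re) * e.re
      - β * Real.sin (γ * ζ.im + δ) * e.im) / wf α β γ δ ζ - 2 * e.re := by
  have h1 := (((wf_hasFDerivAt α β γ δ hγ ζ).log h.ne').const_mul (-2)).sub
    ((hasFDerivAt_re ζ).const_mul 2)
  have h2 : fderiv ℝ (Uf α β γ δ) ζ = _ := h1.fderiv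
  rw [h2]
  simp
  field_simp
  ring

lemma lap_Uf (α β γ δ : ℝ) (hγ : 0 < γ) {ζ : ℂ} (h : 0 < wf α β γ δ ζ) :
    lap (Uf α β γ δ) ζ = -2 * (α ^ 2 - β ^ 2) / (wf α β γ δ ζ) ^ 2 := by
  have hev : ∀ᶠ y in nhds ζ, 0 < wf α β γ δ y :=
    (wf_contDiff α β γ δ).continuous.continuousAt.eventually (lt_mem_nhds h)
  have e1 : (fun y => fderiv ℝ (Uf α β γ δ) y 1) =ᶠ[nhds ζ]
      fun y => -2 * (α * Real.sinh (γ * y.re)) * (wf α β γ δ y)⁻¹ - 2 := by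
    filter_upwards [hev] with y hy
    rw [Uf_fderiv α β γ δ hγ.ne' hy]; simp [div_eq_mul_inv]
  have e2 : (fun y => fderiv ℝ (Uf α β γ δ) y I) =ᶠ[nhds ζ]
      fun y => 2 * (β * Real.sin (γ * y.im + δ)) * (wf α β γ δ y)⁻¹ := by
    filter_upwards [hev] with y hy
    rw [Uf_fderiv α β γ δ hγ.ne' hy]; simp [div_eq_mul_inv]
  have hw := wf_hasFDerivAt α β γ δ hγ.ne' ζ
  have hi := (hasDerivAt_inv h.ne').comp_hasFDerivAt ζ hw
  have d1 := ((((((hasFDerivAt_re ζ).const_mul γ).sinh).const_mul α).const_mul (-2)).mul hi).sub_const 2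
  have d2 := ((((((hasFDerivAt_im ζ).const_mul γ).add_const δ).sin).const_mul β).const_mul 2).mul hi
  have d1' : HasFDerivAt (fun y => -2 * (α * Real.sinh (γ * y.re)) * (wf α β γ δ y)⁻¹ - 2) _ ζ := d1
  have d2' : HasFDerivAt (fun y => 2 * (β * Real.sin (γ * y.im + δ)) * (wf α β γ δ y)⁻¹) _ ζ := d2
  unfold lap
  rw [e1.fderiv_eq, e2.fderiv_eq, d1'.fderiv, d2'.fderiv]
  simp
  have hW : wf α β γ δ ζ * γ = α * Real.cosh (γ * ζ.re) + β * Real.cos (γ * ζ.im + δ) := by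
    unfold wf; field_simp
  set W := wf α β γ δ ζ
  have hc := Real.cosh_sq (γ * ζ.re)
  have hs := Real.sin_sq_add_cos_sq (γ * ζ.im + δ)
  set C := Real.cosh (γ * ζ.re)
  set S := Real.sinh (γ * ζ.re)
  set c := Real.cos (γ * ζ.im + δ)
  set s := Real.sin (γ * ζ.im + δ)
  field_simp
  linear_combination (-α * C + β * c) * hW - α ^ 2 * hc + β ^ 2 * hs

lemma slit_of {z : ℂ} (h : 0 ≤ z.im) (h0 : z ≠ 0) : -I * z ∈ slitPlane := by
  rw [mem_slitPlane_iff]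
  simp
  by_contra hc
  push Not at hc
  apply h0
  apply Complex.ext <;> simp
  · exact hc.2
  · linarith [hc.1]

lemma Lf_hasDerivAt {z : ℂ} (h : -I * z ∈ slitPlane) : HasDerivAt Lf (z⁻¹) z := by
  have h1 := (((hasDerivAt_id z).const_mul (-I)).clog h).add_const (I * ((Real.pi : ℂ) / 2))
  have h2 : HasDerivAt Lf _ z := h1
  refine h2.congr_deriv ?_
  have hz : z ≠ 0 := by rintro rfl; simp at h
  simp
  field_simp

lemma Lf_re (z : ℂ) : (Lf z).re = Real.log ‖z‖ := by
  simp [Lf, Complex.log_re]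

lemma Lf_im_mem {z : ℂ} (h : 0 ≤ z.im) : (Lf z).im ∈ Icc 0 Real.pi := by
  have h1 : |arg (-I * z)| ≤ Real.pi / 2 := by
    rw [abs_arg_le_pi_div_two_iff]; simpa using h
  have h2 : (Lf z).im = arg (-I * z) + Real.pi / 2 := by
    simp [Lf, Complex.log_im]
  rw [h2]
  rw [abs_le] at h1
  constructor <;> linarith [h1.1, h1.2]

lemma Lf_im_pos {s : ℝ} (h : 0 < s) : (Lf s).im = 0 := by
  have h2 : (Lf s).im = arg (-I * s) + Real.pi / 2 := by
    simp [Lf, Complex.log_im]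
  rw [h2, mul_comm, arg_real_mul _ h]; simp

lemma Lf_im_neg {s : ℝ} (h : s < 0) : (Lf s).im = Real.pi := by
  have h2 : (Lf s).im = arg (-I * s) + Real.pi / 2 := by
    simp [Lf, Complex.log_im]
  rw [h2, show -I * (s : ℂ) = ((-s : ℝ) : ℂ) * I by push_cast; ring, arg_real_mul _ (by linarith)]
  simp

/-- The solution. -/
noncomputable def vf (α β γ δ : ℝ) (z : ℂ) : ℝ := Uf α β γ δ (Lf z)

lemma exp_half_vf {α β γ δ : ℝ} {z : ℂ} (hz : z ≠ 0) (h : 0 < wf α β γ δ (Lf z)) :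
    Real.exp (vf α β γ δ z / 2) = 1 / (‖z‖ * wf α β γ δ (Lf z)) := by
  have : vf α β γ δ z / 2 = - (Real.log (wf α β γ δ (Lf z)) + Real.log ‖z‖) := by
    simp only [vf, Uf, Lf_re]; ring
  have hn : 0 < ‖z‖ := norm_pos_iff.mpr hz
  rw [this, Real.exp_neg, Real.exp_add, Real.exp_log h, Real.exp_log hn, one_div, mul_comm]

lemma exp_vf {α β γ δ : ℝ} {z : ℂ} (hz : z ≠ 0) (h : 0 < wf α β γ δ (Lf z)) :
    Real.exp (vf α β γ δ z) = 1 / (‖z‖ * wf α β γ δ (Lf z)) ^ 2 := by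
  have : vf α β γ δ z = vf α β γ δ z / 2 + vf α β γ δ z / 2 := by ring
  rw [this, Real.exp_add, exp_half_vf hz h]
  ring

lemma integrable_radial {γ : ℝ} (hγ : 0 < γ) :
    Integrable (fun z : ℂ => ‖z‖ ^ (2 * γ - 2) / (‖z‖ ^ (2 * γ) + 1) ^ 2) := by
  have h := (integrable_fun_norm_addHaar (volume : Measure ℂ)
    (f := fun r : ℝ => r ^ (2 * γ - 2) / (r ^ (2 * γ) + 1) ^ 2))
  rw [h]
  have key : IntegrableOn (fun r : ℝ => (2 * γ * r ^ (2 * γ - 1)) / (r ^ (2 * γ) + 1) ^ 2)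
      (Ioi 0) := by
    apply integrableOn_Ioi_deriv_of_nonneg (g := fun r : ℝ => -(r ^ (2 * γ) + 1)⁻¹) (l := 0)
    · apply ContinuousAt.continuousWithinAt
      have : ContinuousAt (fun r : ℝ => r ^ (2 * γ)) 0 :=
        Real.continuousAt_rpow_const _ _ (Or.inr (by positivity))
      refine ((this.add continuousAt_const).inv₀ ?_).neg
      have h0 : (0 : ℝ) ^ (2 * γ) = 0 := Real.zero_rpow (by positivity)
      simp [h0]
    · intro r hr
      have hr : 0 < r := hr
      have h1 := ((Real.hasDerivAt_rpow_const (x := r) (p := 2 * γ) (Or.inl hr.ne')).add_const 1)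
      have h2 : r ^ (2 * γ) + 1 ≠ 0 := by positivity
      have h3 := (h1.inv h2).neg
      refine h3.congr_deriv ?_
      ring
    · intro r hr
      have hr : 0 < r := hr
      positivity
    · have : Tendsto (fun r : ℝ => r ^ (2 * γ) + 1) atTop atTop :=
        tendsto_atTop_add_const_right _ _ (tendsto_rpow_atTop (by positivity))
      simpa using this.inv_tendsto_atTop.neg
  refine IntegrableOn.congr_fun (key.const_mul (1 / (2 * γ))) ?_ measurableSet_Ioi
  intro r hr
  have hr : 0 < r := hr
  simp only [finrank_real_complex, smul_eq_mul]
  have : r ^ (2 * γ - 1) = r * r ^ (2 * γ - 2) := by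
    rw [show 2 * γ - 1 = 1 + (2 * γ - 2) by ring, Real.rpow_add hr, Real.rpow_one]
  rw [this]
  field_simp
  norm_num

lemma cosh_log {γ r : ℝ} (hr : 0 < r) :
    (r * Real.cosh (γ * Real.log r)) ^ 2 = (r ^ (2 * γ) + 1) ^ 2 / (4 * r ^ (2 * γ - 2)) := by
  have e1 : Real.exp (γ * Real.log r) = r ^ γ := by
    rw [Real.rpow_def_of_pos hr, mul_comm]
  have hp : 0 < r ^ γ := Real.rpow_pos_of_pos hr _
  have e2 : r ^ (2 * γ) = (r ^ γ) ^ 2 := by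
    rw [show 2 * γ = γ + γ by ring, Real.rpow_add hr]; ring
  have e3 : r ^ (2 * γ - 2) = (r ^ γ) ^ 2 / r ^ 2 := by
    rw [Real.rpow_sub hr, e2]; norm_num
  rw [Real.cosh_eq, Real.exp_neg, e1, e2, e3]
  field_simp
  ring

theorem existence_aux {K c₁ c₂ α β δ δ' : ℝ} (hα : 0 < α) (hK : α ^ 2 - β ^ 2 = K)
    (hδ : δ < δ') (hpos : ∀ φ ∈ Icc δ δ', 0 < α + β * Real.cos φ)
    (h1 : β * Real.sin δ = c₁ / 2) (h2 : β * Real.sin δ' = - c₂ / 2) :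
    ∃ v : ℂ → ℝ, IsSolutionP K c₁ c₂ v ∧
      IntegrableOn (fun z => Real.exp (v z)) {z : ℂ | 0 < z.im} := by
  obtain ⟨γ, hγdef⟩ : ∃ γ, γ = (δ' - δ) / Real.pi := ⟨_, rfl⟩
  have hpi := Real.pi_pos
  have hγ : 0 < γ := by rw [hγdef]; exact div_pos (by linarith) hpi
  have hγπ : γ * Real.pi + δ = δ' := by rw [hγdef]; field_simp; ring
  -- uniform lower bound
  obtain ⟨μ, hμ, hμb⟩ : ∃ μ > 0, ∀ φ ∈ Icc δ δ', μ ≤ α + β * Real.cos φ := by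
    obtain ⟨x, hx, hm⟩ := (isCompact_Icc (a := δ) (b := δ')).exists_isMinOn
      (nonempty_Icc.mpr hδ.le) (f := fun φ => α + β * Real.cos φ) (by fun_prop)
    exact ⟨_, hpos x hx, fun φ hφ => hm hφ⟩
  have hmem : ∀ z : ℂ, 0 ≤ z.im → γ * (Lf z).im + δ ∈ Icc δ δ' := by
    intro z hz
    have := Lf_im_mem hz
    constructor
    · nlinarith [this.1]
    · rw [← hγπ]; nlinarith [this.2]
  set ε := min α μ with hε
  have hεpos : 0 < ε := lt_min hα hμ
  have hlow : ∀ z : ℂ, 0 ≤ z.im →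
      ε * Real.cosh (γ * Real.log ‖z‖) / γ ≤ wf α β γ δ (Lf z) := by
    intro z hz
    unfold wf
    rw [Lf_re]
    have a1 := hμb _ (hmem z hz)
    have a2 := Real.one_le_cosh (γ * Real.log ‖z‖)
    have a3 : ε ≤ α := min_le_left _ _
    have a4 : ε ≤ μ := min_le_right _ _
    apply div_le_div_of_nonneg_right _ hγ.le
    nlinarith
  have hw : ∀ z : ℂ, 0 ≤ z.im → 0 < wf α β γ δ (Lf z) := by
    intro z hz
    refine lt_of_lt_of_le ?_ (hlow z hz)
    have := Real.cosh_pos (γ * Real.log ‖z‖)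
    positivity
  have hLsm : ∀ z : ℂ, 0 ≤ z.im → z ≠ 0 → ContDiffAt ℝ 2 Lf z := by
    intro z hz h0
    unfold Lf
    have hh := slit_of hz h0
    have : ContDiffAt ℂ 2 (fun z => Complex.log (-I * z) + I * (Real.pi / 2)) z :=
      ContDiffAt.add (ContDiffAt.comp z (contDiffAt_log hh)
        (contDiffAt_const.mul contDiffAt_id)) contDiffAt_const
    exact this.restrict_scalars ℝ
  have hvsm : ∀ z : ℂ, 0 ≤ z.im → z ≠ 0 → ContDiffAt ℝ 2 (vf α β γ δ) z := by
    intro z hz h0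
    exact (Uf_contDiffAt α β γ δ (hw z hz)).comp z (hLsm z hz h0)
  have hdnu : ∀ s : ℝ, s ≠ 0 → dnu (vf α β γ δ) s =
      2 * (β * Real.sin (γ * (Lf s).im + δ)) * s⁻¹ / wf α β γ δ (Lf s) := by
    intro s hs
    have hs0 : (s : ℂ) ≠ 0 := by exact_mod_cast hs
    have him : 0 ≤ (s : ℂ).im := by simp
    have hun : UniqueDiffWithinAt ℝ {w : ℂ | 0 ≤ w.im} (s : ℂ) := by
      refine uniqueDiffOn_convex (convex_halfSpace_im_ge 0) ?_ _ him
      refine ⟨I, mem_interior_iff_mem_nhds.mpr ?_⟩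
      have : {w : ℂ | 0 < w.im} ∈ nhds I := (isOpen_lt continuous_const continuous_im).mem_nhds (by simp)
      exact mem_of_superset this (fun w hw => show 0 ≤ w.im from le_of_lt hw)
    unfold dnu
    rw [fderivWithin_eq_fderiv hun ((hvsm s him hs0).differentiableAt (by norm_num))]
    have hUd := (Uf_contDiffAt α β γ δ (hw s him)).differentiableAt (by norm_num)
    have := hasFDerivAt_comp_hol hUd (Lf_hasDerivAt (slit_of him hs0)) I
    unfold vf
    rw [this, Uf_fderiv α β γ δ hγ.ne' (hw s him)]
    have r1 : (((s : ℂ))⁻¹ * I).re = 0 := by rw [← ofReal_inv]; simp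
    have r2 : (((s : ℂ))⁻¹ * I).im = s⁻¹ := by rw [← ofReal_inv]; simp
    rw [r1, r2]; ring
  refine ⟨vf α β γ δ, ⟨?_, ?_, ?_, ?_⟩, ?_⟩
  · rintro z ⟨hz, h0⟩
    exact (hvsm z hz h0).contDiffWithinAt
  · intro z hz
    have h0 : z ≠ 0 := by rintro rfl; simp at hz
    have hsl : ∀ᶠ y in nhds z, HasDerivAt Lf (y⁻¹) y := by
      have : ∀ᶠ y : ℂ in nhds z, 0 < y.im :=
        (isOpen_lt continuous_const continuous_im).mem_nhds hz
      filter_upwards [this] with y hy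
      exact Lf_hasDerivAt (slit_of hy.le (by rintro rfl; simp at hy))
    have := lap_comp (v := Uf α β γ δ) hsl (hasDerivAt_inv h0)
      (Uf_contDiffAt α β γ δ (hw z hz.le))
    rw [exp_vf h0 (hw z hz.le)]
    unfold vf
    rw [this, lap_Uf α β γ δ hγ (hw z hz.le), hK, map_inv₀, normSq_eq_norm_sq]
    have hn : 0 < ‖z‖ := norm_pos_iff.mpr h0
    have hwz := hw z hz.le
    field_simp
    ring
  · intro s hs
    have hs0 : (s : ℂ) ≠ 0 := by exact_mod_cast hs.ne'
    have hwz := hw s (by simp)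
    rw [hdnu s hs.ne', exp_half_vf hs0 hwz, Lf_im_pos hs, mul_zero, zero_add, h1, norm_real,
      Real.norm_eq_abs, abs_of_pos hs]
    field_simp
  · intro s hs
    have hs0 : (s : ℂ) ≠ 0 := by exact_mod_cast hs.ne
    have hwz := hw s (by simp)
    rw [hdnu s hs.ne, exp_half_vf hs0 hwz, Lf_im_neg hs, hγπ, h2, norm_real,
      Real.norm_eq_abs, abs_of_neg hs]
    have := hs.ne
    field_simp
  · have hopen : IsOpen {z : ℂ | 0 < z.im} := isOpen_lt continuous_const continuous_im
    refine Integrable.mono' (((integrable_radial hγ).const_mul (4 * γ ^ 2 / ε ^ 2)).integrableOn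
      (s := {z : ℂ | 0 < z.im})) ?_ ?_
    · apply ContinuousOn.aestronglyMeasurable _ hopen.measurableSet
      intro z hz
      have hz : 0 < z.im := hz
      have h0 : z ≠ 0 := by rintro rfl; simp at hz
      exact (hvsm z hz.le h0).continuousAt.rexp.continuousWithinAt
    · rw [ae_restrict_iff' hopen.measurableSet]
      refine Eventually.of_forall fun z hz => ?_
      have hz : 0 < z.im := hz
      have h0 : z ≠ 0 := by rintro rfl; simp at hz
      have hn : 0 < ‖z‖ := norm_pos_iff.mpr h0
      rw [Real.norm_eq_abs, abs_of_pos (Real.exp_pos _), exp_vf h0 (hw z hz.le)]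
      have hl := hlow z hz.le
      have hc := Real.cosh_pos (γ * Real.log ‖z‖)
      have p1 : 0 < ‖z‖ * (ε * Real.cosh (γ * Real.log ‖z‖) / γ) := by positivity
      have p2 : ‖z‖ * (ε * Real.cosh (γ * Real.log ‖z‖) / γ) ≤ ‖z‖ * wf α β γ δ (Lf z) :=
        mul_le_mul_of_nonneg_left hl hn.le
      calc 1 / (‖z‖ * wf α β γ δ (Lf z)) ^ 2
          ≤ 1 / (‖z‖ * (ε * Real.cosh (γ * Real.log ‖z‖) / γ)) ^ 2 := by gcongr
        _ = γ ^ 2 / ε ^ 2 / (‖z‖ * Real.cosh (γ * Real.log ‖z‖)) ^ 2 := by field_simp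
        _ = _ := by
          rw [cosh_log hn]
          have q1 : 0 < ‖z‖ ^ (2 * γ - 2) := Real.rpow_pos_of_pos hn _
          have q2 : 0 < ‖z‖ ^ (2 * γ) := Real.rpow_pos_of_pos hn _
          field_simp

set_option maxHeartbeats 1000000 in
theorem existence_main {K c₁ c₂ : ℝ} (h : K = 1 ∨
     (K = 0 ∧ (c₁ < 0 ∨ c₂ < 0)) ∨
     (K = -1 ∧ (c₁ < -2 ∨ c₂ < -2 ∨ c₁ + c₂ < 0))) :
    ∃ v : ℂ → ℝ, IsSolutionP K c₁ c₂ v ∧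
      IntegrableOn (fun z => Real.exp (v z)) {z : ℂ | 0 < z.im} := by
  have hpi := Real.pi_pos
  obtain ⟨β, hβdef⟩ : ∃ β, β = |c₁| + |c₂| + 2 := ⟨_, rfl⟩
  have hβ2 : 2 ≤ β := by rw [hβdef]; linarith [abs_nonneg c₁, abs_nonneg c₂]
  have b1 : |c₁| ≤ β := by rw [hβdef]; linarith [abs_nonneg c₂]
  have b2 : |c₂| ≤ β := by rw [hβdef]; linarith [abs_nonneg c₁]
  rw [abs_le] at b1 b2
  have hβ : 0 < β := by linarith
  have l1 : c₁ / (2 * β) < 1 := by rw [div_lt_one (by positivity)]; linarith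
  have l1' : -1 < c₁ / (2 * β) := by rw [lt_div_iff₀ (by positivity)]; linarith
  have l2 : -c₂ / (2 * β) < 1 := by rw [div_lt_one (by positivity)]; linarith
  have l2' : -1 < -c₂ / (2 * β) := by rw [lt_div_iff₀ (by positivity)]; linarith
  obtain ⟨A, hA⟩ : ∃ A, A = Real.arcsin (c₁ / (2 * β)) := ⟨_, rfl⟩
  obtain ⟨B, hB⟩ : ∃ B, B = Real.arcsin (-c₂ / (2 * β)) := ⟨_, rfl⟩
  have sA : Real.sin A = c₁ / (2 * β) := by rw [hA]; exact Real.sin_arcsin l1'.le l1.le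
  have sB : Real.sin B = -c₂ / (2 * β) := by rw [hB]; exact Real.sin_arcsin l2'.le l2.le
  have A1 : A < Real.pi / 2 := by rw [hA]; exact Real.arcsin_lt_pi_div_two.mpr l1
  have A2 : -(Real.pi / 2) < A := by rw [hA]; exact Real.neg_pi_div_two_lt_arcsin.mpr l1'
  have B1 : B < Real.pi / 2 := by rw [hB]; exact Real.arcsin_lt_pi_div_two.mpr l2
  have B2 : -(Real.pi / 2) < B := by rw [hB]; exact Real.neg_pi_div_two_lt_arcsin.mpr l2'
  have fA : β * Real.sin A = c₁ / 2 := by rw [sA]; field_simp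
  have fB : β * Real.sin B = -c₂ / 2 := by rw [sB]; field_simp
  have hα0 : 0 ≤ β ^ 2 + K := by
    rcases h with rfl | ⟨rfl, -⟩ | ⟨rfl, -⟩ <;> nlinarith
  obtain ⟨α, hαdef⟩ : ∃ α, α = Real.sqrt (β ^ 2 + K) := ⟨_, rfl⟩
  have hα : 0 < α := by
    rw [hαdef]; apply Real.sqrt_pos.mpr
    rcases h with rfl | ⟨rfl, -⟩ | ⟨rfl, -⟩ <;> nlinarith
  have hα2 : α ^ 2 = β ^ 2 + K := by rw [hαdef]; exact Real.sq_sqrt hα0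
  have hK : α ^ 2 - β ^ 2 = K := by rw [hα2]; ring
  -- the two wide-angle configurations
  have fA' : β * Real.sin (-Real.pi - A) = c₁ / 2 := by
    rw [← fA, show -Real.pi - A = -(A + Real.pi) by ring, Real.sin_neg, Real.sin_add_pi, neg_neg]
  have fB' : β * Real.sin (Real.pi - B) = -c₂ / 2 := by rw [Real.sin_pi_sub, fB]
  have fin1 : 0 < α + β * Real.cos (-Real.pi - A) → A < 0 → ∃ v : ℂ → ℝ, IsSolutionP K c₁ c₂ v ∧
      IntegrableOn (fun z => Real.exp (v z)) {z : ℂ | 0 < z.im} := by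
    intro hp hA0
    refine existence_aux (δ := -Real.pi - A) (δ' := B) hα hK (by linarith) ?_ fA' fB
    rintro φ ⟨h1, h2⟩
    rcases le_or_gt 0 (Real.cos φ) with hc | hc
    · positivity
    · have : Real.cos (-Real.pi - A) ≤ Real.cos φ := by
        have hφ : φ < 0 := by
          by_contra hh
          push Not at hh
          linarith [Real.cos_nonneg_of_neg_pi_div_two_le_of_le (x := φ) (by linarith) (by linarith)]
        rw [← Real.cos_neg φ, ← Real.cos_neg (-Real.pi - A)]
        exact Real.cos_le_cos_of_nonneg_of_le_pi (by linarith) (by linarith) (by linarith)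
      nlinarith
  have fin2 : 0 < α + β * Real.cos (Real.pi - B) → 0 < B → ∃ v : ℂ → ℝ, IsSolutionP K c₁ c₂ v ∧
      IntegrableOn (fun z => Real.exp (v z)) {z : ℂ | 0 < z.im} := by
    intro hp hB0
    refine existence_aux (δ := A) (δ' := Real.pi - B) hα hK (by linarith) ?_ fA fB'
    rintro φ ⟨h1, h2⟩
    rcases le_or_gt 0 (Real.cos φ) with hc | hc
    · positivity
    · have : Real.cos (Real.pi - B) ≤ Real.cos φ := by
        have hφ : 0 < φ := by
          by_contra hh
          push Not at hh
          linarith [Real.cos_nonneg_of_neg_pi_div_two_le_of_le (x := φ) (by linarith) (by linarith)]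
        exact Real.cos_le_cos_of_nonneg_of_le_pi (by linarith) (by linarith) (by linarith)
      nlinarith
  have cA : Real.cos (-Real.pi - A) = - Real.cos A := by
    rw [show -Real.pi - A = -(A + Real.pi) by ring, Real.cos_neg, Real.cos_add_pi]
  have cB : Real.cos (Real.pi - B) = - Real.cos B := Real.cos_pi_sub B
  have cApos : 0 < Real.cos A := Real.cos_pos_of_mem_Ioo ⟨by linarith, by linarith⟩
  have cBpos : 0 < Real.cos B := Real.cos_pos_of_mem_Ioo ⟨by linarith, by linarith⟩
  have A0 : c₁ < 0 → A < 0 := by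
    intro h; rw [hA]; exact Real.arcsin_lt_zero.mpr (div_neg_of_neg_of_pos h (by positivity))
  have B0 : c₂ < 0 → 0 < B := by
    intro h; rw [hB]; exact Real.arcsin_pos.mpr (div_pos (by linarith) (by positivity))
  -- the criterion for positivity
  have qA : - K < (c₁ / 2) ^ 2 → 0 < α + β * Real.cos (-Real.pi - A) := by
    intro hq
    rw [cA]
    have : (β * Real.cos A) ^ 2 < α ^ 2 := by
      rw [hα2, mul_pow, Real.cos_sq', mul_sub, ← mul_pow, fA]; linarith
    have := lt_of_pow_lt_pow_left₀ 2 hα.le this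
    linarith
  have qB : - K < (-c₂ / 2) ^ 2 → 0 < α + β * Real.cos (Real.pi - B) := by
    intro hq
    rw [cB]
    have : (β * Real.cos B) ^ 2 < α ^ 2 := by
      rw [hα2, mul_pow, Real.cos_sq', mul_sub, ← mul_pow, fB]; linarith
    have := lt_of_pow_lt_pow_left₀ 2 hα.le this
    linarith
  rcases h with h | ⟨h, h' | h'⟩ | ⟨h, h' | h' | h'⟩
  · refine existence_aux (δ := A) (δ' := B + 2 * Real.pi) hα hK (by linarith) ?_ fA
      (by rw [Real.sin_add_two_pi, fB])
    intro φ _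
    have : β < α := by
      apply lt_of_pow_lt_pow_left₀ 2 hα.le; rw [hα2, h]; linarith
    have := mul_le_mul_of_nonneg_left (Real.neg_one_le_cos φ) hβ.le
    linarith
  · exact fin1 (qA (by rw [h]; nlinarith)) (A0 h')
  · exact fin2 (qB (by rw [h]; nlinarith)) (B0 h')
  · exact fin1 (qA (by rw [h]; nlinarith)) (A0 (by linarith))
  · exact fin2 (qB (by rw [h]; nlinarith)) (B0 (by linarith))
  · refine existence_aux (δ := A) (δ' := B) hα hK ?_ ?_ fA fB
    · rw [hA, hB]
      apply Real.arcsin_lt_arcsin l1'.le _ l2.le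
      apply div_lt_div_of_pos_right (by linarith) (by positivity)
    · rintro φ ⟨h1, h2⟩
      have := Real.cos_nonneg_of_neg_pi_div_two_le_of_le (x := φ) (by linarith) (by linarith)
      positivity

/-! ### Nonexistence -/

/-- The closed strip. -/
def Sc : Set ℂ := {ζ : ℂ | 0 ≤ ζ.im ∧ ζ.im ≤ Real.pi}

/-- The open strip. -/
def So : Set ℂ := {ζ : ℂ | 0 < ζ.im ∧ ζ.im < Real.pi}

lemma So_open : IsOpen So :=
  (isOpen_lt continuous_const continuous_im).inter (isOpen_lt continuous_im continuous_const)

lemma So_sub : So ⊆ Sc := fun _ h => ⟨h.1.le, h.2.le⟩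

lemma Sc_nhds {ζ : ℂ} (h : ζ ∈ So) : Sc ∈ nhds ζ := mem_of_superset (So_open.mem_nhds h) So_sub

lemma Sc_unique : UniqueDiffOn ℝ Sc := by
  refine uniqueDiffOn_convex ((convex_halfSpace_im_ge 0).inter (convex_halfSpace_im_le _)) ?_
  refine ⟨I, mem_interior_iff_mem_nhds.mpr (Sc_nhds ?_)⟩
  have := Real.pi_gt_three
  constructor <;> simp
  linarith

lemma mem_Sc {x θ : ℝ} (h : θ ∈ Icc 0 Real.pi) : (x + θ * I : ℂ) ∈ Sc := by
  constructor <;> simp [h.1, h.2]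

lemma mem_So {x θ : ℝ} (h : θ ∈ Ioo 0 Real.pi) : (x + θ * I : ℂ) ∈ So := by
  constructor <;> simp [h.1, h.2]

lemma hor_deriv {g : ℂ → ℝ} (hg : DifferentiableOn ℝ g Sc) {x θ : ℝ} (h : θ ∈ Icc 0 Real.pi) :
    HasDerivAt (fun y : ℝ => g (y + θ * I)) (fderivWithin ℝ g Sc (x + θ * I) 1) x := by
  have h1 := (hg _ (mem_Sc (x := x) h)).hasFDerivWithinAt
  have h2 : HasDerivWithinAt (fun y : ℝ => (y + θ * I : ℂ)) 1 univ x :=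
    ((ofRealCLM.hasDerivAt (x := x)).add_const (θ * I : ℂ)).hasDerivWithinAt
  have h3 := h1.comp_hasDerivWithinAt x h2 (fun y _ => mem_Sc h)
  rwa [hasDerivWithinAt_univ] at h3

lemma ver_deriv {g : ℂ → ℝ} (hg : DifferentiableOn ℝ g Sc) {x θ : ℝ} (h : θ ∈ Ioo 0 Real.pi) :
    HasDerivAt (fun y : ℝ => g (x + y * I)) (fderivWithin ℝ g Sc (x + θ * I) I) θ := by
  have h1 := (hg _ (mem_Sc (x := x) ⟨h.1.le, h.2.le⟩)).hasFDerivWithinAt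
  have h2 : HasDerivAt (fun y : ℝ => (x + y * I : ℂ)) (1 * I) θ :=
    ((ofRealCLM.hasDerivAt (x := θ)).mul_const I).const_add (x : ℂ)
  rw [one_mul] at h2
  exact (h1.hasFDerivAt (Sc_nhds (mem_So h))).comp_hasDerivAt θ h2

lemma cont_slice {g : ℂ → ℝ} (hg : ContinuousOn g Sc) (x : ℝ) :
    ContinuousOn (fun θ : ℝ => g (x + θ * I)) (Icc 0 Real.pi) :=
  hg.comp (by fun_prop) (fun _ h => mem_Sc h)

lemma param_deriv {g : ℂ → ℝ} (hg : DifferentiableOn ℝ g Sc)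
    (hc : ContinuousOn (fun ζ => fderivWithin ℝ g Sc ζ 1) Sc) (x : ℝ) :
    HasDerivAt (fun y : ℝ => ∫ θ in (0 : ℝ)..Real.pi, g (y + θ * I))
      (∫ θ in (0 : ℝ)..Real.pi, fderivWithin ℝ g Sc (x + θ * I) 1) x := by
  have hpi := Real.pi_pos
  have hu : Set.uIcc 0 Real.pi = Icc 0 Real.pi := uIcc_of_le hpi.le
  have hI : Set.uIoc 0 Real.pi ⊆ Icc 0 Real.pi := by
    rw [uIoc_of_le hpi.le]; exact Ioc_subset_Icc_self
  have h_int : ∀ {k : ℂ → ℝ}, ContinuousOn k Sc → ∀ y : ℝ,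
      IntervalIntegrable (fun θ : ℝ => k (y + θ * I)) volume 0 Real.pi := by
    intro k hk y
    apply ContinuousOn.intervalIntegrable
    rw [hu]; exact cont_slice hk y
  have hmeas : ∀ {k : ℂ → ℝ}, ContinuousOn k Sc → ∀ y : ℝ,
      AEStronglyMeasurable (fun θ : ℝ => k (y + θ * I)) (volume.restrict (Set.uIoc 0 Real.pi)) := by
    intro k hk y
    exact (intervalIntegrable_iff.mp (h_int hk y)).aestronglyMeasurable
  -- bound
  have hcomp : IsCompact ((fun p : ℝ × ℝ => (p.1 + p.2 * I : ℂ)) ''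
      (Icc (x - 1) (x + 1) ×ˢ Icc 0 Real.pi)) :=
    (isCompact_Icc.prod isCompact_Icc).image (by fun_prop)
  obtain ⟨C, hC⟩ := hcomp.exists_bound_of_continuousOn (f := fun ζ => fderivWithin ℝ g Sc ζ 1)
    (hc.mono (by rintro _ ⟨p, hp, rfl⟩; exact mem_Sc hp.2))
  refine (intervalIntegral.hasDerivAt_integral_of_dominated_loc_of_deriv_le
    (F := fun (y θ : ℝ) => g (y + θ * I)) (F' := fun (y θ : ℝ) => fderivWithin ℝ g Sc (y + θ * I) 1)
    (bound := fun _ => C) (s := Icc (x - 1) (x + 1))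
    (Icc_mem_nhds (by linarith) (by linarith)) ?_ ?_ ?_ ?_ ?_ ?_).2
  · exact Eventually.of_forall fun y => hmeas hg.continuousOn y
  · exact h_int hg.continuousOn x
  · exact hmeas hc x
  · refine Eventually.of_forall fun θ hθ y hy => ?_
    exact hC _ ⟨(y, θ), ⟨hy, hI hθ⟩, rfl⟩
  · simp
  · exact Eventually.of_forall fun θ hθ y hy => hor_deriv hg (hI hθ)

lemma convex_half {M M1 M2 : ℝ → ℝ} (h1 : ∀ x, HasDerivAt M (M1 x) x)
    (h2 : ∀ x, HasDerivAt M1 (M2 x) x) (h3 : ∀ x, 0 ≤ M2 x) :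
    (∀ x ∈ Ici (0 : ℝ), M 0 ≤ M x) ∨ (∀ x ∈ Iic (0 : ℝ), M 0 ≤ M x) := by
  have hmono : Monotone M1 := by
    apply monotone_of_deriv_nonneg (fun x => (h2 x).differentiableAt)
    intro x; rw [(h2 x).deriv]; exact h3 x
  have hd : Differentiable ℝ M := fun x => (h1 x).differentiableAt
  rcases le_total 0 (M1 0) with h | h
  · left
    have : MonotoneOn M (Ici 0) := by
      apply monotoneOn_of_deriv_nonneg (convex_Ici 0) hd.continuous.continuousOn
        hd.differentiableOn
      intro x hx
      rw [interior_Ici] at hx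
      rw [(h1 x).deriv]; exact h.trans (hmono (le_of_lt hx))
    intro x hx
    exact this self_mem_Ici hx hx
  · right
    have : AntitoneOn M (Iic 0) := by
      apply antitoneOn_of_deriv_nonpos (convex_Iic 0) hd.continuous.continuousOn
        hd.differentiableOn
      intro x hx
      rw [interior_Iic] at hx
      rw [(h1 x).deriv]; exact (hmono (le_of_lt hx)).trans h
    intro x hx
    exact this hx self_mem_Iic hx

lemma not_integrable_of_half {G : ℝ → ℝ} (hG : Integrable G) {c : ℝ} (hc : 0 < c)
    (h : (∀ x ∈ Ici (0 : ℝ), c ≤ G x) ∨ (∀ x ∈ Iic (0 : ℝ), c ≤ G x)) : False := by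
  have key : ∀ s : Set ℝ, MeasurableSet s → volume s = ⊤ → (∀ x ∈ s, c ≤ G x) → False := by
    intro s hs htop hb
    have h1 : IntegrableOn (fun _ : ℝ => c) s := by
      refine Integrable.mono' (hG.integrableOn (s := s)) (by fun_prop) ?_
      rw [ae_restrict_iff' hs]
      refine Eventually.of_forall fun x hx => ?_
      rw [Real.norm_eq_abs, abs_of_pos hc]; exact hb x hx
    rw [integrableOn_const_iff] at h1
    rcases h1 with h1 | h1
    · exact hc.ne' (by simpa using h1)
    · rw [htop] at h1; exact lt_irrefl _ h1
  rcases h with h | h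
  · exact key _ measurableSet_Ici Real.volume_Ici h
  · exact key _ measurableSet_Iic Real.volume_Iic h

lemma fubini_strip {g : ℂ → ℝ} (hg : IntegrableOn g So) :
    Integrable (fun x : ℝ => ∫ θ in Ioo 0 Real.pi, g (x + θ * I)) := by
  have hp := Complex.volume_preserving_equiv_real_prod.symm
  have h1 := (hp.integrableOn_comp_preimage (measurableEquivRealProd.symm.measurableEmbedding)
    (f := g) (s := So)).mpr hg
  have h2 : (measurableEquivRealProd.symm ⁻¹' So) = univ ×ˢ Ioo 0 Real.pi := by
    ext p; simp [So]
  rw [h2, IntegrableOn, Measure.volume_eq_prod, ← Measure.prod_restrict, Measure.restrict_univ] at h1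
  have h3 := h1.integral_prod_left
  refine h3.congr (Eventually.of_forall fun x => ?_)
  simp only [Function.comp_def]
  congr 1
  funext θ
  congr 1
  apply Complex.ext <;> simp

theorem strip_nonexist {f : ℂ → ℝ} {K a : ℝ} (hf : ContDiffOn ℝ 2 f Sc) (hpos : ∀ ζ, 0 < f ζ)
    (hK : a ^ 2 ≤ -4 * K)
    (hlap : ∀ ζ ∈ So, lap f ζ * f ζ = -K * f ζ ^ 4 + (fderiv ℝ f ζ 1 ^ 2 + fderiv ℝ f ζ I ^ 2))
    (hb0 : ∀ x : ℝ, -a * f x ^ 2 / 2 ≤ fderivWithin ℝ f Sc x I)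
    (hb1 : ∀ x : ℝ, fderivWithin ℝ f Sc (x + Real.pi * I) I ≤ -a * f (x + Real.pi * I) ^ 2 / 2)
    (h_int : IntegrableOn (fun ζ => f ζ ^ 2) So) : False := by
  have hpi := Real.pi_pos
  have hD : ContDiffOn ℝ 1 (fderivWithin ℝ f Sc) Sc := hf.fderivWithin Sc_unique (by norm_num)
  have hDe : ∀ e : ℂ, ContDiffOn ℝ 1 (fun ζ => fderivWithin ℝ f Sc ζ e) Sc :=
    fun e => hD.clm_apply contDiffOn_const
  have hDD : ∀ e : ℂ, ContinuousOn
      (fun ζ => fderivWithin ℝ (fun ζ => fderivWithin ℝ f Sc ζ e) Sc ζ e) Sc :=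
    fun e => ((hDe e).continuousOn_fderivWithin Sc_unique (by norm_num)).clm_apply continuousOn_const
  have hfd : DifferentiableOn ℝ f Sc := hf.differentiableOn (by norm_num)
  have hDd : ∀ e : ℂ, DifferentiableOn ℝ (fun ζ => fderivWithin ℝ f Sc ζ e) Sc :=
    fun e => (hDe e).differentiableOn (by norm_num)
  have e1 : ∀ ζ ∈ So, ∀ e : ℂ, fderivWithin ℝ f Sc ζ e = fderiv ℝ f ζ e := by
    intro ζ h e; rw [fderivWithin_of_mem_nhds (Sc_nhds h)]
  have e2 : ∀ ζ ∈ So, ∀ e : ℂ, fderivWithin ℝ (fun ζ => fderivWithin ℝ f Sc ζ e) Sc ζ e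
      = fderiv ℝ (fun w => fderiv ℝ f w e) ζ e := by
    intro ζ h e
    rw [fderivWithin_of_mem_nhds (Sc_nhds h)]
    have : (fun ζ => fderivWithin ℝ f Sc ζ e) =ᶠ[nhds ζ] fun w => fderiv ℝ f w e := by
      filter_upwards [So_open.mem_nhds h] with y hy
      exact e1 y hy e
    rw [this.fderiv_eq]
  set fxx := fun ζ => fderivWithin ℝ (fun ζ => fderivWithin ℝ f Sc ζ 1) Sc ζ 1 with hfxx
  set ftt := fun ζ => fderivWithin ℝ (fun ζ => fderivWithin ℝ f Sc ζ I) Sc ζ I with hftt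
  set ft := fun ζ => fderivWithin ℝ f Sc ζ I with hft
  have hpt : ∀ ζ ∈ So, -(ftt ζ + a * f ζ * ft ζ) ≤ fxx ζ := by
    intro ζ h
    have h1 : lap f ζ = fxx ζ + ftt ζ := by
      simp only [hfxx, hftt, lap]
      rw [← e2 ζ h 1, ← e2 ζ h I]
    have h2 := hlap ζ h
    rw [h1, ← e1 ζ h 1, ← e1 ζ h I] at h2
    change _ = _ + (_ + ft ζ ^ 2) at h2
    have h3 : 0 ≤ (fxx ζ + ftt ζ + a * f ζ * ft ζ) * f ζ := by
      have q : 0 ≤ (-4 * K - a ^ 2) * f ζ ^ 4 := mul_nonneg (by linarith) (by positivity)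
      nlinarith [sq_nonneg (ft ζ + a * f ζ ^ 2 / 2), sq_nonneg (fderivWithin ℝ f Sc ζ 1)]
    have := nonneg_of_mul_nonneg_left h3 (hpos ζ)
    linarith
  have hM2 : ∀ x : ℝ, 0 ≤ ∫ θ in (0 : ℝ)..Real.pi, fxx (x + θ * I) := by
    intro x
    have hPcont : ContinuousOn (fun ζ => ftt ζ + a * f ζ * ft ζ) Sc :=
      (hDD I).add ((continuousOn_const.mul hf.continuousOn).mul (hDe I).continuousOn)
    have hFTC := intervalIntegral.integral_eq_sub_of_hasDerivAt_of_le hpi.le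
      (f := fun θ : ℝ => ft (x + θ * I) + a * f (x + θ * I) ^ 2 / 2)
      (f' := fun θ : ℝ => ftt (x + θ * I) + a * f (x + θ * I) * ft (x + θ * I))
      ((cont_slice (hDe I).continuousOn x).add ((continuousOn_const.mul
        ((cont_slice hf.continuousOn x).pow 2)).div_const 2))
      (by
        intro θ hθ
        have d1 := ver_deriv (hDd I) (x := x) hθ
        have d2 := ver_deriv hfd (x := x) hθ
        refine (d1.add (((d2.pow 2).const_mul a).div_const 2)).congr_deriv ?_
        simp only [hftt, hft]
        push_cast
        ring)
      (by
        apply ContinuousOn.intervalIntegrable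
        rw [uIcc_of_le hpi.le]; exact cont_slice hPcont x)
    have hle : ∫ θ in (0 : ℝ)..Real.pi, -(ftt (x + θ * I) + a * f (x + θ * I) * ft (x + θ * I))
        ≤ ∫ θ in (0 : ℝ)..Real.pi, fxx (x + θ * I) := by
      apply intervalIntegral.integral_mono_on_of_le_Ioo hpi.le
      · apply ContinuousOn.intervalIntegrable
        rw [uIcc_of_le hpi.le]; exact (cont_slice hPcont x).neg
      · apply ContinuousOn.intervalIntegrable
        rw [uIcc_of_le hpi.le]; exact cont_slice (hDD 1) x
      · intro θ hθ
        exact hpt _ (mem_So hθ)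
    rw [intervalIntegral.integral_neg, hFTC] at hle
    have b0 := hb0 x
    have b1 := hb1 x
    simp only [ofReal_zero, zero_mul, add_zero] at hle
    change _ ≤ ft x at b0
    change ft _ ≤ _ at b1
    linarith
  have hM := fun x => param_deriv hfd (hDe 1).continuousOn x
  have hM1 := fun x => param_deriv (hDd 1) (hDD 1) x
  have hconv := convex_half hM hM1 hM2
  have hM0 : 0 < ∫ θ in (0 : ℝ)..Real.pi, f ((0 : ℝ) + θ * I) := by
    apply intervalIntegral.intervalIntegral_pos_of_pos_on
    · apply ContinuousOn.intervalIntegrable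
      rw [uIcc_of_le hpi.le]; exact cont_slice hf.continuousOn 0
    · intro θ _; exact hpos _
    · exact hpi
  set m := ∫ θ in (0 : ℝ)..Real.pi, f ((0 : ℝ) + θ * I) with hm
  have hlow : ∀ x : ℝ, m ≤ ∫ θ in (0 : ℝ)..Real.pi, f (x + θ * I) →
      m ^ 2 / Real.pi ≤ ∫ θ in Ioo 0 Real.pi, f (x + θ * I) ^ 2 := by
    intro x hx
    rw [← integral_Ioc_eq_integral_Ioo, ← intervalIntegral.integral_of_le hpi.le]
    have hfi : IntervalIntegrable (fun θ : ℝ => f (x + θ * I)) volume 0 Real.pi := by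
      apply ContinuousOn.intervalIntegrable
      rw [uIcc_of_le hpi.le]; exact cont_slice hf.continuousOn x
    have : ∫ θ in (0 : ℝ)..Real.pi, (2 * (m / Real.pi) * f (x + θ * I) - (m / Real.pi) ^ 2)
        ≤ ∫ θ in (0 : ℝ)..Real.pi, f (x + θ * I) ^ 2 := by
      apply intervalIntegral.integral_mono_on hpi.le
      · exact (hfi.const_mul _).sub (by simp)
      · apply ContinuousOn.intervalIntegrable
        rw [uIcc_of_le hpi.le]; exact (cont_slice hf.continuousOn x).pow 2
      · intro θ _
        nlinarith [sq_nonneg (f (x + θ * I) - m / Real.pi)]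
    refine le_trans ?_ this
    rw [intervalIntegral.integral_sub (hfi.const_mul _) (by simp),
      intervalIntegral.integral_const_mul, intervalIntegral.integral_const]
    have h2 : m / Real.pi * m ≤ m / Real.pi * ∫ θ in (0 : ℝ)..Real.pi, f (x + θ * I) :=
      mul_le_mul_of_nonneg_left hx (by positivity)
    have h3 : m ^ 2 / Real.pi = 2 * (m / Real.pi * m) - (Real.pi - 0) • (m / Real.pi) ^ 2 := by
      simp only [smul_eq_mul]; field_simp; ring
    rw [h3]; linarith
  refine not_integrable_of_half (fubini_strip h_int) (c := m ^ 2 / Real.pi) (by positivity) ?_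
  rcases hconv with h | h
  · exact Or.inl fun x hx => hlow x (h x hx)
  · exact Or.inr fun x hx => hlow x (h x hx)

lemma exp_im_nonneg {ζ : ℂ} (h : ζ ∈ Sc) : 0 ≤ (Complex.exp ζ).im := by
  rw [exp_im]
  exact mul_nonneg (Real.exp_pos _).le (Real.sin_nonneg_of_nonneg_of_le_pi h.1 h.2)

lemma exp_im_pos {ζ : ℂ} (h : ζ ∈ So) : 0 < (Complex.exp ζ).im := by
  rw [exp_im]
  exact mul_pos (Real.exp_pos _) (Real.sin_pos_of_pos_of_lt_pi h.1 h.2)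

lemma exp_image_So : Complex.exp '' So = {z : ℂ | 0 < z.im} := by
  ext z
  constructor
  · rintro ⟨ζ, h, rfl⟩; exact exp_im_pos h
  · intro h
    have h : 0 < z.im := h
    have h0 : z ≠ 0 := by rintro rfl; simp at h
    refine ⟨Complex.log z, ?_, Complex.exp_log h0⟩
    constructor
    · rw [Complex.log_im]
      refine lt_of_le_of_ne (arg_nonneg_iff.mpr h.le) ?_
      intro hh
      have := (arg_eq_zero_iff.mp hh.symm).2
      linarith
    · rw [Complex.log_im]
      refine lt_of_le_of_ne (arg_le_pi z) ?_
      intro hh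
      have := (arg_eq_pi_iff.mp hh).2
      linarith

lemma exp_injOn : InjOn Complex.exp So := by
  intro a ha b hb hab
  have := Real.pi_pos
  exact Complex.exp_inj_of_neg_pi_lt_of_le_pi (by linarith [ha.1]) (by linarith [ha.2])
    (by linarith [hb.1]) (by linarith [hb.2]) hab

lemma det_mul (c : ℂ) : (c • (1 : ℂ →L[ℝ] ℂ)).det = normSq c := by
  rw [← Algebra.norm_complex_apply, Algebra.norm_apply]
  rfl

lemma strip_integrable {v : ℂ → ℝ}
    (h : IntegrableOn (fun z => Real.exp (v z)) {z : ℂ | 0 < z.im}) :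
    IntegrableOn (fun ζ => Real.exp (v (Complex.exp ζ) / 2 + ζ.re) ^ 2) So := by
  rw [← exp_image_So, integrableOn_image_iff_integrableOn_abs_det_fderiv_smul volume
    So_open.measurableSet (f' := fun ζ => Complex.exp ζ • (1 : ℂ →L[ℝ] ℂ))
    (fun ζ _ => (Complex.hasDerivAt_exp ζ).complexToReal_fderiv.hasFDerivWithinAt) exp_injOn] at h
  refine h.congr_fun ?_ So_open.measurableSet
  intro ζ _
  simp only [det_mul, smul_eq_mul]
  rw [abs_of_nonneg (normSq_nonneg _), normSq_eq_norm_sq, Complex.norm_exp, ← Real.exp_nat_mul,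
    ← Real.exp_nat_mul, ← Real.exp_add]
  congr 1
  push_cast
  ring

theorem nonexist {K c₁ c₂ a : ℝ} (hK : a ^ 2 ≤ -4 * K) (h1 : -a ≤ c₁) (h2 : a ≤ c₂) {v : ℂ → ℝ}
    (hv : IsSolutionP K c₁ c₂ v)
    (h_int : IntegrableOn (fun z => Real.exp (v z)) {z : ℂ | 0 < z.im}) : False := by
  obtain ⟨hsm, hl, hb1, hb2⟩ := hv
  have hmaps : MapsTo Complex.exp Sc ({z : ℂ | 0 ≤ z.im} \ {0}) :=
    fun ζ h => ⟨exp_im_nonneg h, Complex.exp_ne_zero ζ⟩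
  have hexp : ContDiff ℝ 2 Complex.exp := Complex.contDiff_exp
  have hg : ContDiffOn ℝ 2 (fun ζ => v (Complex.exp ζ)) Sc :=
    hsm.comp hexp.contDiffOn hmaps
  have hre : ContDiff ℝ 2 (fun z : ℂ => z.re) := reCLM.contDiff
  have hf : ContDiffOn ℝ 2 (fun ζ => Real.exp (v (Complex.exp ζ) / 2 + ζ.re)) Sc :=
    ((hg.div_const 2).add hre.contDiffOn).exp
  -- boundary derivative
  have hbd : ∀ ζ ∈ Sc, ∀ s : ℝ, s ≠ 0 → Complex.exp ζ = s →
      fderivWithin ℝ (fun ζ => Real.exp (v (Complex.exp ζ) / 2 + ζ.re)) Sc ζ I =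
      Real.exp (v (Complex.exp ζ) / 2 + ζ.re) * (s * dnu v s / 2) := by
    intro ζ hζ s hs hes
    have hs0 : (s : ℂ) ≠ 0 := by exact_mod_cast hs
    have hsH : (s : ℂ) ∈ {z : ℂ | 0 ≤ z.im} \ {0} := ⟨by simp, hs0⟩
    have hvd : DifferentiableWithinAt ℝ v {z : ℂ | 0 ≤ z.im} (s : ℂ) := by
      refine (hsm.differentiableOn (by norm_num) _ hsH).mono_of_mem_nhdsWithin ?_
      exact inter_mem_nhdsWithin _ (isOpen_compl_singleton.mem_nhds hs0)
    have d0 := hvd.hasFDerivWithinAt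
    rw [← hes] at d0
    have d1 := d0.comp ζ ((Complex.hasDerivAt_exp ζ).complexToReal_fderiv.hasFDerivWithinAt (s := Sc))
      (fun y hy => exp_im_nonneg hy)
    have d2 := ((d1.mul_const (2⁻¹ : ℝ)).add (hasFDerivAt_re ζ).hasFDerivWithinAt).exp
    have d3 : HasFDerivWithinAt (fun ζ => Real.exp (v (Complex.exp ζ) / 2 + ζ.re)) _ Sc ζ := d2
    rw [d3.fderivWithin (Sc_unique ζ hζ)]
    have e1 : fderivWithin ℝ v {z : ℂ | 0 ≤ z.im} (s : ℂ) (s * I) = s * dnu v s := by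
      have : (s * I : ℂ) = s • I := by simp
      rw [this, map_smul]; rfl
    simp [hes, e1]
    rw [div_eq_mul_inv (v (s : ℂ))]
    ring
  refine strip_nonexist (f := fun ζ => Real.exp (v (Complex.exp ζ) / 2 + ζ.re)) (K := K) (a := a)
    hf (fun ζ => Real.exp_pos _) hK ?_ ?_ ?_ (strip_integrable h_int)
  · intro ζ hζ
    have hgc : ContDiffAt ℝ 2 (fun ζ => v (Complex.exp ζ)) ζ := hg.contDiffAt (Sc_nhds hζ)
    have hz := exp_im_pos hζ
    have hvc : ContDiffAt ℝ 2 v (Complex.exp ζ) := by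
      refine hsm.contDiffAt ?_
      have : {z : ℂ | 0 < z.im} ∈ nhds (Complex.exp ζ) :=
        (isOpen_lt continuous_const continuous_im).mem_nhds hz
      refine mem_of_superset this fun y hy => ?_
      have hy : 0 < y.im := hy
      exact ⟨hy.le, by rintro rfl; simp at hy⟩
    have hlg := lap_comp (v := v) (ζ := ζ) (Eventually.of_forall fun w => Complex.hasDerivAt_exp w)
      (Complex.hasDerivAt_exp ζ) hvc
    have hlv := hl _ hz
    set g := fun ζ => v (Complex.exp ζ) with hgdef
    have hfd : ∀ y, DifferentiableAt ℝ g y → HasFDerivAt (fun ζ => Real.exp (g ζ / 2 + ζ.re))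
        (Real.exp (g y / 2 + y.re) • (((2 : ℝ)⁻¹) • fderiv ℝ g y + reCLM)) y := by
      intro y hy
      exact ((hy.hasFDerivAt.mul_const (2⁻¹ : ℝ)).add (hasFDerivAt_re y)).exp
    have hev : ∀ᶠ y in nhds ζ, DifferentiableAt ℝ g y := by
      filter_upwards [hgc.eventually (by simp)] with y hy
      exact hy.differentiableAt (by norm_num)
    have hD : DifferentiableAt ℝ (fderiv ℝ g) ζ :=
      (hgc.fderiv_right (m := 1) (by norm_num)).differentiableAt (by norm_num)
    have hgζ := hgc.differentiableAt (by norm_num)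
    have second : ∀ e : ℂ, fderiv ℝ (fun w => fderiv ℝ (fun ζ => Real.exp (g ζ / 2 + ζ.re)) w e) ζ e
        = Real.exp (g ζ / 2 + ζ.re) * ((fderiv ℝ g ζ e / 2 + e.re) ^ 2
          + fderiv ℝ (fun w => fderiv ℝ g w e) ζ e / 2) := by
      intro e
      have ee : (fun w => fderiv ℝ (fun ζ => Real.exp (g ζ / 2 + ζ.re)) w e) =ᶠ[nhds ζ]
          fun w => Real.exp (g w / 2 + w.re) * (fderiv ℝ g w e * 2⁻¹ + e.re) := by
        filter_upwards [hev] with y hy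
        rw [(hfd y hy).fderiv]
        simp
        ring
      rw [ee.fderiv_eq]
      have hDe : DifferentiableAt ℝ (fun w => fderiv ℝ g w e) ζ :=
        hD.clm_apply (differentiableAt_const e)
      have := ((hfd ζ hgζ).mul ((hDe.hasFDerivAt.mul_const (2⁻¹ : ℝ)).add_const e.re)).fderiv
      have h' : fderiv ℝ (fun w => Real.exp (g w / 2 + w.re) * (fderiv ℝ g w e * 2⁻¹ + e.re)) ζ = _ :=
        this
      rw [h']
      simp
      ring
    have hF1 : fderiv ℝ (fun ζ => Real.exp (g ζ / 2 + ζ.re)) ζ 1 =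
        Real.exp (g ζ / 2 + ζ.re) * (fderiv ℝ g ζ 1 / 2 + 1) := by
      rw [(hfd ζ hgζ).fderiv]; simp; ring
    have hFI : fderiv ℝ (fun ζ => Real.exp (g ζ / 2 + ζ.re)) ζ I =
        Real.exp (g ζ / 2 + ζ.re) * (fderiv ℝ g ζ I / 2) := by
      rw [(hfd ζ hgζ).fderiv]; simp; ring
    have hF2 : Real.exp (g ζ / 2 + ζ.re) ^ 2 = normSq (Complex.exp ζ) * Real.exp (g ζ) := by
      rw [normSq_eq_norm_sq, Complex.norm_exp, ← Real.exp_nat_mul,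
        ← Real.exp_nat_mul, ← Real.exp_add]
      congr 1
      push_cast
      ring
    have hlapg : lap g ζ = -2 * K * Real.exp (g ζ / 2 + ζ.re) ^ 2 := by
      rw [hF2, hlg]
      have : lap v (Complex.exp ζ) = -2 * K * Real.exp (g ζ) := by
        simp only [hgdef]; linarith
      rw [this]; ring
    have hlapf : lap (fun ζ => Real.exp (g ζ / 2 + ζ.re)) ζ =
        Real.exp (g ζ / 2 + ζ.re) * ((fderiv ℝ g ζ 1 / 2 + 1) ^ 2 + (fderiv ℝ g ζ I / 2) ^ 2
          + lap g ζ / 2) := by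
      unfold lap
      rw [second, second]
      simp only [one_re, I_re]
      ring
    change lap (fun ζ => Real.exp (g ζ / 2 + ζ.re)) ζ * Real.exp (g ζ / 2 + ζ.re) =
      -K * Real.exp (g ζ / 2 + ζ.re) ^ 4 +
      (fderiv ℝ (fun ζ => Real.exp (g ζ / 2 + ζ.re)) ζ 1 ^ 2 +
        fderiv ℝ (fun ζ => Real.exp (g ζ / 2 + ζ.re)) ζ I ^ 2)
    rw [hlapf, hF1, hFI, hlapg]
    ring
  · intro x
    have hx := Real.exp_pos x
    have hζ : (x : ℂ) ∈ Sc := by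
      constructor <;> simp [Real.pi_pos.le]
    have he : Complex.exp (x : ℂ) = ((Real.exp x : ℝ) : ℂ) := by simp
    rw [hbd x hζ (Real.exp x) hx.ne' he, hb1 _ hx]
    have hE : Real.exp (v (Complex.exp x) / 2 + (x : ℂ).re) =
        Real.exp x * Real.exp (v ((Real.exp x : ℝ) : ℂ) / 2) := by
      rw [Real.exp_add, he, ofReal_re, mul_comm]
    rw [hE]
    set E := Real.exp x * Real.exp (v ((Real.exp x : ℝ) : ℂ) / 2)
    have : E * (Real.exp x * (c₁ * Real.exp (v ((Real.exp x : ℝ) : ℂ) / 2)) / 2) = c₁ * E ^ 2 / 2 := by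
      simp only [E]; ring
    rw [this]
    have := mul_le_mul_of_nonneg_right h1 (sq_nonneg E)
    linarith
  · intro x
    have hx := Real.exp_pos x
    have hζ : (x + Real.pi * I : ℂ) ∈ Sc := mem_Sc ⟨Real.pi_pos.le, le_rfl⟩
    have he : Complex.exp (x + Real.pi * I : ℂ) = ((-Real.exp x : ℝ) : ℂ) := by
      rw [Complex.exp_add, Complex.exp_pi_mul_I]; simp
    rw [hbd _ hζ (-Real.exp x) (by linarith) he, hb2 _ (by linarith)]
    have hE : Real.exp (v (Complex.exp (x + Real.pi * I : ℂ)) / 2 + (x + Real.pi * I : ℂ).re) =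
        Real.exp x * Real.exp (v ((-Real.exp x : ℝ) : ℂ) / 2) := by
      rw [Real.exp_add, he, mul_comm]; simp
    rw [hE]
    set E := Real.exp x * Real.exp (v ((-Real.exp x : ℝ) : ℂ) / 2)
    have : E * (-Real.exp x * (c₂ * Real.exp (v ((-Real.exp x : ℝ) : ℂ) / 2)) / 2)
        = -(c₂ * E ^ 2 / 2) := by
      simp only [E]; ring
    rw [this]
    have := mul_le_mul_of_nonneg_right h2 (sq_nonneg E)
    linarith

/-- given K ∈ {−1,0,1} and c₁, c₂ ∈ ℝ, a finite-area solution of problem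
(P) exists if and only if K = 1, or K = 0 and some cᵢ < 0, or K = −1 and
(c₁ < −2 or c₂ < −2 or c₁ + c₂ < 0). -/
theorem existence_of_finite_area_solutions
    (K c₁ c₂ : ℝ) (hK : K = -1 ∨ K = 0 ∨ K = 1) :
    (∃ v : ℂ → ℝ, IsSolutionP K c₁ c₂ v ∧
      IntegrableOn (fun z => Real.exp (v z)) {z : ℂ | 0 < z.im}) ↔
    (K = 1 ∨
     (K = 0 ∧ (c₁ < 0 ∨ c₂ < 0)) ∨
     (K = -1 ∧ (c₁ < -2 ∨ c₂ < -2 ∨ c₁ + c₂ < 0))) := by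
  constructor
  · rintro ⟨v, hv, h_int⟩
    by_contra hc
    push Not at hc
    obtain ⟨n1, n0, nm⟩ := hc
    rcases hK with h | h | h
    · obtain ⟨m1, m2, m3⟩ := nm h
      rcases le_total c₁ 0 with hc1 | hc1
      · exact nonexist (a := -c₁) (by rw [h]; nlinarith) (by linarith) (by linarith) hv h_int
      · rcases le_total c₂ 0 with hc2 | hc2
        · exact nonexist (a := c₂) (by rw [h]; nlinarith) (by linarith) le_rfl hv h_int
        · exact nonexist (a := 0) (by rw [h]; norm_num) (by linarith) hc2 hv h_int
    · obtain ⟨m1, m2⟩ := n0 h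
      exact nonexist (a := 0) (by rw [h]; norm_num) (by linarith) m2 hv h_int
    · exact n1 h
  · exact existence_main
end
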